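/- There exist universal constants c0, c, c', C1, C2 > 0 such that for all integers k ≥ 2 and n ≥ 1: if n ≥ c0·k/log k then C1·((k/(n·log k))² + (log k)²/n) ≤ R*(k,n) ≤ C2·((k/(n·log k))² + (log k)²/n); and if n ≤ c·k/log k then R*(k,n) ≥ c'. -/

import Mathlib

open scoped BigOperators
open Real

noncomputable section

/-- The set of probability vectors on `Fin k`. -/
def probVec (k : ℕ) : Set (Fin k → ℝ) := {P | (∀ i, 0 ≤ P i) ∧ (∑ i, P i) = 1}

/-- Shannon entropy `H(P) = ∑ pᵢ log (1/pᵢ)` (natural log, `0·log(1/0) = 0`). -/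
def entropy {k : ℕ} (P : Fin k → ℝ) : ℝ := ∑ i, P i * Real.log (1 / P i)

/-- The multinomial probability mass function of the histogram `N` of `n` i.i.d. samples
from `P`. -/
def multinomialPMF {k : ℕ} (n : ℕ) (P : Fin k → ℝ) (N : Fin k → ℕ) : ℝ :=
  if (∑ i, N i) = n then
    (n.factorial : ℝ) / (∏ i, ((N i).factorial : ℝ)) * ∏ i, P i ^ (N i)
  else 0

/-- Mean squared error of the estimator `est` of the entropy, from the histogram of
`n` i.i.d. samples of `P`. -/
def mseIID {k : ℕ} (n : ℕ) (P : Fin k → ℝ) (est : (Fin k → ℕ) → ℝ) : ℝ :=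
  ∑' N : Fin k → ℕ, multinomialPMF n P N * (est N - entropy P) ^ 2

/-- The minimax quadratic risk `R*(k,n)` of entropy estimation. -/
def Rstar (k n : ℕ) : ℝ :=
  ⨅ est : (Fin k → ℕ) → ℝ, ⨆ P : probVec k, mseIID n P.1 est

/-- The histogram of a single sample. -/
def ei {k : ℕ} (i : Fin k) : Fin k → ℕ := fun j => if j = i then 1 else 0

lemma ei_apply {k : ℕ} (i j : Fin k) : ei i j = if j = i then 1 else 0 := rfl

lemma sum_ei {k : ℕ} (i : Fin k) : ∑ j, ei i j = 1 := by simp [ei_apply]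

/-- Expectation over the histogram of `n` i.i.d. samples from `p`, defined recursively. -/
def Ex {k : ℕ} (p : Fin k → ℝ) : ℕ → ((Fin k → ℕ) → ℝ) → ℝ
  | 0, f => f 0
  | n + 1, f => ∑ i, p i * Ex p n (fun M => f (M + ei i))

/-- Expectation over a binomial variable, defined recursively. -/
def Bx (p : ℝ) : ℕ → (ℕ → ℝ) → ℝ
  | 0, g => g 0
  | n + 1, g => p * Bx p n (fun m => g (m + 1)) + (1 - p) * Bx p n g

section ExLemmas

variable {k : ℕ} (p : Fin k → ℝ)

lemma Ex_add (n : ℕ) (f g : (Fin k → ℕ) → ℝ) :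
    Ex p n (fun M => f M + g M) = Ex p n f + Ex p n g := by
  induction n generalizing f g with
  | zero => simp [Ex]
  | succ n ih =>
    simp only [Ex]
    rw [← Finset.sum_add_distrib]
    refine Finset.sum_congr rfl fun i _ => ?_
    rw [ih (fun M => f (M + ei i)) (fun M => g (M + ei i))]; ring

lemma Ex_mul (n : ℕ) (c : ℝ) (f : (Fin k → ℕ) → ℝ) :
    Ex p n (fun M => c * f M) = c * Ex p n f := by
  induction n generalizing f with
  | zero => simp [Ex]
  | succ n ih =>
    simp only [Ex]
    rw [Finset.mul_sum]
    refine Finset.sum_congr rfl fun i _ => ?_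
    rw [ih (fun M => f (M + ei i))]; ring

lemma Ex_sub (n : ℕ) (f g : (Fin k → ℕ) → ℝ) :
    Ex p n (fun M => f M - g M) = Ex p n f - Ex p n g := by
  have h := Ex_add p n f (fun M => (-1) * g M)
  rw [Ex_mul] at h
  have : (fun M => f M - g M) = (fun M => f M + (-1) * g M) := by funext M; ring
  rw [this, h]; ring

lemma Ex_zero (n : ℕ) : Ex p n (fun _ => 0) = 0 := by
  have := Ex_mul p n 0 (fun _ => 0)
  simpa using this

lemma Ex_sum {ι : Type*} (s : Finset ι) (n : ℕ) (f : ι → (Fin k → ℕ) → ℝ) :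
    Ex p n (fun M => ∑ a ∈ s, f a M) = ∑ a ∈ s, Ex p n (f a) := by
  classical
  induction s using Finset.induction_on with
  | empty => simp [Ex_zero]
  | insert a s ha ih =>
    simp only [Finset.sum_insert ha]
    rw [Ex_add p n (f a) (fun M => ∑ a ∈ s, f a M), ih]

lemma Ex_const (hp : ∑ i, p i = 1) (n : ℕ) (c : ℝ) : Ex p n (fun _ => c) = c := by
  induction n with
  | zero => simp [Ex]
  | succ n ih => simp only [Ex, ih]; rw [← Finset.sum_mul, hp, one_mul]

lemma Ex_mono (hp : ∀ i, 0 ≤ p i) (n : ℕ) (f g : (Fin k → ℕ) → ℝ)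
    (h : ∀ M, ∑ i, M i = n → f M ≤ g M) : Ex p n f ≤ Ex p n g := by
  induction n generalizing f g with
  | zero => simp only [Ex]; exact h 0 (by simp)
  | succ n ih =>
    simp only [Ex]
    refine Finset.sum_le_sum fun i _ => mul_le_mul_of_nonneg_left ?_ (hp i)
    refine ih _ _ fun M hM => h _ ?_
    simp [Finset.sum_add_distrib, hM, sum_ei]

lemma Ex_congr (n : ℕ) (f g : (Fin k → ℕ) → ℝ)
    (h : ∀ M, ∑ i, M i = n → f M = g M) : Ex p n f = Ex p n g := by
  induction n generalizing f g with
  | zero => simp only [Ex]; exact h 0 (by simp)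
  | succ n ih =>
    simp only [Ex]
    refine Finset.sum_congr rfl fun i _ => ?_
    rw [ih _ _ fun M hM => h _ ?_]
    simp [Finset.sum_add_distrib, hM, sum_ei]

lemma Ex_nonneg (hp : ∀ i, 0 ≤ p i) (n : ℕ) (f : (Fin k → ℕ) → ℝ)
    (h : ∀ M, 0 ≤ f M) : 0 ≤ Ex p n f := by
  have := Ex_mono p hp n (fun _ => 0) f (fun M _ => h M)
  rwa [Ex_zero] at this

lemma Ex_marginal (hp : ∑ i, p i = 1) (n : ℕ) (j : Fin k) (g : ℕ → ℝ) :
    Ex p n (fun M => g (M j)) = Bx (p j) n g := by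
  induction n generalizing g with
  | zero => simp [Ex, Bx]
  | succ n ih =>
    simp only [Ex, Bx]
    rw [← Finset.add_sum_erase _ _ (Finset.mem_univ j)]
    congr 1
    · congr 1
      rw [← ih]; simp [ei_apply]
    · have : ∀ i ∈ Finset.univ.erase j, p i * Ex p n (fun M => g ((M + ei i) j))
          = p i * Bx (p j) n g := by
        intro i hi
        rw [← ih]
        have hij : j ≠ i := (Finset.ne_of_mem_erase hi).symm
        simp [ei_apply, hij]
      rw [Finset.sum_congr rfl this, ← Finset.sum_mul]
      congr 1
      have := Finset.add_sum_erase Finset.univ p (Finset.mem_univ j)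
      rw [hp] at this; linarith

lemma Ex_sq_nonneg (hp : ∀ i, 0 ≤ p i) (hs : ∑ i, p i = 1) (n : ℕ) (f : (Fin k → ℕ) → ℝ) :
    (Ex p n f) ^ 2 ≤ Ex p n (fun M => f M ^ 2) := by
  have h := Ex_nonneg p hp n (fun M => (f M - Ex p n f) ^ 2) (fun M => sq_nonneg _)
  have e : (fun M => (f M - Ex p n f) ^ 2) =
      (fun M => (f M ^ 2 - (2 * Ex p n f) * f M) + (Ex p n f) ^ 2) := by funext M; ring
  rw [e, Ex_add p n (fun M => f M ^ 2 - (2 * Ex p n f) * f M), Ex_sub p n (fun M => f M ^ 2),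
    Ex_mul, Ex_const p hs] at h
  nlinarith

/-- Efron-Stein type inequality. -/
lemma Ex_var (hp : ∀ i, 0 ≤ p i) (hs : ∑ i, p i = 1) (n : ℕ) (f : (Fin k → ℕ) → ℝ) :
    Ex p (n + 1) (fun M => f M ^ 2) - (Ex p (n + 1) f) ^ 2 ≤
      (n + 1) * Ex p n (fun M => ∑ j, p j * (f (M + ei j) - f M) ^ 2) := by
  -- one-step bound for any n
  have step : ∀ (n : ℕ) (f : (Fin k → ℕ) → ℝ),
      ∑ i, p i * (Ex p n (fun M => f (M + ei i))) ^ 2 - (Ex p (n + 1) f) ^ 2 ≤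
      Ex p n (fun M => ∑ j, p j * (f (M + ei j) - f M) ^ 2) := by
    intro n f
    rw [Ex_sum]
    set a : Fin k → ℝ := fun i => Ex p n (fun M => f (M + ei i)) with ha
    have h1 : Ex p (n + 1) f = ∑ i, p i * a i := rfl
    have h2 : ∀ i, (a i - Ex p n f) ^ 2 ≤ Ex p n (fun M => (f (M + ei i) - f M) ^ 2) := by
      intro i
      rw [ha]
      rw [← Ex_sub p n]
      exact Ex_sq_nonneg p hp hs n _
    have h3 : ∑ i, p i * (a i) ^ 2 - (∑ i, p i * a i) ^ 2 ≤ ∑ i, p i * (a i - Ex p n f) ^ 2 := by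
      have : ∑ i, p i * (a i - Ex p n f) ^ 2 =
          ∑ i, p i * (a i) ^ 2 - 2 * Ex p n f * ∑ i, p i * a i + (Ex p n f) ^ 2 * ∑ i, p i := by
        rw [Finset.mul_sum, Finset.mul_sum, ← Finset.sum_sub_distrib, ← Finset.sum_add_distrib]
        refine Finset.sum_congr rfl fun i _ => ?_
        ring
      rw [this, hs]
      nlinarith [sq_nonneg (∑ i, p i * a i - Ex p n f)]
    rw [h1]
    refine h3.trans (Finset.sum_le_sum fun i _ => ?_)
    rw [Ex_mul]
    exact mul_le_mul_of_nonneg_left (h2 i) (hp i)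
  induction n generalizing f with
  | zero =>
    have := step 0 f
    simpa [Ex] using this
  | succ n ih =>
    have h1 := step (n + 1) f
    have h2 : ∀ i, p i * (Ex p (n + 1) (fun M => f (M + ei i) ^ 2)
        - (Ex p (n + 1) (fun M => f (M + ei i))) ^ 2) ≤
        p i * ((n + 1) * Ex p n (fun M => ∑ j, p j *
          (f (M + ei i + ei j) - f (M + ei i)) ^ 2)) := by
      intro i
      refine mul_le_mul_of_nonneg_left ?_ (hp i)
      refine (ih (fun M => f (M + ei i))).trans (le_of_eq ?_)
      congr 2
      funext M
      refine Finset.sum_congr rfl fun j _ => ?_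
      rw [add_right_comm]
    have h3 := Finset.sum_le_sum (fun i (_ : i ∈ Finset.univ) => h2 i)
    have e1 : Ex p (n + 1 + 1) (fun M => f M ^ 2) =
      ∑ i, p i * Ex p (n + 1) (fun M => f (M + ei i) ^ 2) := rfl
    have e2 : Ex p (n + 1) (fun M => ∑ j, p j * (f (M + ei j) - f M) ^ 2) =
      ∑ i, p i * Ex p n (fun M => ∑ j, p j *
          (f (M + ei i + ei j) - f (M + ei i)) ^ 2) := rfl
    have e3 : ∑ i, p i * ((n + 1) * Ex p n (fun M => ∑ j, p j *
          (f (M + ei i + ei j) - f (M + ei i)) ^ 2)) =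
          (n + 1) * Ex p (n + 1) (fun M => ∑ j, p j * (f (M + ei j) - f M) ^ 2) := by
      rw [e2, Finset.mul_sum]
      refine Finset.sum_congr rfl fun i _ => by ring
    rw [e3] at h3
    simp only [mul_sub, Finset.sum_sub_distrib] at h3
    rw [← e1] at h3
    push_cast
    linarith

lemma Ex_onestep (n : ℕ) (i : Fin k) (F : (Fin k → ℕ) → ℝ) :
    Ex p (n + 1) (fun N => (N i : ℝ) * F (N - ei i)) = (n + 1) * p i * Ex p n F := by
  induction n generalizing F with
  | zero =>
    simp only [Ex]
    rw [Finset.sum_eq_single i]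
    · simp [ei_apply]
    · intro j _ hj
      simp [ei_apply, hj.symm]
    · simp
  | succ n ih =>
    have key : ∀ j, Ex p (n + 1) (fun M => (((M + ei j) i : ℕ) : ℝ) *
        F (M + ei j - ei i)) =
        (if j = i then Ex p (n + 1) F else 0)
          + (n + 1) * p i * Ex p n (fun M => F (M + ei j)) := by
      intro j
      rw [← ih (fun M => F (M + ei j))]
      have h0 : (if j = i then Ex p (n + 1) F else 0) =
          Ex p (n + 1) (fun M => if j = i then F M else 0) := by
        split_ifs <;> simp [Ex_zero]
      rw [h0, ← Ex_add]
      congr 1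
      funext M
      have h1 : (M i : ℝ) * F (M + ei j - ei i) =
          (M i : ℝ) * F (M - ei i + ei j) := by
        rcases Nat.eq_zero_or_pos (M i) with h | h
        · simp [h]
        · congr 2
          funext l
          simp only [Pi.add_apply, Pi.sub_apply, ei_apply]
          by_cases hl : l = i
          · subst hl; simp; split_ifs <;> omega
          · simp [hl]
      by_cases hji : j = i
      · subst hji
        simp only [if_true]
        rw [← h1]
        have : M + ei j - ei j = M := by simp
        simp [this, ei_apply]
        ring
      · have hji' : i ≠ j := fun h => hji h.symm
        simp only [hji, if_false, zero_add]
        rw [← h1]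
        simp [ei_apply, hji']
    have e1 : Ex p (n + 1 + 1) (fun N => (N i : ℝ) * F (N - ei i)) =
      ∑ j, p j * Ex p (n + 1) (fun M => (((M + ei j) i : ℕ) : ℝ) *
        F (M + ei j - ei i)) := rfl
    rw [e1]
    simp only [key, mul_add, Finset.sum_add_distrib]
    have e2 : ∑ j, p j * ((n + 1) * p i * Ex p n (fun M => F (M + ei j))) =
        (n + 1) * p i * Ex p (n + 1) F := by
      simp only [Ex]
      rw [Finset.mul_sum]
      refine Finset.sum_congr rfl fun j _ => by ring
    rw [e2]
    simp
    ring

end ExLemmas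

lemma mult_finite {k : ℕ} (n : ℕ) : {N : Fin k → ℕ | ∑ i, N i = n}.Finite := by
  refine Set.Finite.subset (Set.Finite.pi (fun _ : Fin k => Set.finite_Iic n)) ?_
  intro N hN i _
  simp only [Set.mem_ofPred_eq] at hN
  simp only [Set.mem_Iic]
  rw [← hN]
  exact Finset.single_le_sum (f := N) (fun _ _ => Nat.zero_le _) (Finset.mem_univ i)

lemma mult_support {k : ℕ} (n : ℕ) (P : Fin k → ℝ) (f : (Fin k → ℕ) → ℝ) :
    (Function.support fun N => multinomialPMF n P N * f N).Finite := by
  refine (mult_finite (k := k) n).subset ?_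
  intro N hN
  simp only [Function.mem_support] at hN
  by_contra h
  apply hN
  simp only [Set.mem_ofPred_eq] at h
  simp [multinomialPMF, h]

lemma mult_shift {k : ℕ} (n : ℕ) (P : Fin k → ℝ) (M : Fin k → ℕ) (i : Fin k) :
    ((M + ei i) i : ℝ) * multinomialPMF (n + 1) P (M + ei i) =
      (n + 1) * (P i * multinomialPMF n P M) := by
  have hs : ∑ j, (M + ei i) j = ∑ j, M j + 1 := by
    simp [Finset.sum_add_distrib, sum_ei]
  unfold multinomialPMF
  rw [hs]
  by_cases h : ∑ j, M j = n
  · simp only [h, if_true]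
    have h1 : ∏ j, (((M + ei i) j).factorial : ℝ) = (M i + 1) * ∏ j, ((M j).factorial : ℝ) := by
      rw [← Finset.mul_prod_erase _ _ (Finset.mem_univ i),
        ← Finset.mul_prod_erase Finset.univ (fun j => ((M j).factorial : ℝ)) (Finset.mem_univ i)]
      rw [← mul_assoc]
      congr 1
      · simp [ei_apply, Nat.factorial_succ]
      · refine Finset.prod_congr rfl fun j hj => ?_
        simp [ei_apply, Finset.ne_of_mem_erase hj]
    have h2 : ∏ j, P j ^ ((M + ei i) j) = P i * ∏ j, P j ^ (M j) := by
      rw [← Finset.mul_prod_erase _ _ (Finset.mem_univ i),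
        ← Finset.mul_prod_erase Finset.univ (fun j => P j ^ (M j)) (Finset.mem_univ i)]
      rw [← mul_assoc]
      congr 1
      · simp [ei_apply, pow_succ]; ring
      · refine Finset.prod_congr rfl fun j hj => ?_
        simp [ei_apply, Finset.ne_of_mem_erase hj]
    rw [h1, h2]
    have h3 : (∏ j, ((M j).factorial : ℝ)) ≠ 0 :=
      Finset.prod_ne_zero_iff.mpr fun j _ => by positivity
    have h4 : (M i : ℝ) + 1 ≠ 0 := by positivity
    have h5 : ((M + ei i) i : ℝ) = M i + 1 := by simp [ei_apply]
    rw [h5, Nat.factorial_succ]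
    push_cast
    field_simp
  · simp [h]

lemma tsum_eq_Ex {k : ℕ} (n : ℕ) (P : Fin k → ℝ) (f : (Fin k → ℕ) → ℝ) :
    ∑' N, multinomialPMF n P N * f N = Ex P n f := by
  induction n generalizing f with
  | zero =>
    rw [tsum_eq_single 0]
    · simp [multinomialPMF, Ex]
    · intro N hN
      have : ∑ i, N i ≠ 0 := by
        intro h
        apply hN
        funext i
        simpa using (Finset.sum_eq_zero_iff.mp h) i (Finset.mem_univ i)
      simp [multinomialPMF, this]
  | succ n ih =>
    simp only [Ex]
    simp only [← ih]
    have hn : ((n : ℝ) + 1) ≠ 0 := by positivity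
    have h1 : ∀ i, P i * ∑' M, multinomialPMF n P M * f (M + ei i) =
        ∑' N : Fin k → ℕ, ((N i : ℝ) / (n + 1)) * (multinomialPMF (n + 1) P N * f N) := by
      intro i
      have hinj : Function.Injective (fun M : Fin k → ℕ => M + ei i) := add_left_injective _
      rw [← hinj.tsum_eq (f := fun N : Fin k → ℕ =>
        ((N i : ℝ) / (n + 1)) * (multinomialPMF (n + 1) P N * f N)), ← tsum_mul_left]
      · refine tsum_congr fun M => ?_
        have := mult_shift n P M i
        have h2 : ((M + ei i) i : ℝ) / (n + 1) * (multinomialPMF (n + 1) P (M + ei i)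
          * f (M + ei i)) = ((M + ei i) i : ℝ) * multinomialPMF (n + 1) P (M + ei i)
          * f (M + ei i) / (n + 1) := by ring
        rw [h2, this]
        field_simp
      · intro N hN
        simp only [Function.mem_support] at hN
        have hNi : N i ≠ 0 := by
          intro h; apply hN; simp [h]
        refine ⟨N - ei i, ?_⟩
        funext j
        simp only [Pi.add_apply, Pi.sub_apply, ei_apply]
        split_ifs with hj
        · subst hj; omega
        · simp
    simp only [h1]
    rw [← Summable.tsum_finsetSum]
    · refine tsum_congr fun N => ?_
      rw [← Finset.sum_mul, ← Finset.sum_div]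
      by_cases h : ∑ i, N i = n + 1
      · have : (∑ i, (N i : ℝ)) = n + 1 := by exact_mod_cast h
        rw [this, div_self hn, one_mul]
      · simp [multinomialPMF, h]
    · intro i _
      refine summable_of_hasFiniteSupport ?_
      refine (mult_support (n + 1) P f).subset ?_
      intro N hN
      simp only [Function.mem_support] at hN ⊢
      exact fun h => hN (by rw [h, mul_zero])

lemma mse_eq {k : ℕ} (n : ℕ) (P : Fin k → ℝ) (est : (Fin k → ℕ) → ℝ) :
    mseIID n P est = Ex P n (fun N => (est N - entropy P) ^ 2) := tsum_eq_Ex n P _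

lemma probVec_nonempty {k : ℕ} (hk : 1 ≤ k) : Nonempty (probVec k) := by
  refine ⟨⟨fun i => if i = ⟨0, hk⟩ then 1 else 0, ?_, ?_⟩⟩
  · intro i; dsimp only; split_ifs <;> norm_num
  · simp

lemma probVec_le_one {k : ℕ} {P : Fin k → ℝ} (hP : P ∈ probVec k) (i : Fin k) : P i ≤ 1 := by
  rw [← hP.2]
  exact Finset.single_le_sum (f := P) (fun j _ => hP.1 j) (Finset.mem_univ i)

lemma entropy_nonneg {k : ℕ} {P : Fin k → ℝ} (hP : P ∈ probVec k) : 0 ≤ entropy P := by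
  refine Finset.sum_nonneg fun i _ => mul_nonneg (hP.1 i) ?_
  rw [one_div, Real.log_inv]
  have := Real.log_nonpos (hP.1 i) (probVec_le_one hP i)
  linarith

lemma entropy_le_log {k : ℕ} (hk : 1 ≤ k) {P : Fin k → ℝ} (hP : P ∈ probVec k) :
    entropy P ≤ Real.log k := by
  have hk0 : (0 : ℝ) < k := by exact_mod_cast hk
  have h : ∀ i, P i * Real.log (1 / P i) ≤ P i * Real.log k + (1 / k - P i) := by
    intro i
    rcases (hP.1 i).eq_or_lt with h0 | h0
    · rw [← h0]; simp
    · have h1 := Real.log_le_sub_one_of_pos (x := 1 / (k * P i)) (by positivity)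
      have h2 : Real.log (1 / (k * P i)) = Real.log (1 / P i) - Real.log k := by
        rw [one_div, one_div, Real.log_inv, Real.log_inv, Real.log_mul hk0.ne' h0.ne']; ring
      rw [h2] at h1
      have h3 := mul_le_mul_of_nonneg_left h1 h0.le
      have h4 : P i * (1 / (k * P i) - 1) = 1 / k - P i := by field_simp
      rw [h4] at h3
      linarith
  have := Finset.sum_le_sum (fun i (_ : i ∈ Finset.univ) => h i)
  rw [Finset.sum_add_distrib, Finset.sum_sub_distrib, ← Finset.sum_mul, hP.2] at this
  have h5 : ∑ i : Fin k, (1 / (k : ℝ)) = 1 := by simp; field_simp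
  rw [h5] at this
  unfold entropy
  linarith

lemma mse_bdd {k : ℕ} (hk : 1 ≤ k) (n : ℕ) (est : (Fin k → ℕ) → ℝ) :
    BddAbove (Set.range fun P : probVec k => mseIID n P.1 est) := by
  obtain ⟨C, hC⟩ := ((mult_finite (k := k) n).image (fun N => |est N|)).bddAbove
  refine ⟨(C + Real.log k) ^ 2, ?_⟩
  rintro _ ⟨P, rfl⟩
  dsimp only
  rw [mse_eq]
  have := Ex_mono P.1 P.2.1 n (fun N => (est N - entropy P.1) ^ 2) (fun _ => (C + Real.log k) ^ 2) ?_
  · rwa [Ex_const P.1 P.2.2] at this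
  · intro M hM
    have h1 : |est M| ≤ C := hC ⟨M, hM, rfl⟩
    have h2 := entropy_nonneg P.2
    have h3 := entropy_le_log hk P.2
    have h4 := abs_le.mp h1
    apply sq_le_sq'
    · linarith
    · linarith

lemma Rstar_le {k n : ℕ} (hk : 1 ≤ k) (est : (Fin k → ℕ) → ℝ) (B : ℝ)
    (h : ∀ P ∈ probVec k, Ex P n (fun N => (est N - entropy P) ^ 2) ≤ B) : Rstar k n ≤ B := by
  have := probVec_nonempty hk
  refine (ciInf_le ⟨0, ?_⟩ est).trans (ciSup_le fun P => ?_)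
  · rintro _ ⟨e, rfl⟩
    refine Real.iSup_nonneg fun P => ?_
    rw [mse_eq]
    exact Ex_nonneg _ P.2.1 _ _ fun _ => sq_nonneg _
  · rw [mse_eq]; exact h P.1 P.2

lemma le_Rstar {k n : ℕ} (hk : 1 ≤ k) (B : ℝ)
    (h : ∀ (est : (Fin k → ℕ) → ℝ) (R : ℝ),
      (∀ P ∈ probVec k, Ex P n (fun N => (est N - entropy P) ^ 2) ≤ R) → B ≤ R) : B ≤ Rstar k n := by
  refine le_ciInf fun est => ?_
  refine h est _ fun P hP => ?_
  have := le_ciSup (mse_bdd hk n est) ⟨P, hP⟩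
  rw [mse_eq] at this
  exact this

/-- Combining estimators by the conditional law of the last sample. -/
lemma combine_est {k : ℕ} (n : ℕ) (e : Fin k → (Fin k → ℕ) → ℝ) :
    ∃ est : (Fin k → ℕ) → ℝ, ∀ P ∈ probVec k, ∀ h : ℝ,
      Ex P (n + 1) (fun N => (est N - h) ^ 2) ≤ ∑ i, P i * Ex P n (fun N => (e i N - h) ^ 2) := by
  refine ⟨fun N => ∑ i, ((N i : ℝ) / (n + 1)) * e i (N - ei i), fun P hP h => ?_⟩
  have hn : ((n : ℝ) + 1) ≠ 0 := by positivity
  have h1 : ∑ i, P i * Ex P n (fun N => (e i N - h) ^ 2) =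
      Ex P (n + 1) (fun N => ∑ i, ((N i : ℝ) / (n + 1)) * (e i (N - ei i) - h) ^ 2) := by
    rw [Ex_sum]
    refine Finset.sum_congr rfl fun i _ => ?_
    have e1 : (fun N : Fin k → ℕ => ((N i : ℝ) / (n + 1)) * (e i (N - ei i) - h) ^ 2) =
        (fun N => (1 / ((n : ℝ) + 1)) * ((N i : ℝ) * (fun M => (e i M - h) ^ 2) (N - ei i))) := by
      funext N; ring
    rw [e1, Ex_mul, Ex_onestep P n i (fun M => (e i M - h) ^ 2)]
    field_simp
  rw [h1]
  refine Ex_mono P hP.1 _ _ _ fun M hM => ?_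
  have hw : ∑ i, (M i : ℝ) / (n + 1) = 1 := by
    rw [← Finset.sum_div]
    have : (∑ i, (M i : ℝ)) = n + 1 := by exact_mod_cast hM
    rw [this, div_self hn]
  have h2 : ∑ i, ((M i : ℝ) / (n + 1)) * e i (M - ei i) - h =
      ∑ i, ((M i : ℝ) / (n + 1)) * (e i (M - ei i) - h) := by
    simp only [mul_sub, Finset.sum_sub_distrib]
    rw [← Finset.sum_mul, hw, one_mul]
  rw [h2]
  have h3 := (Even.convexOn_pow (𝕜 := ℝ) (n := 2) even_two).map_sum_le (t := Finset.univ)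
    (w := fun i => (M i : ℝ) / (n + 1)) (p := fun i => e i (M - ei i) - h)
    (fun i _ => by positivity) hw (fun i _ => Set.mem_univ _)
  simpa [smul_eq_mul] using h3

lemma split_est {k : ℕ} (n1 n2 : ℕ) (g : (Fin k → ℕ) → (Fin k → ℕ) → ℝ) :
    ∃ est : (Fin k → ℕ) → ℝ, ∀ P ∈ probVec k, ∀ h : ℝ,
      Ex P (n1 + n2) (fun N => (est N - h) ^ 2) ≤
        Ex P n1 (fun M => Ex P n2 (fun M' => (g M M' - h) ^ 2)) := by
  induction n2 generalizing g with
  | zero =>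
    refine ⟨fun N => g N 0, fun P _ h => ?_⟩
    simp [Ex]
  | succ n2 ih =>
    choose e he using fun i => ih (fun M M' => g M (M' + ei i))
    obtain ⟨est, hest⟩ := combine_est (n1 + n2) e
    refine ⟨est, fun P hP h => (hest P hP h).trans ?_⟩
    have h1 : Ex P n1 (fun M => Ex P (n2 + 1) (fun M' => (g M M' - h) ^ 2)) =
        ∑ i, P i * Ex P n1 (fun M => Ex P n2 (fun M' => (g M (M' + ei i) - h) ^ 2)) := by
      simp only [Ex]
      rw [Ex_sum]
      refine Finset.sum_congr rfl fun i _ => ?_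
      rw [Ex_mul]
    rw [h1]
    exact Finset.sum_le_sum fun i _ => mul_le_mul_of_nonneg_left (he i P hP h) (hP.1 i)

lemma Rstar_split {k n1 n2 : ℕ} (hk : 1 ≤ k) (g : (Fin k → ℕ) → (Fin k → ℕ) → ℝ) (B : ℝ)
    (h : ∀ P ∈ probVec k, Ex P n1 (fun M => Ex P n2 (fun M' => (g M M' - entropy P) ^ 2)) ≤ B) :
    Rstar k (n1 + n2) ≤ B := by
  obtain ⟨est, hest⟩ := split_est n1 n2 g
  exact Rstar_le hk est B fun P hP => (hest P hP _).trans (h P hP)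

lemma Rstar_anti {k n m : ℕ} (hk : 1 ≤ k) (hnm : n ≤ m) : Rstar k m ≤ Rstar k n := by
  obtain ⟨d, rfl⟩ := Nat.exists_eq_add_of_le hnm
  refine le_Rstar hk _ fun est R hR => ?_
  refine Rstar_split hk (fun M _ => est M) R fun P hP => ?_
  simp only [Ex_const P hP.2]
  exact hR P hP

section BxLemmas

variable (p : ℝ)

lemma Bx_add (n : ℕ) (f g : ℕ → ℝ) :
    Bx p n (fun m => f m + g m) = Bx p n f + Bx p n g := by
  induction n generalizing f g with
  | zero => simp [Bx]
  | succ n ih =>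
    simp only [Bx]
    rw [ih (fun m => f (m + 1)) (fun m => g (m + 1)), ih]; ring

lemma Bx_mul (n : ℕ) (c : ℝ) (f : ℕ → ℝ) :
    Bx p n (fun m => c * f m) = c * Bx p n f := by
  induction n generalizing f with
  | zero => simp [Bx]
  | succ n ih =>
    simp only [Bx]
    rw [ih (fun m => f (m + 1)), ih]; ring

lemma Bx_const (n : ℕ) (c : ℝ) : Bx p n (fun _ => c) = c := by
  induction n with
  | zero => simp [Bx]
  | succ n ih => simp only [Bx, ih]; ring

lemma Bx_sub (n : ℕ) (f g : ℕ → ℝ) :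
    Bx p n (fun m => f m - g m) = Bx p n f - Bx p n g := by
  have h := Bx_add p n f (fun M => (-1) * g M)
  rw [Bx_mul] at h
  have : (fun M => f M - g M) = (fun M => f M + (-1) * g M) := by funext M; ring
  rw [this, h]; ring

lemma Bx_sum {ι : Type*} (s : Finset ι) (n : ℕ) (f : ι → ℕ → ℝ) :
    Bx p n (fun M => ∑ a ∈ s, f a M) = ∑ a ∈ s, Bx p n (f a) := by
  classical
  induction s using Finset.induction_on with
  | empty => simp [Bx_const]
  | insert a s ha ih =>
    simp only [Finset.sum_insert ha]
    rw [Bx_add p n (f a) (fun M => ∑ a ∈ s, f a M), ih]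

lemma Bx_mono (h0 : 0 ≤ p) (h1 : p ≤ 1) (n : ℕ) (f g : ℕ → ℝ)
    (h : ∀ m, m ≤ n → f m ≤ g m) : Bx p n f ≤ Bx p n g := by
  induction n generalizing f g with
  | zero => simp only [Bx]; exact h 0 le_rfl
  | succ n ih =>
    simp only [Bx]
    refine add_le_add (mul_le_mul_of_nonneg_left ?_ h0)
      (mul_le_mul_of_nonneg_left ?_ (by linarith))
    · exact ih _ _ fun m hm => h _ (by omega)
    · exact ih _ _ fun m hm => h _ (by omega)

lemma Bx_nonneg (h0 : 0 ≤ p) (h1 : p ≤ 1) (n : ℕ) (f : ℕ → ℝ)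
    (h : ∀ m, 0 ≤ f m) : 0 ≤ Bx p n f := by
  have := Bx_mono p h0 h1 n (fun _ => 0) f (fun m _ => h m)
  rwa [Bx_const] at this

lemma Bx_pow (n : ℕ) (c : ℝ) : Bx p n (fun m => c ^ m) = (1 - p + p * c) ^ n := by
  induction n with
  | zero => simp [Bx]
  | succ n ih =>
    simp only [Bx]
    have : (fun m : ℕ => c ^ (m + 1)) = (fun m => c * c ^ m) := by funext m; ring
    rw [this, Bx_mul, ih]; ring

lemma Bx_desc (n j : ℕ) :
    Bx p n (fun m => (m.descFactorial j : ℝ)) = (n.descFactorial j : ℝ) * p ^ j := by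
  induction n generalizing j with
  | zero =>
    cases j <;> simp [Bx]
  | succ n ih =>
    simp only [Bx]
    cases j with
    | zero => simp [Bx_const]
    | succ j =>
      have e : ∀ m : ℕ, ((m + 1).descFactorial (j + 1) : ℝ) =
          (m.descFactorial (j + 1) : ℝ) + (j + 1) * (m.descFactorial j : ℝ) := by
        intro m
        rw [Nat.succ_descFactorial_succ, Nat.descFactorial_succ]
        push_cast
        rcases le_or_gt j m with h | h
        · rw [Nat.cast_sub h]; ring
        · simp [Nat.descFactorial_of_lt h]
      simp only [e]
      rw [Bx_add p n (fun m => (m.descFactorial (j + 1) : ℝ)), Bx_mul, ih, ih]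
      ring

lemma Bx_c1 (n : ℕ) : Bx p n (fun m => (m : ℝ) - n * p) = 0 := by
  have := Bx_desc p n 1
  simp at this
  rw [Bx_sub p n (fun m => (m : ℝ)), this, Bx_const]; ring

lemma Bx_c2 (n : ℕ) : Bx p n (fun m => ((m : ℝ) - n * p) ^ 2) = n * p * (1 - p) := by
  induction n with
  | zero => simp [Bx]
  | succ n ih =>
    simp only [Bx]
    have e1 : (fun m : ℕ => (((m + 1 : ℕ) : ℝ) - ((n + 1 : ℕ) : ℝ) * p) ^ 2) =
      (fun m : ℕ => ((m : ℝ) - n * p) ^ 2 + (2 * (1 - p) * ((m : ℝ) - n * p) + (1 - p) ^ 2)) := by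
      funext m; push_cast; ring
    have e2 : (fun m : ℕ => ((m : ℝ) - ((n + 1 : ℕ) : ℝ) * p) ^ 2) =
      (fun m : ℕ => ((m : ℝ) - n * p) ^ 2 + (2 * (-p) * ((m : ℝ) - n * p) + (-p) ^ 2)) := by
      funext m; push_cast; ring
    rw [e1, e2]
    simp only [Bx_add, Bx_mul, Bx_const, ih, Bx_c1]
    push_cast; ring

lemma Bx_c3 (n : ℕ) : Bx p n (fun m => ((m : ℝ) - n * p) ^ 3) = n * p * (1 - p) * (1 - 2 * p) := by
  induction n with
  | zero => simp [Bx]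
  | succ n ih =>
    simp only [Bx]
    have e1 : (fun m : ℕ => (((m + 1 : ℕ) : ℝ) - ((n + 1 : ℕ) : ℝ) * p) ^ 3) =
      (fun m : ℕ => ((m : ℝ) - n * p) ^ 3 + (3 * (1 - p) * ((m : ℝ) - n * p) ^ 2 +
        (3 * (1 - p) ^ 2 * ((m : ℝ) - n * p) + (1 - p) ^ 3))) := by
      funext m; push_cast; ring
    have e2 : (fun m : ℕ => ((m : ℝ) - ((n + 1 : ℕ) : ℝ) * p) ^ 3) =
      (fun m : ℕ => ((m : ℝ) - n * p) ^ 3 + (3 * (-p) * ((m : ℝ) - n * p) ^ 2 +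
        (3 * (-p) ^ 2 * ((m : ℝ) - n * p) + (-p) ^ 3))) := by
      funext m; push_cast; ring
    rw [e1, e2]
    simp only [Bx_add, Bx_mul, Bx_const, ih, Bx_c1, Bx_c2]
    push_cast; ring

lemma Bx_c4 (n : ℕ) : Bx p n (fun m => ((m : ℝ) - n * p) ^ 4) =
    3 * (n * p * (1 - p)) ^ 2 + n * p * (1 - p) * (1 - 6 * p * (1 - p)) := by
  induction n with
  | zero => simp [Bx]
  | succ n ih =>
    simp only [Bx]
    have e1 : (fun m : ℕ => (((m + 1 : ℕ) : ℝ) - ((n + 1 : ℕ) : ℝ) * p) ^ 4) =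
      (fun m : ℕ => ((m : ℝ) - n * p) ^ 4 + (4 * (1 - p) * ((m : ℝ) - n * p) ^ 3 +
        (6 * (1 - p) ^ 2 * ((m : ℝ) - n * p) ^ 2 +
        (4 * (1 - p) ^ 3 * ((m : ℝ) - n * p) + (1 - p) ^ 4)))) := by
      funext m; push_cast; ring
    have e2 : (fun m : ℕ => ((m : ℝ) - ((n + 1 : ℕ) : ℝ) * p) ^ 4) =
      (fun m : ℕ => ((m : ℝ) - n * p) ^ 4 + (4 * (-p) * ((m : ℝ) - n * p) ^ 3 +
        (6 * (-p) ^ 2 * ((m : ℝ) - n * p) ^ 2 +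
        (4 * (-p) ^ 3 * ((m : ℝ) - n * p) + (-p) ^ 4)))) := by
      funext m; push_cast; ring
    rw [e1, e2]
    simp only [Bx_add, Bx_mul, Bx_const, ih, Bx_c1, Bx_c2, Bx_c3]
    push_cast; ring

end BxLemmas

/-- Risk bound for additive estimators. -/
lemma additive_risk {k : ℕ} {P : Fin k → ℝ} (hP : P ∈ probVec k) (n : ℕ) (g : Fin k → ℕ → ℝ)
    (h : ℝ) :
    Ex P (n + 1) (fun N => (∑ j, g j (N j) - h) ^ 2) ≤
      (n + 1) * ∑ j, P j * Bx (P j) n (fun m => (g j (m + 1) - g j m) ^ 2) +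
      (∑ j, Bx (P j) (n + 1) (g j) - h) ^ 2 := by
  have h1 := Ex_var P hP.1 hP.2 n (fun N => ∑ j, g j (N j))
  have h2 : Ex P (n + 1) (fun N => ∑ j, g j (N j)) = ∑ j, Bx (P j) (n + 1) (g j) := by
    rw [Ex_sum]
    exact Finset.sum_congr rfl fun j _ => Ex_marginal P hP.2 _ j _
  have h3 : Ex P n (fun M => ∑ j, P j * (∑ l, g l ((M + ei j) l) - ∑ l, g l (M l)) ^ 2) =
      ∑ j, P j * Bx (P j) n (fun m => (g j (m + 1) - g j m) ^ 2) := by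
    rw [Ex_sum]
    refine Finset.sum_congr rfl fun j _ => ?_
    rw [Ex_mul, ← Ex_marginal P hP.2 n j]
    congr 2
    funext M
    congr 1
    rw [← Finset.sum_sub_distrib, Finset.sum_eq_single j]
    · simp [ei_apply]
    · intro l _ hl
      simp [ei_apply, hl]
    · simp
  rw [h3, h2] at h1
  have e : (fun N : Fin k → ℕ => (∑ j, g j (N j) - h) ^ 2) =
      (fun N => ((∑ j, g j (N j)) ^ 2 - (2 * h) * ∑ j, g j (N j)) + h ^ 2) := by
    funext N; ring
  rw [e, Ex_add P (n + 1) (fun N => (∑ j, g j (N j)) ^ 2 - (2 * h) * ∑ j, g j (N j)),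
    Ex_sub P (n + 1) (fun N => (∑ j, g j (N j)) ^ 2), Ex_mul, Ex_const P hP.2, h2]
  nlinarith

/-- The function `x log (1/x)`. -/
def phi (x : ℝ) : ℝ := x * Real.log (1 / x)

lemma phi_eq (x : ℝ) : phi x = -(x * Real.log x) := by
  simp [phi, Real.log_inv]

lemma phi_zero : phi 0 = 0 := by simp [phi]

lemma plugin_bias {p : ℝ} (h0 : 0 ≤ p) (h1 : p ≤ 1) {n : ℕ} (hn : 1 ≤ n) :
    |Bx p n (fun m => phi (m / n)) - phi p| ≤ 1 / n := by
  have hn0 : (0 : ℝ) < n := by exact_mod_cast hn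
  rcases h0.eq_or_lt with h | hp
  · rw [← h]
    have : ∀ (n : ℕ) (g : ℕ → ℝ), Bx 0 n g = g 0 := by
      intro n
      induction n with
      | zero => intro g; simp [Bx]
      | succ n ih => intro g; simp [Bx, ih]
    rw [this]
    simp [phi_zero]
  · have up : ∀ m : ℕ, phi (m / n) ≤ Real.log (1 / p) / n * m + (p - m / n) := by
      intro m
      rcases Nat.eq_zero_or_pos m with rfl | hm
      · simp [phi_zero, h0]
      · have hm0 : (0 : ℝ) < m := by exact_mod_cast hm
        have hx : (0 : ℝ) < m / n := by positivity
        set x : ℝ := m / n with hxdef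
        have e1 := Real.log_le_sub_one_of_pos (x := p / x) (by positivity)
        rw [Real.log_div hp.ne' hx.ne'] at e1
        have e2 := mul_le_mul_of_nonneg_left e1 hx.le
        have e3 : x * (p / x - 1) = p - x := by field_simp
        have e4 : Real.log (1 / p) / n * m = x * Real.log (1 / p) := by rw [hxdef]; ring
        rw [e4, phi_eq, one_div, Real.log_inv]
        nlinarith
    have lo : ∀ m : ℕ, Real.log (1 / p) / n * m + (-(1 / (p * n ^ 2))) * ((m - n * p) ^ 2 +
        n * p * (m - n * p)) ≤ phi (m / n) := by
      intro m
      rcases Nat.eq_zero_or_pos m with rfl | hm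
      · simp [phi_zero]
        apply le_of_eq; ring
      · have hm0 : (0 : ℝ) < m := by exact_mod_cast hm
        have hx : (0 : ℝ) < m / n := by positivity
        set x : ℝ := m / n with hxdef
        have e1 := Real.log_le_sub_one_of_pos (x := x / p) (by positivity)
        rw [Real.log_div hx.ne' hp.ne'] at e1
        have e2 := mul_le_mul_of_nonneg_left e1 hx.le
        have e4 : Real.log (1 / p) / n * m = x * Real.log (1 / p) := by rw [hxdef]; ring
        have e5 : (-(1 / (p * n ^ 2))) * (((m : ℝ) - n * p) ^ 2 + n * p * (m - n * p)) =
          - (x * (x / p - 1)) := by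
          rw [hxdef]; field_simp; ring
        rw [e4, e5, phi_eq, one_div, Real.log_inv]
        nlinarith
    have U := Bx_mono p h0 h1 n _ _ (fun m _ => up m)
    have Lo := Bx_mono p h0 h1 n _ _ (fun m _ => lo m)
    have m1 : Bx p n (fun m => (m : ℝ)) = n * p := by
      have := Bx_desc p n 1
      simpa using this
    have eU : (fun m : ℕ => Real.log (1 / p) / n * (m : ℝ) + (p - m / n)) =
      (fun m : ℕ => (Real.log (1 / p) / n - 1 / n) * (m : ℝ) + p) := by funext m; ring
    rw [eU, Bx_add p n (fun m : ℕ => (Real.log (1 / p) / n - 1 / n) * (m : ℝ)), Bx_mul, m1,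
      Bx_const] at U
    rw [Bx_add p n (fun m : ℕ => Real.log (1 / p) / n * (m : ℝ)), Bx_mul, Bx_mul, m1,
      Bx_add p n (fun m : ℕ => ((m : ℝ) - n * p) ^ 2), Bx_mul, Bx_c1, Bx_c2] at Lo
    have f1 : (Real.log (1 / p) / n - 1 / n) * (n * p) + p = phi p := by
      unfold phi; field_simp; ring
    have f2 : Real.log (1 / p) / n * (n * p) + -(1 / (p * (n : ℝ) ^ 2)) *
        (n * p * (1 - p) + n * p * 0) = phi p - (1 - p) / n := by
      unfold phi; field_simp; ring
    rw [f1] at U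
    rw [f2] at Lo
    have : (1 - p) / n ≤ 1 / n := by gcongr; linarith
    have h3 : (0 : ℝ) ≤ 1 / n := by positivity
    rw [abs_le]
    constructor <;> linarith

lemma mono_pos_of_deriv (f f' : ℝ → ℝ) (hd : ∀ u > 0, HasDerivAt f (f' u) u)
    (h : ∀ u > 0, 0 ≤ f' u) : MonotoneOn f (Set.Ioi 0) := by
  apply monotoneOn_of_deriv_nonneg (convex_Ioi 0)
  · intro u hu; exact (hd u hu).continuousAt.continuousWithinAt
  · intro u hu
    rw [interior_Ioi] at hu
    exact (hd u hu).differentiableAt.differentiableWithinAt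
  · intro u hu
    rw [interior_Ioi] at hu
    rw [(hd u hu).deriv]; exact h u hu

lemma min_at_one (f f' : ℝ → ℝ) (hd : ∀ u > 0, HasDerivAt f (f' u) u)
    (h : ∀ u > 0, 0 ≤ (u - 1) * f' u) (u : ℝ) (hu : 0 < u) : f 1 ≤ f u := by
  rcases le_total 1 u with h1 | h1
  · have : MonotoneOn f (Set.Ici 1) := by
      apply monotoneOn_of_deriv_nonneg (convex_Ici 1)
      · intro u hu
        exact (hd u (lt_of_lt_of_le one_pos hu)).continuousAt.continuousWithinAt
      · intro u hu
        rw [interior_Ici] at hu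
        exact (hd u (one_pos.trans hu)).differentiableAt.differentiableWithinAt
      · intro u hu
        rw [interior_Ici] at hu
        have hu' : (1 : ℝ) < u := hu
        rw [(hd u (one_pos.trans hu)).deriv]
        have := h u (one_pos.trans hu)
        by_contra hneg
        push Not at hneg
        nlinarith
    exact this (Set.mem_Ici.mpr le_rfl) h1 h1
  · have : AntitoneOn f (Set.Ioc 0 1) := by
      apply antitoneOn_of_deriv_nonpos (convex_Ioc 0 1)
      · intro u hu
        exact (hd u hu.1).continuousAt.continuousWithinAt
      · intro u hu
        rw [interior_Ioc] at hu
        exact (hd u hu.1).differentiableAt.differentiableWithinAt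
      · intro u hu
        rw [interior_Ioc] at hu
        rw [(hd u hu.1).deriv]
        have := h u hu.1
        by_contra hneg
        push Not at hneg
        nlinarith [hu.2]
    exact this ⟨hu, h1⟩ ⟨one_pos, le_rfl⟩ h1

lemma log_le_cubic (u : ℝ) (hu : 0 < u) :
    Real.log u ≤ (u - 1) - (u - 1) ^ 2 / 2 + (u - 1) ^ 3 / 3 := by
  have := min_at_one (fun u => (u - 1) - (u - 1) ^ 2 / 2 + (u - 1) ^ 3 / 3 - Real.log u)
    (fun u => 1 - (u - 1) + (u - 1) ^ 2 - u⁻¹) (fun u hu => by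
      have h1 := (hasDerivAt_id u).sub_const 1
      have := ((h1.sub ((h1.pow 2).div_const 2)).add ((h1.pow 3).div_const 3)).sub
        (Real.hasDerivAt_log hu.ne')
      refine HasDerivAt.congr_deriv this ?_
      simp) (fun u hu => by
      have : (u - 1) * (1 - (u - 1) + (u - 1) ^ 2 - u⁻¹) = ((u - 1) ^ 2) ^ 2 / u := by
        field_simp; ring
      rw [this]; positivity) u hu
  simp at this
  linarith

lemma ulogu_lower (u : ℝ) (hu : 0 < u) :
    (u - 1) + (u - 1) ^ 2 / 2 - (u - 1) ^ 3 / 6 ≤ u * Real.log u := by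
  have hmono := mono_pos_of_deriv (fun u => Real.log u - (u - 1) + (u - 1) ^ 2 / 2)
    (fun u => u⁻¹ - 1 + (u - 1)) (fun u hu => by
      have h1 := (hasDerivAt_id u).sub_const 1
      have := ((Real.hasDerivAt_log hu.ne').sub h1).add ((h1.pow 2).div_const 2)
      refine HasDerivAt.congr_deriv this ?_
      simp) (fun u hu => by
      have : u⁻¹ - 1 + (u - 1) = (u - 1) ^ 2 / u := by field_simp; ring
      rw [this]; positivity)
  have := min_at_one (fun u => u * Real.log u - (u - 1) - (u - 1) ^ 2 / 2 + (u - 1) ^ 3 / 6)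
    (fun u => Real.log u - (u - 1) + (u - 1) ^ 2 / 2) (fun u hu => by
      have h1 := (hasDerivAt_id u).sub_const 1
      have := ((((hasDerivAt_id u).mul (Real.hasDerivAt_log hu.ne')).sub h1).sub
        ((h1.pow 2).div_const 2)).add ((h1.pow 3).div_const 6)
      refine HasDerivAt.congr_deriv this ?_
      simp [hu.ne']; ring) (fun u hu => by
      rcases le_total 1 u with h1 | h1
      · have := hmono (Set.mem_Ioi.mpr one_pos) (Set.mem_Ioi.mpr hu) h1
        simp at this
        exact mul_nonneg (by linarith) (by linarith)
      · have := hmono (Set.mem_Ioi.mpr hu) (Set.mem_Ioi.mpr one_pos) h1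
        simp at this
        exact mul_nonneg_of_nonpos_of_nonpos (by linarith) (by linarith)) u hu
  simp at this
  linarith

lemma ulogu_bounds (u : ℝ) (hu : 0 ≤ u) :
    (u - 1) + (u - 1) ^ 2 / 2 - (u - 1) ^ 3 / 6 ≤ u * Real.log u ∧
    u * Real.log u ≤ (u - 1) + (u - 1) ^ 2 / 2 - (u - 1) ^ 3 / 6 + (u - 1) ^ 4 / 3 := by
  rcases hu.eq_or_lt with h | h
  · rw [← h]; norm_num
  · refine ⟨ulogu_lower u h, ?_⟩
    have := mul_le_mul_of_nonneg_left (log_le_cubic u h) hu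
    refine this.trans (le_of_eq ?_)
    ring

lemma refined_bias {p : ℝ} (h1 : p ≤ 1) {n : ℕ} (hnp : 1 ≤ n * p) :
    |Bx p n (fun m => phi (m / n)) + (1 - p) / (2 * n) - phi p| ≤ 2 / (n ^ 2 * p) := by
  have hn0 : (0 : ℝ) < n := by
    rcases (Nat.cast_nonneg n : (0 : ℝ) ≤ n).eq_or_lt with h | h
    · rw [← h] at hnp; norm_num at hnp
    · exact h
  have hp : 0 < p := by
    by_contra h
    push Not at h
    nlinarith
  have eq : ∀ m : ℕ, phi (m / n) = Real.log (1 / p) / n * m -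
      p * ((m / (n * p)) * Real.log (m / (n * p))) := by
    intro m
    rcases Nat.eq_zero_or_pos m with rfl | hm
    · simp [phi_zero]
    · have hm0 : (0 : ℝ) < m := by exact_mod_cast hm
      rw [phi_eq, one_div, Real.log_inv, Real.log_div hm0.ne' hn0.ne',
        Real.log_div hm0.ne' (by positivity), Real.log_mul hn0.ne' hp.ne']
      field_simp
      ring
  set s : ℝ := n * p with hs
  have hs0 : 0 < s := by positivity
  set A : ℕ → ℝ := fun m => Real.log (1 / p) / n * m - p * (1 / s * (m - s) +
    1 / (2 * s ^ 2) * (m - s) ^ 2 + (- (1 / (6 * s ^ 3))) * (m - s) ^ 3) with hA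
  set q : ℕ → ℝ := fun m => p * (1 / (3 * s ^ 4)) * (m - s) ^ 4 with hq
  have e1 : ∀ m : ℕ, (m : ℝ) / s - 1 = (m - s) / s := by intro m; field_simp
  have up : ∀ m : ℕ, phi (m / n) ≤ A m := by
    intro m
    have := (ulogu_bounds (m / s) (by positivity)).1
    rw [e1] at this
    rw [eq, hA]
    dsimp only
    have h2 := mul_le_mul_of_nonneg_left this hp.le
    have h3 : ((m : ℝ) - s) / s + (((m : ℝ) - s) / s) ^ 2 / 2 - (((m : ℝ) - s) / s) ^ 3 / 6 =
      1 / s * (m - s) + 1 / (2 * s ^ 2) * (m - s) ^ 2 + (- (1 / (6 * s ^ 3))) * (m - s) ^ 3 := by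
      field_simp; ring
    rw [h3] at h2
    linarith
  have lo : ∀ m : ℕ, A m - q m ≤ phi (m / n) := by
    intro m
    have := (ulogu_bounds (m / s) (by positivity)).2
    rw [e1] at this
    rw [eq, hA, hq]
    dsimp only
    have h2 := mul_le_mul_of_nonneg_left this hp.le
    have h3 : ((m : ℝ) - s) / s + (((m : ℝ) - s) / s) ^ 2 / 2 - (((m : ℝ) - s) / s) ^ 3 / 6
       + (((m : ℝ) - s) / s) ^ 4 / 3 =
      1 / s * (m - s) + 1 / (2 * s ^ 2) * (m - s) ^ 2 + (- (1 / (6 * s ^ 3))) * (m - s) ^ 3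
       + 1 / (3 * s ^ 4) * (m - s) ^ 4 := by
      field_simp; ring
    rw [h3] at h2
    linarith
  have U := Bx_mono p hp.le h1 n _ _ (fun m _ => up m)
  have Lo := Bx_mono p hp.le h1 n _ _ (fun m _ => lo m)
  have m1 : Bx p n (fun m => (m : ℝ)) = s := by
    have := Bx_desc p n 1
    simpa using this
  have EA : Bx p n A = phi p - (1 - p) / (2 * n) + (1 - p) * (1 - 2 * p) / (6 * n ^ 2 * p) := by
    rw [hA]
    rw [Bx_sub p n (fun m : ℕ => Real.log (1 / p) / n * (m : ℝ)), Bx_mul, Bx_mul,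
      Bx_add p n (fun m : ℕ => 1 / s * ((m : ℝ) - s) + 1 / (2 * s ^ 2) * ((m : ℝ) - s) ^ 2),
      Bx_add p n (fun m : ℕ => 1 / s * ((m : ℝ) - s)), Bx_mul, Bx_mul, Bx_mul, Bx_c1, Bx_c2, Bx_c3,
      m1]
    unfold phi
    rw [hs]
    field_simp
    ring
  have Eq : Bx p n q ≤ 4 / (3 * n ^ 2 * p) := by
    rw [hq, Bx_mul, Bx_c4]
    have b1 : 3 * (n * p * (1 - p)) ^ 2 + n * p * (1 - p) * (1 - 6 * p * (1 - p)) ≤ 4 * s ^ 2 := by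
      rw [← hs]
      have c1 : s * (1 - p) ≤ s := by nlinarith
      have c2 : 0 ≤ s * (1 - p) := mul_nonneg hs0.le (by linarith)
      have c3 : s * (1 - p) * (1 - 6 * p * (1 - p)) ≤ s * (1 - p) := by
        have : 0 ≤ p * (1 - p) := mul_nonneg hp.le (by linarith)
        nlinarith
      nlinarith
    calc p * (1 / (3 * s ^ 4)) * _ ≤ p * (1 / (3 * s ^ 4)) * (4 * s ^ 2) := by gcongr
      _ = 4 / (3 * n ^ 2 * p) := by rw [hs]; field_simp
  rw [Bx_sub p n A, EA] at Lo
  rw [EA] at U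
  have b3 : |(1 - p) * (1 - 2 * p) / (6 * n ^ 2 * p)| ≤ 1 / (6 * n ^ 2 * p) := by
    rw [abs_div, abs_of_pos (show (0 : ℝ) < 6 * n ^ 2 * p by positivity)]
    gcongr
    rw [abs_le]
    constructor <;> nlinarith
  have b4 := abs_le.mp b3
  have b5 : 1 / (6 * n ^ 2 * p) + 4 / (3 * n ^ 2 * p) = (3 / 4) * (2 / (n ^ 2 * p)) := by
    field_simp; norm_num
  have b6 : 0 < 2 / (n ^ 2 * p) := by positivity
  have b7 : 0 < 1 / (6 * n ^ 2 * p) := by positivity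
  have b8 : 0 < 4 / (3 * n ^ 2 * p) := by positivity
  rw [abs_le]
  constructor <;> linarith

lemma phi_diff {m n : ℕ} (hm : m ≤ n) :
    |phi (((m + 1 : ℕ) : ℝ) / ((n + 1 : ℕ) : ℝ)) - phi (m / ((n + 1 : ℕ) : ℝ))| ≤
      (1 + Real.log ((n + 1) / (m + 1))) / (n + 1) := by
  push_cast
  have hn0 : (0 : ℝ) < n + 1 := by positivity
  have hm0 : (0 : ℝ) < m + 1 := by positivity
  have hmn : (m : ℝ) ≤ n := by exact_mod_cast hm
  have hL : 0 ≤ Real.log ((n + 1) / (m + 1)) := by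
    apply Real.log_nonneg
    rw [le_div_iff₀ hm0]; linarith
  have key : ∃ θ : ℝ, 0 ≤ θ ∧ θ ≤ 1 ∧ phi (((m : ℝ) + 1) / (n + 1)) - phi ((m : ℝ) / (n + 1)) =
      (Real.log ((n + 1) / (m + 1)) - θ) / (n + 1) := by
    rcases Nat.eq_zero_or_pos m with rfl | hm'
    · refine ⟨0, le_rfl, zero_le_one, ?_⟩
      simp [phi, phi_zero]
      field_simp
    · have hm1 : (0 : ℝ) < m := by exact_mod_cast hm'
      refine ⟨m * Real.log ((m + 1) / m), ?_, ?_, ?_⟩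
      · apply mul_nonneg hm1.le
        apply Real.log_nonneg
        rw [le_div_iff₀ hm1]; linarith
      · have := Real.log_le_sub_one_of_pos (x := ((m : ℝ) + 1) / m) (by positivity)
        have h2 := mul_le_mul_of_nonneg_left this hm1.le
        refine h2.trans (le_of_eq ?_)
        field_simp; ring
      · rw [phi_eq, phi_eq, Real.log_div hm0.ne' hn0.ne', Real.log_div hm1.ne' hn0.ne',
          Real.log_div hm0.ne' hm1.ne', Real.log_div hn0.ne' hm0.ne']
        field_simp
        ring
  obtain ⟨θ, h0, h1, h2⟩ := key
  rw [h2, abs_div, abs_of_pos hn0]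
  gcongr
  rw [abs_le]
  constructor <;> linarith

lemma log_sq_bound {k : ℕ} (hk : 1 ≤ k) (x : ℝ) (hx : 1 ≤ x) :
    (Real.log x) ^ 2 ≤ 2 * (Real.log k) ^ 2 + 2 * (x / k) := by
  have hk0 : (1 : ℝ) ≤ k := by exact_mod_cast hk
  have hk00 : (0 : ℝ) < k := by linarith
  have hx0 : 0 < x := by linarith
  have hl := Real.log_nonneg hx
  rcases le_total x k with h | h
  · have := Real.log_le_log hx0 h
    have : 0 ≤ x / k := by positivity
    nlinarith
  · have hy : 1 ≤ x / k := by rw [le_div_iff₀ hk00]; linarith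
    have e : Real.log x = Real.log k + Real.log (x / k) := by
      rw [Real.log_div hx0.ne' hk00.ne']; ring
    have hb : (Real.log (x / k)) ^ 2 ≤ x / k := by
      have h1 : Real.log (x / k) = 2 * Real.log (Real.sqrt (x / k)) := by
        rw [Real.log_sqrt (by positivity)]; ring
      set s := Real.sqrt (x / k) with hs
      have hs1 : 1 ≤ s := by rw [hs]; exact Real.one_le_sqrt.mpr hy
      have hss : s ^ 2 = x / k := Real.sq_sqrt (by positivity)
      have h3 : Real.log s ≤ s / 2 := by
        have e1 := Real.log_le_sub_one_of_pos (x := s / 2) (by positivity)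
        rw [Real.log_div (by positivity) (by norm_num)] at e1
        have := Real.log_two_lt_d9
        linarith
      have h4 := Real.log_nonneg hs1
      rw [h1, ← hss]
      nlinarith
    rw [e]
    nlinarith [sq_nonneg (Real.log k - Real.log (x / k))]

lemma plugin_var {k : ℕ} (hk : 1 ≤ k) {P : Fin k → ℝ} (hP : P ∈ probVec k) (n : ℕ) :
    ∑ j, P j * Bx (P j) n (fun m => (phi (((m + 1 : ℕ) : ℝ) / ((n + 1 : ℕ) : ℝ))
      - phi (m / ((n + 1 : ℕ) : ℝ))) ^ 2) ≤ (4 * (Real.log k) ^ 2 + 6) / (n + 1) ^ 2 := by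
  have hk0 : (0 : ℝ) < k := by exact_mod_cast hk
  have hn0 : (0 : ℝ) < n + 1 := by positivity
  have h1 : ∀ j, P j * Bx (P j) n (fun m => (phi (((m + 1 : ℕ) : ℝ) / ((n + 1 : ℕ) : ℝ))
      - phi (m / ((n + 1 : ℕ) : ℝ))) ^ 2) ≤
      P j * ((2 + 4 * (Real.log k) ^ 2) / (n + 1) ^ 2) + 4 / (k * (n + 1) ^ 2) := by
    intro j
    have hpj := hP.1 j
    have b1 := Bx_mono (P j) hpj (probVec_le_one hP j) n
      (fun m => (phi (((m + 1 : ℕ) : ℝ) / ((n + 1 : ℕ) : ℝ)) - phi (m / ((n + 1 : ℕ) : ℝ))) ^ 2)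
      (fun m => (2 + 4 * (Real.log k) ^ 2) / (n + 1) ^ 2 +
        4 / (k * (n + 1)) * (1 / ((m : ℝ) + 1))) (by
        intro m hm
        have h2 := phi_diff hm
        have hmn : (m : ℝ) ≤ n := by exact_mod_cast hm
        have hx : 1 ≤ ((n : ℝ) + 1) / (m + 1) := by
          rw [le_div_iff₀ (by positivity)]; linarith
        have h3 := log_sq_bound hk _ hx
        have h4 := Real.log_nonneg hx
        set l := Real.log (((n : ℝ) + 1) / (m + 1))
        rw [← sq_abs]
        calc _ ≤ ((1 + l) / (n + 1)) ^ 2 := by gcongr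
          _ = (1 + l) ^ 2 / (n + 1) ^ 2 := by rw [div_pow]
          _ ≤ (2 + 4 * (Real.log k) ^ 2 + 4 * (((n : ℝ) + 1) / (m + 1) / k)) / (n + 1) ^ 2 := by
            gcongr
            nlinarith [sq_nonneg (1 - l)]
          _ = _ := by field_simp)
    rw [Bx_add (P j) n (fun _ => _), Bx_const, Bx_mul] at b1
    have b2 : (n + 1) * P j * Bx (P j) n (fun m => 1 / ((m : ℝ) + 1)) ≤ 1 := by
      rw [← Ex_marginal P hP.2 n j, ← Ex_onestep P n j (fun M => 1 / ((M j : ℝ) + 1))]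
      have := Ex_mono P hP.1 (n + 1) (fun N => (N j : ℝ) * (1 / (((N - ei j) j : ℕ) + 1 : ℝ)))
        (fun _ => 1) (by
          intro N _
          simp only [Pi.sub_apply, ei_apply, if_true]
          rcases Nat.eq_zero_or_pos (N j) with h | h
          · simp [h]
          · have : (((N j - 1 : ℕ)) : ℝ) + 1 = N j := by
              rw [Nat.cast_sub h]; push_cast; ring
            rw [this]
            have : (0 : ℝ) < N j := by exact_mod_cast h
            field_simp
            exact le_rfl)
      rwa [Ex_const P hP.2] at this
    calc _ ≤ P j * ((2 + 4 * (Real.log k) ^ 2) / (n + 1) ^ 2 +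
        4 / (k * (n + 1)) * Bx (P j) n (fun m => 1 / ((m : ℝ) + 1))) :=
          mul_le_mul_of_nonneg_left b1 hpj
      _ = P j * ((2 + 4 * (Real.log k) ^ 2) / (n + 1) ^ 2) + 4 / (k * (n + 1) ^ 2) *
        ((n + 1) * P j * Bx (P j) n (fun m => 1 / ((m : ℝ) + 1))) := by field_simp
      _ ≤ P j * ((2 + 4 * (Real.log k) ^ 2) / (n + 1) ^ 2) + 4 / (k * (n + 1) ^ 2) * 1 := by
        gcongr
      _ = _ := by ring
  refine (Finset.sum_le_sum fun j _ => h1 j).trans (le_of_eq ?_)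
  rw [Finset.sum_add_distrib, ← Finset.sum_mul, hP.2]
  simp
  field_simp
  ring

lemma entropy_eq {k : ℕ} (P : Fin k → ℝ) : entropy P = ∑ j, phi (P j) := rfl

lemma plugin_risk {k n : ℕ} (hk : 1 ≤ k) (hn : 1 ≤ n) :
    Rstar k n ≤ (4 * (Real.log k) ^ 2 + 6) / n + (k / n) ^ 2 := by
  obtain ⟨n, rfl⟩ : ∃ m, n = m + 1 := ⟨n - 1, by omega⟩
  refine Rstar_le hk (fun N => ∑ j, phi (N j / ((n + 1 : ℕ) : ℝ))) _ fun P hP => ?_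
  refine (additive_risk hP n (fun _ m => phi (m / ((n + 1 : ℕ) : ℝ))) (entropy P)).trans ?_
  have h1 := plugin_var hk hP n
  have hn0 : (0 : ℝ) < n + 1 := by positivity
  apply add_le_add
  · calc _ ≤ ((n : ℝ) + 1) * ((4 * (Real.log k) ^ 2 + 6) / (n + 1) ^ 2) :=
        mul_le_mul_of_nonneg_left h1 hn0.le
      _ = _ := by push_cast; field_simp
  · rw [entropy_eq, ← Finset.sum_sub_distrib]
    apply sq_le_sq'
    all_goals
      have h2 : |∑ j, (Bx (P j) (n + 1) (fun m => phi (m / ((n + 1 : ℕ) : ℝ))) - phi (P j))| ≤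
          k / ((n + 1 : ℕ) : ℝ) := by
        refine (Finset.abs_sum_le_sum_abs _ _).trans ?_
        refine (Finset.sum_le_sum fun j _ => plugin_bias (hP.1 j) (probVec_le_one hP j) hn).trans ?_
        simp
        rw [div_eq_mul_inv]
      have h3 := abs_le.mp h2
      linarith [h3.1, h3.2]

lemma HasSum.congr_fun' {f g : ℕ → ℂ} {a b : ℂ} (h : HasSum g b) (h1 : ∀ j, f j = g j)
    (h2 : a = b) : HasSum f a := by
  have : f = g := funext h1
  rw [this, h2]; exact h

lemma F_series (z : ℂ) (hz : ‖z‖ < 1) :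
    HasSum (fun j : ℕ => 2 / (((j : ℂ) + 3) * (j + 2) * (j + 1)) * z ^ (j + 3))
      ((1 - z) ^ 2 * (-Complex.log (1 - z)) - z + 3 / 2 * z ^ 2) := by
  have h0 := Complex.hasSum_taylorSeries_neg_log hz
  have h1 := (hasSum_nat_add_iff' 1).mpr h0
  have h2 := ((hasSum_nat_add_iff' 2).mpr h0).mul_left (-2 * z)
  have h3 := (hasSum_nat_add_iff' 3).mpr h0
  have h1' := h1.mul_left (z ^ 2)
  have := (h3.add h2).add h1'
  refine (HasSum.congr_fun' this ?_ ?_)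
  · intro j
    have e1 : (j : ℂ) + 1 ≠ 0 := by exact_mod_cast Nat.succ_ne_zero j
    have e2 : (j : ℂ) + 2 ≠ 0 := by exact_mod_cast Nat.succ_ne_zero (j + 1)
    have e3 : (j : ℂ) + 3 ≠ 0 := by exact_mod_cast Nat.succ_ne_zero (j + 2)
    push_cast
    field_simp
    ring
  · simp [Finset.sum_range_succ]
    ring

lemma cheb_coef_summable : Summable (fun j : ℕ => 2 / (((j : ℝ) + 3) * (j + 2) * (j + 1))) := by
  have h : Summable (fun j : ℕ => 2 * (1 / ((j + 1 : ℕ) : ℝ) ^ 2)) := by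
    have := (Real.summable_one_div_nat_pow (p := 2)).mpr (by norm_num)
    exact ((summable_nat_add_iff 1).mpr this).mul_left 2
  refine Summable.of_nonneg_of_le (fun j => by positivity) (fun j => ?_) h
  push_cast
  rw [mul_one_div]
  apply div_le_div_of_nonneg_left (by norm_num) (by positivity)
  have : (0 : ℝ) ≤ j := Nat.cast_nonneg j
  nlinarith

lemma F_series_circle (z : ℂ) (hz : ‖z‖ = 1) :
    HasSum (fun j : ℕ => 2 / (((j : ℂ) + 3) * (j + 2) * (j + 1)) * z ^ (j + 3))
      ((1 - z) ^ 2 * (-Complex.log (1 - z)) - z + 3 / 2 * z ^ 2) := by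
  have hsum : Summable (fun j : ℕ => 2 / (((j : ℂ) + 3) * (j + 2) * (j + 1)) * z ^ (j + 3)) := by
    apply Summable.of_norm
    refine cheb_coef_summable.congr (fun j => ?_)
    rw [norm_mul, norm_pow, hz, one_pow, mul_one]
    have : (2 : ℂ) / (((j : ℂ) + 3) * (j + 2) * (j + 1)) =
        ((2 / (((j : ℝ) + 3) * (j + 2) * (j + 1)) : ℝ) : ℂ) := by push_cast; rfl
    rw [this, Complex.norm_real, Real.norm_of_nonneg (by positivity)]
  have habel := Complex.tendsto_tsum_powerSeries_nhdsWithin_lt hsum.hasSum.tendsto_sum_nat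
  rw [Filter.tendsto_map'_iff] at habel
  have key : Filter.Tendsto (fun r : ℝ => ((1 - r * z) ^ 2 * (-Complex.log (1 - r * z)) - r * z
      + 3 / 2 * (r * z) ^ 2)) (nhdsWithin 1 (Set.Iio 1))
      (nhds ((1 - z) ^ 2 * (-Complex.log (1 - z)) - z + 3 / 2 * z ^ 2)) := by
    have hlog : Filter.Tendsto (fun r : ℝ => ((1 - r * z) ^ 2 * (-Complex.log (1 - r * z))))
        (nhdsWithin 1 (Set.Iio 1)) (nhds ((1 - z) ^ 2 * (-Complex.log (1 - z)))) := by
      by_cases h1 : z = 1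
      · subst h1
        have hc : Filter.Tendsto (fun r : ℝ => (1 - r) * ((1 - r) * Real.log (1 - r)))
            (nhdsWithin 1 (Set.Iio 1)) (nhds 0) := by
          have : Continuous (fun r : ℝ => (1 - r) * ((1 - r) * Real.log (1 - r))) := by
            have := Real.continuous_mul_log.comp (continuous_const.sub continuous_id : Continuous fun r : ℝ => 1 - r)
            exact (continuous_const.sub continuous_id).mul this
          have := (this.tendsto 1).mono_left (nhdsWithin_le_nhds (s := Set.Iio 1))
          simpa using this
        simp only [sub_self]
        have e0 : ((0 : ℂ) ^ 2 * -Complex.log 0) = ((-0 : ℝ) : ℂ) := by simp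
        rw [e0]
        refine Filter.Tendsto.congr' ?_ ((Complex.continuous_ofReal.tendsto _).comp hc.neg)
        filter_upwards [self_mem_nhdsWithin] with r hr
        have : (1 : ℂ) - r * 1 = ((1 - r : ℝ) : ℂ) := by push_cast; ring
        rw [this, ← Complex.ofReal_log (by linarith [Set.mem_Iio.mp hr])]
        simp only [Function.comp]
        push_cast
        ring
      · have hs : (1 - ((1 : ℝ) : ℂ) * z) ∈ Complex.slitPlane := by
          left
          have : z.re < 1 := by
            have hle := Complex.re_le_norm z
            rcases lt_or_eq_of_le (hz ▸ hle) with h | h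
            · exact h
            · exfalso; apply h1
              have hn := Complex.sq_norm z
              rw [hz, Complex.normSq_apply, h] at hn
              have : z.im = 0 := by nlinarith
              exact Complex.ext (by simp [h]) (by simp [this])
          simp; exact this
        have hcont : ContinuousAt (fun r : ℝ => ((1 - r * z) ^ 2 * (-Complex.log (1 - r * z)))) 1 := by
          have hc1 : ContinuousAt (fun r : ℝ => (1 - (r : ℂ) * z)) 1 := by fun_prop
          exact (hc1.pow 2).mul (hc1.clog hs).neg
        have := hcont.tendsto.mono_left (nhdsWithin_le_nhds (s := Set.Iio 1))
        simpa using this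
    have h2 : Filter.Tendsto (fun r : ℝ => (- (r * z) + 3 / 2 * (r * z) ^ 2))
        (nhdsWithin 1 (Set.Iio 1)) (nhds (- z + 3 / 2 * z ^ 2)) := by
      have hc1 : ContinuousAt (fun r : ℝ => (- ((r : ℂ) * z) + 3 / 2 * (r * z) ^ 2)) 1 := by fun_prop
      have := hc1.tendsto.mono_left (nhdsWithin_le_nhds (s := Set.Iio 1))
      simpa using this
    have := hlog.add h2
    simp only [← add_assoc, ← sub_eq_add_neg] at this
    exact this
  -- the Abel sums agree with the closed form
  have heq : (fun r : ℝ => ((r : ℂ)) ^ 3 * ∑' j : ℕ, 2 / (((j : ℂ) + 3) * (j + 2) * (j + 1)) * z ^ (j + 3) * (r : ℂ) ^ j)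
      =ᶠ[nhdsWithin 1 (Set.Iio 1)] (fun r : ℝ => ((1 - r * z) ^ 2 * (-Complex.log (1 - r * z)) - r * z
      + 3 / 2 * (r * z) ^ 2)) := by
    have hpos : ∀ᶠ r : ℝ in nhdsWithin 1 (Set.Iio 1), 0 < r :=
      nhdsWithin_le_nhds (lt_mem_nhds one_pos)
    filter_upwards [self_mem_nhdsWithin, hpos] with r hr hr0
    have hn : ‖(r : ℂ) * z‖ < 1 := by
      rw [norm_mul, hz, mul_one, Complex.norm_real, Real.norm_of_nonneg hr0.le]; exact hr
    rw [← (F_series _ hn).tsum_eq, ← tsum_mul_left]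
    congr 1
    funext j
    ring
  have hr3 : Filter.Tendsto (fun r : ℝ => ((r : ℂ)) ^ 3) (nhdsWithin 1 (Set.Iio 1)) (nhds 1) := by
    have hc1 : ContinuousAt (fun r : ℝ => ((r : ℂ)) ^ 3) 1 := by fun_prop
    have := hc1.tendsto.mono_left (nhdsWithin_le_nhds (s := Set.Iio 1))
    simpa using this
  have hA := (hr3.mul habel)
  have hB := key.congr' heq.symm
  have := tendsto_nhds_unique hA hB
  rw [one_mul] at this
  rw [← this]
  exact hsum.hasSum

lemma cheb_series (θ : ℝ) :
    HasSum (fun j : ℕ => Real.cos ((j + 2 : ℕ) * θ) / (((j : ℝ) + 3) * (j + 2) * (j + 1)))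
      ((1 - Real.cos θ) / 2 * Real.log (4 * ((1 - Real.cos θ) / 2)) - 1 / 2 + 3 / 4 * Real.cos θ) := by
  set z : ℂ := Complex.exp (θ * Complex.I) with hzdef
  have hz : ‖z‖ = 1 := Complex.norm_exp_ofReal_mul_I θ
  have hzc : z = Real.cos θ + Real.sin θ * Complex.I := by
    rw [hzdef, Complex.exp_mul_I, Complex.ofReal_cos, Complex.ofReal_sin]
  set w : ℂ := Complex.exp (-(θ * Complex.I)) with hwdef
  have hwz : w * z = 1 := by rw [hwdef, hzdef, ← Complex.exp_add]; simp
  have hwc : w = Real.cos θ - Real.sin θ * Complex.I := by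
    rw [hwdef, ← neg_mul, Complex.exp_mul_I, Complex.cos_neg, Complex.sin_neg, Complex.ofReal_cos, Complex.ofReal_sin]
    ring
  have h := Complex.hasSum_re ((F_series_circle z hz).mul_left (w / 2))
  convert h using 1
  · funext j
    have e : w / 2 * (2 / (((j : ℂ) + 3) * (j + 2) * (j + 1)) * z ^ (j + 3)) =
        ((1 / (((j : ℝ) + 3) * (j + 2) * (j + 1)) : ℝ) : ℂ) * z ^ (j + 2) := by
      push_cast
      calc _ = (w * z) * (1 / (((j : ℂ) + 3) * (j + 2) * (j + 1)) * z ^ (j + 2)) := by ring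
        _ = _ := by rw [hwz, one_mul]
    rw [e, Complex.re_ofReal_mul]
    have : (z ^ (j + 2)).re = Real.cos ((j + 2 : ℕ) * θ) := by
      rw [hzdef, ← Complex.exp_nat_mul]
      have : ((j + 2 : ℕ) : ℂ) * (θ * Complex.I) = (((j + 2 : ℕ) * θ : ℝ) : ℂ) * Complex.I := by
        push_cast; ring
      rw [this, Complex.exp_ofReal_mul_I_re]
    rw [this]; ring
  · have e : w / 2 * ((1 - z) ^ 2 * -Complex.log (1 - z) - z + 3 / 2 * z ^ 2) =
        ((1 - Real.cos θ : ℝ) : ℂ) * Complex.log (1 - z) - (1 / 2 : ℝ) + (3 / 4 : ℝ) * z := by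
      have : w * (1 - z) ^ 2 = ((2 * Real.cos θ - 2 : ℝ) : ℂ) := by
        calc w * (1 - z) ^ 2 = w - 2 * (w * z) + (w * z) * z := by ring
          _ = _ := by rw [hwz, hwc, hzc]; push_cast; ring
      calc _ = w * (1 - z) ^ 2 / 2 * (-Complex.log (1 - z)) - (w * z) / 2 + 3 / 4 * (w * z) * z := by ring
        _ = _ := by rw [this, hwz]; push_cast; ring
    rw [e, Complex.add_re, Complex.sub_re, Complex.re_ofReal_mul, Complex.re_ofReal_mul,
      Complex.ofReal_re, Complex.log_re]
    have hzre : z.re = Real.cos θ := Complex.exp_ofReal_mul_I_re θ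
    have hzim : z.im = Real.sin θ := Complex.exp_ofReal_mul_I_im θ
    have hnorm : 4 * ((1 - Real.cos θ) / 2) = ‖1 - z‖ ^ 2 := by
      rw [Complex.sq_norm, Complex.normSq_apply]
      simp only [Complex.sub_re, Complex.sub_im, Complex.one_re, Complex.one_im, hzre, hzim]
      nlinarith [Real.sin_sq_add_cos_sq θ]
    rw [hnorm, Real.log_pow, hzre]
    push_cast
    ring

lemma cheb_partial (N M : ℕ) :
    ∑ j ∈ Finset.range M, 1 / ((((j + N : ℕ) : ℝ) + 3) * ((j + N : ℕ) + 2) * ((j + N : ℕ) + 1)) =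
      1 / (2 * ((N : ℝ) + 1) * (N + 2)) - 1 / (2 * (((M + N : ℕ) : ℝ) + 1) * ((M + N : ℕ) + 2)) := by
  induction M with
  | zero => simp
  | succ M ih =>
    rw [Finset.sum_range_succ, ih]
    push_cast
    have : (0 : ℝ) ≤ M := Nat.cast_nonneg M
    have : (0 : ℝ) ≤ N := Nat.cast_nonneg N
    have e1 : (M : ℝ) + N + 1 ≠ 0 := by positivity
    have e2 : (M : ℝ) + N + 2 ≠ 0 := by positivity
    have e3 : (M : ℝ) + N + 3 ≠ 0 := by positivity
    have e4 : (M : ℝ) + 1 + N + 1 ≠ 0 := by positivity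
    have e5 : (M : ℝ) + 1 + N + 2 ≠ 0 := by positivity
    field_simp
    ring

lemma cheb_tail (θ : ℝ) (N : ℕ) :
    |((1 - Real.cos θ) / 2 * Real.log (4 * ((1 - Real.cos θ) / 2)) - 1 / 2 + 3 / 4 * Real.cos θ)
      - ∑ j ∈ Finset.range N, Real.cos ((j + 2 : ℕ) * θ) / (((j : ℝ) + 3) * (j + 2) * (j + 1))|
      ≤ 1 / (2 * ((N : ℝ) + 1) * (N + 2)) := by
  have h := (hasSum_nat_add_iff' N).mpr (cheb_series θ)
  have ht := h.tendsto_sum_nat.abs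
  refine le_of_tendsto ht (Filter.Eventually.of_forall fun M => ?_)
  refine (Finset.abs_sum_le_sum_abs _ _).trans ?_
  have h1 : ∑ j ∈ Finset.range M, |Real.cos ((j + N + 2 : ℕ) * θ) /
      ((((j + N : ℕ) : ℝ) + 3) * ((j + N : ℕ) + 2) * ((j + N : ℕ) + 1))| ≤
      ∑ j ∈ Finset.range M, 1 / ((((j + N : ℕ) : ℝ) + 3) * ((j + N : ℕ) + 2) * ((j + N : ℕ) + 1)) := by
    refine Finset.sum_le_sum fun j _ => ?_
    rw [abs_div, abs_of_pos (by positivity : (0 : ℝ) < (((j + N : ℕ) : ℝ) + 3) * ((j + N : ℕ) + 2) * ((j + N : ℕ) + 1))]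
    exact div_le_div_of_nonneg_right (Real.abs_cos_le_one _) (by positivity)
  refine h1.trans ?_
  rw [cheb_partial]
  have : 0 ≤ 1 / (2 * (((M + N : ℕ) : ℝ) + 1) * ((M + N : ℕ) + 2)) := by positivity
  linarith

/-- `f θ` is a polynomial of degree at most `L` in `(1 - cos θ)/2`, coefficient `ℓ¹` norm `≤ B`. -/
def PolyRep (f : ℝ → ℝ) (L : ℕ) (B : ℝ) : Prop :=
  ∃ q : ℕ → ℝ, (∀ θ, f θ = ∑ s ∈ Finset.range (L + 1), q s * ((1 - Real.cos θ) / 2) ^ s) ∧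
    ∑ s ∈ Finset.range (L + 1), |q s| ≤ B

lemma PolyRep.add {f g : ℝ → ℝ} {L : ℕ} {B C : ℝ} (hf : PolyRep f L B) (hg : PolyRep g L C) :
    PolyRep (fun θ => f θ + g θ) L (B + C) := by
  obtain ⟨q, h1, h2⟩ := hf
  obtain ⟨r, h3, h4⟩ := hg
  refine ⟨fun s => q s + r s, fun θ => ?_, ?_⟩
  · beta_reduce
    rw [h1, h3, ← Finset.sum_add_distrib]
    exact Finset.sum_congr rfl fun s _ => by ring
  · refine (Finset.sum_le_sum fun s _ => abs_add_le (q s) (r s)).trans ?_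
    rw [Finset.sum_add_distrib]; linarith

lemma PolyRep.smul {f : ℝ → ℝ} {L : ℕ} {B : ℝ} (hf : PolyRep f L B) (c : ℝ) :
    PolyRep (fun θ => c * f θ) L (|c| * B) := by
  obtain ⟨q, h1, h2⟩ := hf
  refine ⟨fun s => c * q s, fun θ => ?_, ?_⟩
  · beta_reduce
    rw [h1, Finset.mul_sum]
    exact Finset.sum_congr rfl fun s _ => by ring
  · simp only [abs_mul]
    rw [← Finset.mul_sum]
    exact mul_le_mul_of_nonneg_left h2 (abs_nonneg _)

lemma PolyRep.up {f : ℝ → ℝ} {L : ℕ} {B : ℝ} (hf : PolyRep f L B) : PolyRep f (L + 1) B := by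
  obtain ⟨q, h1, h2⟩ := hf
  refine ⟨fun s => if s < L + 1 then q s else 0, fun θ => ?_, ?_⟩
  · rw [h1, Finset.sum_range_succ _ (L + 1)]
    simp only [lt_irrefl, if_false, zero_mul, add_zero]
    exact Finset.sum_congr rfl fun s hs => by rw [if_pos (Finset.mem_range.mp hs)]
  · rw [Finset.sum_range_succ _ (L + 1)]
    simp only [lt_irrefl, if_false, abs_zero, add_zero]
    refine le_trans (le_of_eq ?_) h2
    exact Finset.sum_congr rfl fun s hs => by rw [if_pos (Finset.mem_range.mp hs)]

lemma PolyRep.mulx {f : ℝ → ℝ} {L : ℕ} {B : ℝ} (hf : PolyRep f L B) :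
    PolyRep (fun θ => ((1 - Real.cos θ) / 2) * f θ) (L + 1) B := by
  obtain ⟨q, h1, h2⟩ := hf
  refine ⟨fun s => if s = 0 then 0 else q (s - 1), fun θ => ?_, ?_⟩
  · beta_reduce
    rw [h1, Finset.sum_range_succ' _ (L + 1), Finset.mul_sum]
    simp only [if_true, zero_mul, add_zero]
    refine Finset.sum_congr rfl fun s _ => ?_
    rw [if_neg (Nat.succ_ne_zero s), Nat.add_sub_cancel]; ring
  · rw [Finset.sum_range_succ' _ (L + 1)]
    simpa using h2

lemma PolyRep.mono {f : ℝ → ℝ} {L M : ℕ} {B C : ℝ} (hf : PolyRep f L B) (h : L ≤ M) (hB : B ≤ C) :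
    PolyRep f M C := by
  have : ∀ d, PolyRep f (L + d) B := by
    intro d
    induction d with
    | zero => exact hf
    | succ d ih => exact ih.up
  obtain ⟨d, rfl⟩ := Nat.exists_eq_add_of_le h
  obtain ⟨q, h1, h2⟩ := this d
  exact ⟨q, h1, h2.trans hB⟩

lemma PolyRep.congr {f g : ℝ → ℝ} {L : ℕ} {B : ℝ} (hf : PolyRep f L B) (h : ∀ θ, g θ = f θ) :
    PolyRep g L B := by
  have : g = f := funext h
  rw [this]; exact hf

lemma PolyRep_const (c : ℝ) : PolyRep (fun _ => c) 0 |c| := by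
  refine ⟨fun _ => c, fun θ => ?_, ?_⟩ <;> simp

lemma PolyRep_cos (j : ℕ) : PolyRep (fun θ => Real.cos (j * θ)) j (7 ^ j) ∧
    PolyRep (fun θ => Real.cos ((j + 1 : ℕ) * θ)) (j + 1) (7 ^ (j + 1)) := by
  induction j with
  | zero =>
    constructor
    · refine ((PolyRep_const 1).mono le_rfl ?_).congr fun θ => ?_ <;> simp
    · refine (((PolyRep_const 1).up.add ((PolyRep_const 1).mulx.smul (-2))).mono le_rfl ?_).congr fun θ => ?_
      · norm_num [abs_of_neg, abs_of_pos]
      · simp; ring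
  | succ j ih =>
    refine ⟨ih.2, ?_⟩
    have h := ((ih.2.up.smul 2).add (ih.2.mulx.smul (-4))).add (ih.1.up.up.smul (-1))
    refine (h.mono le_rfl ?_).congr fun θ => ?_
    · have : (0 : ℝ) < 7 ^ j := by positivity
      rw [abs_of_pos (by norm_num : (0 : ℝ) < 2), abs_of_neg (by norm_num : (-4 : ℝ) < 0),
        abs_of_neg (by norm_num : (-1 : ℝ) < 0)]
      have e : (7 : ℝ) ^ (j + 1 + 1) = 49 * 7 ^ j := by ring
      have e' : (7 : ℝ) ^ (j + 1) = 7 * 7 ^ j := by ring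
      rw [e, e']; linarith
    · have e1 : ((j + 1 + 1 : ℕ) : ℝ) * θ = (j + 1 : ℕ) * θ + θ := by push_cast; ring
      have e2 : ((j : ℕ) : ℝ) * θ = (j + 1 : ℕ) * θ - θ := by push_cast; ring
      rw [e1, e2, Real.cos_add, Real.cos_sub]
      ring

lemma PolyRep_sum (N : ℕ) : PolyRep (fun θ => ∑ j ∈ Finset.range N,
    Real.cos ((j + 2 : ℕ) * θ) / (((j : ℝ) + 3) * (j + 2) * (j + 1))) (N + 1) (7 ^ (N + 2)) := by
  induction N with
  | zero =>
    refine ((PolyRep_const 0).mono (by omega) (by simp)).congr fun θ => ?_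
    simp
  | succ N ih =>
    have h := ih.up.add ((PolyRep_cos (N + 2)).1.smul (1 / (((N : ℝ) + 3) * (N + 2) * (N + 1))))
    refine (h.mono le_rfl ?_).congr fun θ => ?_
    · have h1 : |1 / (((N : ℝ) + 3) * (N + 2) * (N + 1))| ≤ 1 := by
        rw [abs_of_pos (by positivity)]
        rw [div_le_one (by positivity)]
        have : (0 : ℝ) ≤ N := Nat.cast_nonneg N
        have h1 : (1 : ℝ) ≤ (N + 3) * (N + 2) := by nlinarith
        nlinarith
      have h2 : (0 : ℝ) < 7 ^ (N + 2) := by positivity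
      have := mul_le_mul_of_nonneg_right h1 h2.le
      rw [pow_succ _ (N + 2)]
      linarith
    · rw [Finset.sum_range_succ]; ring

lemma poly_approx (L : ℕ) (hL : 1 ≤ L) : ∃ q : ℕ → ℝ,
    (∀ x : ℝ, 0 ≤ x → x ≤ 1 →
      |∑ s ∈ Finset.range (L + 1), q s * x ^ s - x * Real.log x| ≤ 1 / (2 * (L : ℝ) ^ 2)) ∧
    ∑ s ∈ Finset.range (L + 1), |q s| ≤ 9 * 7 ^ L := by
  obtain ⟨N, rfl⟩ : ∃ N, L = N + 1 := ⟨L - 1, by omega⟩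
  have hlog : |(-Real.log 4)| ≤ 2 := by
    rw [abs_neg, abs_of_pos (Real.log_pos (by norm_num))]
    have : Real.log 4 = 2 * Real.log 2 := by
      rw [show (4 : ℝ) = 2 ^ 2 by norm_num, Real.log_pow]; norm_num
    rw [this]; linarith [Real.log_two_lt_d9]
  have h0 := (((PolyRep_const 1).mulx.smul (-Real.log 4)).mono (M := N + 1) (by omega) le_rfl).add
    ((PolyRep_const (1 / 2)).mono (M := N + 1) (by omega) le_rfl)
  have h1 := (h0.add (((PolyRep_cos 1).1.smul (-(3 / 4))).mono (M := N + 1) (by omega) le_rfl)).add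
    (PolyRep_sum N)
  obtain ⟨q, hq, hB⟩ := h1
  refine ⟨q, fun x hx0 hx1 => ?_, hB.trans ?_⟩
  · have hθ : Real.cos (Real.arccos (1 - 2 * x)) = 1 - 2 * x :=
      Real.cos_arccos (by linarith) (by linarith)
    have ht := cheb_tail (Real.arccos (1 - 2 * x)) N
    have hqx := hq (Real.arccos (1 - 2 * x))
    simp only [Nat.cast_one, one_mul] at hqx
    rw [hθ] at ht hqx
    have e1 : (1 - (1 - 2 * x)) / 2 = x := by ring
    rw [e1] at ht hqx
    rw [← hqx]
    have e2 : x * Real.log (4 * x) = x * Real.log 4 + x * Real.log x := by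
      rcases hx0.eq_or_lt with h | h
      · rw [← h]; simp
      · rw [Real.log_mul (by norm_num) h.ne']; ring
    rw [e2] at ht
    rw [abs_sub_comm]
    have e3 : (1 : ℝ) / (2 * (N + 1) * (N + 2)) ≤ 1 / (2 * ((N + 1 : ℕ) : ℝ) ^ 2) := by
      push_cast
      apply div_le_div_of_nonneg_left (by norm_num) (by positivity)
      have : (0 : ℝ) ≤ N := Nat.cast_nonneg N
      nlinarith
    refine le_trans (le_of_eq ?_) (ht.trans e3)
    congr 1
    ring
  · have : (7 : ℝ) ≤ 7 ^ (N + 1) := by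
      rw [pow_succ]
      have : (1 : ℝ) ≤ 7 ^ N := one_le_pow₀ (by norm_num)
      linarith
    rw [abs_of_neg (by norm_num : (-(3 / 4) : ℝ) < 0), abs_of_pos (by norm_num : (0 : ℝ) < 1 / 2), abs_one,
      pow_succ _ (N + 1)]
    linarith

lemma chernoff_low {p : ℝ} (h0 : 0 ≤ p) (h1 : p ≤ 1) (m : ℕ) (l : ℝ) (h : 16 * l ≤ m * p) :
    Bx p m (fun N => if (N : ℝ) ≤ 5 * l then 1 else 0) ≤ Real.exp (-3 * l) := by
  have hle : Bx p m (fun N => if (N : ℝ) ≤ 5 * l then 1 else 0) ≤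
      Bx p m (fun N => Real.exp (5 * l) * (Real.exp (-1)) ^ N) := by
    refine Bx_mono p h0 h1 m _ _ fun N _ => ?_
    rw [← Real.exp_nat_mul, ← Real.exp_add]
    split_ifs with hN
    · apply Real.one_le_exp; linarith
    · positivity
  refine hle.trans ?_
  rw [Bx_mul, Bx_pow]
  have he : Real.exp (-1) ≤ 1 / 2 := by
    rw [Real.exp_neg, ← one_div]
    apply one_div_le_one_div_of_le (by norm_num)
    linarith [Real.add_one_le_exp 1]
  have hb : 1 - p + p * Real.exp (-1) ≤ Real.exp (-(p / 2)) := by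
    have := Real.add_one_le_exp (-(p / 2))
    nlinarith
  have hb0 : 0 ≤ 1 - p + p * Real.exp (-1) := by
    have := mul_nonneg h0 (Real.exp_pos (-1)).le
    linarith
  calc Real.exp (5 * l) * (1 - p + p * Real.exp (-1)) ^ m
      ≤ Real.exp (5 * l) * (Real.exp (-(p / 2))) ^ m := by gcongr
    _ = Real.exp (5 * l + m * (-(p / 2))) := by rw [← Real.exp_nat_mul, ← Real.exp_add]
    _ ≤ Real.exp (-3 * l) := by apply Real.exp_le_exp.mpr; linarith

lemma chernoff_high {p : ℝ} (h0 : 0 ≤ p) (h1 : p ≤ 1) (m : ℕ) (l : ℝ) (h : m * p ≤ l) :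
    Bx p m (fun N => if (N : ℝ) ≤ 5 * l then 0 else 1) ≤ Real.exp (-3 * l) := by
  have hle : Bx p m (fun N => if (N : ℝ) ≤ 5 * l then 0 else 1) ≤
      Bx p m (fun N => Real.exp (-(5 * l)) * (Real.exp 1) ^ N) := by
    refine Bx_mono p h0 h1 m _ _ fun N _ => ?_
    rw [← Real.exp_nat_mul, ← Real.exp_add]
    split_ifs with hN
    · positivity
    · apply Real.one_le_exp; push Not at hN; linarith
  refine hle.trans ?_
  rw [Bx_mul, Bx_pow]
  have he : Real.exp 1 ≤ 3 := by linarith [Real.exp_one_lt_d9]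
  have hb : 1 - p + p * Real.exp 1 ≤ Real.exp (2 * p) := by
    have := Real.add_one_le_exp (2 * p)
    nlinarith
  have hb0 : 0 ≤ 1 - p + p * Real.exp 1 := by
    have := mul_nonneg h0 (Real.exp_pos 1).le
    linarith
  calc Real.exp (-(5 * l)) * (1 - p + p * Real.exp 1) ^ m
      ≤ Real.exp (-(5 * l)) * (Real.exp (2 * p)) ^ m := by gcongr
    _ = Real.exp (-(5 * l) + m * (2 * p)) := by rw [← Real.exp_nat_mul, ← Real.exp_add]
    _ ≤ Real.exp (-3 * l) := by apply Real.exp_le_exp.mpr; linarith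

/-- Unbiased estimator of the rescaled polynomial. -/
def Uest (β : ℝ) (L : ℕ) (q : ℕ → ℝ) (m : ℕ) (N : ℕ) : ℝ :=
  -(β * ∑ s ∈ Finset.range (L + 1), q s / β ^ s * ((N.descFactorial s : ℝ) / m.descFactorial s))
    - (N : ℝ) / m * Real.log β

lemma Uest_mean (p β : ℝ) (L : ℕ) (q : ℕ → ℝ) (m : ℕ) (hL : L ≤ m) (hm : 1 ≤ m) :
    Bx p m (Uest β L q m) =
      -(β * ∑ s ∈ Finset.range (L + 1), q s * (p / β) ^ s) - p * Real.log β := by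
  have e : Uest β L q m = (fun N => (-β) * (∑ s ∈ Finset.range (L + 1),
      (q s / β ^ s / m.descFactorial s) * (N.descFactorial s : ℝ)) -
      (Real.log β / m) * (N.descFactorial 1 : ℝ)) := by
    funext N
    simp only [Uest, Nat.descFactorial_one]
    rw [neg_mul]
    congr 1
    · congr 2
      refine Finset.sum_congr rfl fun s _ => by ring
    · ring
  rw [e, Bx_sub p m (fun N => (-β) * (∑ s ∈ Finset.range (L + 1),
      (q s / β ^ s / m.descFactorial s) * (N.descFactorial s : ℝ))), Bx_mul, Bx_mul, Bx_sum, Bx_desc]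
  have hm0 : (m : ℝ) ≠ 0 := by positivity
  rw [neg_mul]
  congr 1
  · congr 2
    refine Finset.sum_congr rfl fun s hs => ?_
    rw [Bx_mul, Bx_desc, div_pow]
    have : (m.descFactorial s : ℝ) ≠ 0 := by
      have hs' : s ≤ m := by have := Finset.mem_range.mp hs; omega
      exact_mod_cast (Nat.descFactorial_pos.mpr hs').ne'
    field_simp
  · simp only [Nat.descFactorial_one, pow_one]; field_simp

lemma Uest_bias {p β : ℝ} (hβ : 0 < β) (h0 : 0 ≤ p) (hp : p ≤ β) (L : ℕ) (q : ℕ → ℝ) (m : ℕ)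
    (hL : L ≤ m) (hm : 1 ≤ m)
    (hq : ∀ x : ℝ, 0 ≤ x → x ≤ 1 →
      |∑ s ∈ Finset.range (L + 1), q s * x ^ s - x * Real.log x| ≤ 1 / (2 * (L : ℝ) ^ 2)) :
    |Bx p m (Uest β L q m) - phi p| ≤ β / (2 * (L : ℝ) ^ 2) := by
  rw [Uest_mean p β L q m hL hm, phi_eq]
  have hx := hq (p / β) (by positivity) ((div_le_one hβ).mpr hp)
  have e : p * Real.log p = β * (p / β * Real.log (p / β)) + p * Real.log β := by
    rcases h0.eq_or_lt with h | h
    · rw [← h]; simp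
    · rw [Real.log_div h.ne' hβ.ne']; field_simp; ring
  have e2 : -(β * ∑ s ∈ Finset.range (L + 1), q s * (p / β) ^ s) - p * Real.log β - -(p * Real.log p)
      = (-β) * (∑ s ∈ Finset.range (L + 1), q s * (p / β) ^ s - p / β * Real.log (p / β)) := by
    rw [e]; ring
  rw [e2, abs_mul, abs_neg, abs_of_pos hβ]
  calc β * _ ≤ β * (1 / (2 * (L : ℝ) ^ 2)) := mul_le_mul_of_nonneg_left hx hβ.le
    _ = _ := by ring

lemma desc_diff (N s : ℕ) : ((N + 1).descFactorial (s + 1) : ℝ) - N.descFactorial (s + 1) =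
    (s + 1) * N.descFactorial s := by
  rw [Nat.succ_descFactorial_succ, Nat.descFactorial_succ]
  rcases le_or_gt s N with h | h
  · push_cast [Nat.cast_sub h]; ring
  · rw [Nat.descFactorial_of_lt h]; simp

lemma desc_lower (m s : ℕ) (h : 2 * s ≤ m) : ((m : ℝ) / 2) ^ s ≤ m.descFactorial s := by
  have h1 := Nat.pow_sub_le_descFactorial m s
  have h2 : ((m : ℝ) / 2) ≤ ((m + 1 - s : ℕ) : ℝ) := by
    have : (m : ℝ) ≤ ((2 * (m + 1 - s) : ℕ) : ℝ) := by exact_mod_cast (by omega)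
    push_cast at this ⊢
    linarith
  calc ((m : ℝ) / 2) ^ s ≤ ((m + 1 - s : ℕ) : ℝ) ^ s := by gcongr
    _ ≤ _ := by exact_mod_cast h1

/-- Increment bound for the polynomial part. -/
lemma Uest_incr (l : ℝ) (hl : 0 < l) (L : ℕ) (hL : 48 * (L : ℝ) ≤ l) (q : ℕ → ℝ) (m : ℕ)
    (hm : 1 ≤ m) (hLm : 2 * L ≤ m)
    (hB : ∑ s ∈ Finset.range (L + 1), |q s| ≤ 9 * 7 ^ L) (N : ℕ) :
    |Uest (16 * l / m) L q m (N + 1) - Uest (16 * l / m) L q m N| ≤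
      (18 * L * 7 ^ L * (Real.exp (1 / 384)) ^ N + |Real.log (16 * l / m)|) / m := by
  set β := 16 * l / m with hβ
  have hm0 : (0 : ℝ) < m := by exact_mod_cast hm
  have hβ0 : 0 < β := by positivity
  have e : Uest β L q m (N + 1) - Uest β L q m N =
      -(β * ∑ s ∈ Finset.range (L + 1), q s / β ^ s *
        ((((N + 1).descFactorial s : ℝ) - N.descFactorial s) / m.descFactorial s))
      - 1 / m * Real.log β := by
    have : ∑ s ∈ Finset.range (L + 1), q s / β ^ s *
        ((((N + 1).descFactorial s : ℝ) - N.descFactorial s) / m.descFactorial s) =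
        ∑ s ∈ Finset.range (L + 1), q s / β ^ s * (((N + 1).descFactorial s : ℝ) / m.descFactorial s)
        - ∑ s ∈ Finset.range (L + 1), q s / β ^ s * ((N.descFactorial s : ℝ) / m.descFactorial s) := by
      rw [← Finset.sum_sub_distrib]
      exact Finset.sum_congr rfl fun s _ => by ring
    rw [this]
    simp only [Uest]
    push_cast
    ring
  rw [e]
  have hterm : ∀ s ∈ Finset.range (L + 1), |q s / β ^ s *
        ((((N + 1).descFactorial s : ℝ) - N.descFactorial s) / m.descFactorial s)| ≤
        |q s| * (2 * L / (m * β) * (Real.exp (1 / 384)) ^ N) := by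
    intro s hs
    cases s with
    | zero =>
      simp
      positivity
    | succ s =>
      have hsL : s + 1 ≤ L := by have := Finset.mem_range.mp hs; omega
      rw [desc_diff, abs_mul, abs_div, abs_of_pos (pow_pos hβ0 _)]
      have hlow := desc_lower m (s + 1) (by omega)
      have hpos : (0 : ℝ) < ((m : ℝ) / 2) ^ (s + 1) := by positivity
      rw [abs_of_nonneg (by positivity : (0 : ℝ) ≤ ((s : ℝ) + 1) * (N.descFactorial s : ℝ) / m.descFactorial (s + 1))]
      have h1 : ((s : ℝ) + 1) * (N.descFactorial s : ℝ) / m.descFactorial (s + 1) ≤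
          L * (N : ℝ) ^ s / ((m : ℝ) / 2) ^ (s + 1) := by
        have a1 : ((s : ℝ) + 1) ≤ L := by exact_mod_cast hsL
        have a2 : (N.descFactorial s : ℝ) ≤ (N : ℝ) ^ s := by
          exact_mod_cast Nat.descFactorial_le_pow N s
        gcongr
      have h2 : (N / (8 * l)) ^ s ≤ (Real.exp (1 / 384)) ^ N := by
        have a1 : (N : ℝ) / (8 * l) ≤ Real.exp (N / (8 * l)) := by
          linarith [Real.add_one_le_exp ((N : ℝ) / (8 * l))]
        calc (N / (8 * l)) ^ s ≤ (Real.exp (N / (8 * l))) ^ s := by gcongr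
          _ = Real.exp (s * (N / (8 * l))) := by rw [← Real.exp_nat_mul]
          _ ≤ Real.exp (N * (1 / 384)) := by
            apply Real.exp_le_exp.mpr
            have : (s : ℝ) ≤ L := by exact_mod_cast (by omega)
            have : 48 * (s : ℝ) ≤ l := by linarith
            rw [mul_div_assoc', div_le_iff₀ (by positivity)]
            have hN : (0 : ℝ) ≤ N := Nat.cast_nonneg N
            nlinarith
          _ = _ := by rw [← Real.exp_nat_mul]
      calc |q (s + 1)| / β ^ (s + 1) * (((s : ℝ) + 1) * (N.descFactorial s : ℝ) / m.descFactorial (s + 1))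
          ≤ |q (s + 1)| / β ^ (s + 1) * (L * (N : ℝ) ^ s / ((m : ℝ) / 2) ^ (s + 1)) := by gcongr
        _ = |q (s + 1)| * (2 * L / (m * β) * (N / (8 * l)) ^ s) := by
            have : (8 * l) = m * β / 2 := by rw [hβ]; field_simp; norm_num
            rw [this]
            simp only [div_pow, mul_pow, pow_succ]
            field_simp
        _ ≤ _ := by gcongr
  have hsum : |∑ s ∈ Finset.range (L + 1), q s / β ^ s *
        ((((N + 1).descFactorial s : ℝ) - N.descFactorial s) / m.descFactorial s)| ≤
      9 * 7 ^ L * (2 * L / (m * β) * (Real.exp (1 / 384)) ^ N) := by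
    refine (Finset.abs_sum_le_sum_abs _ _).trans ((Finset.sum_le_sum hterm).trans ?_)
    rw [← Finset.sum_mul]
    gcongr
  refine (abs_sub _ _).trans ?_
  rw [abs_neg, abs_mul, abs_mul, abs_of_pos hβ0, abs_of_pos (by positivity : (0 : ℝ) < 1 / m)]
  rw [add_div]
  refine add_le_add ?_ (le_of_eq (by ring))
  calc β * _ ≤ β * (9 * 7 ^ L * (2 * L / (m * β) * (Real.exp (1 / 384)) ^ N)) := by gcongr
    _ = _ := by field_simp; ring

lemma seven_pow_bound (L : ℕ) (l : ℝ) (hL : 48 * (L : ℝ) ≤ l) :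
    ((L : ℝ) * 7 ^ L) ^ 2 ≤ Real.exp (l / 8) := by
  have h1 : (L : ℝ) ≤ 2 ^ L := by exact_mod_cast (Nat.lt_two_pow_self (n := L)).le
  have h2 : (196 : ℝ) ≤ Real.exp 6 := by
    have := Real.exp_one_gt_d9
    have e : Real.exp 6 = (Real.exp 1) ^ 6 := by rw [← Real.exp_nat_mul]; norm_num
    rw [e]
    calc (196 : ℝ) ≤ 2.7 ^ 6 := by norm_num
      _ ≤ _ := by gcongr; linarith
  calc ((L : ℝ) * 7 ^ L) ^ 2 ≤ (2 ^ L * 7 ^ L) ^ 2 := by gcongr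
    _ = 196 ^ L := by rw [← mul_pow, ← pow_mul, mul_comm L 2, pow_mul]; norm_num
    _ ≤ (Real.exp 6) ^ L := by gcongr
    _ = Real.exp (L * 6) := by rw [← Real.exp_nat_mul]
    _ ≤ _ := by apply Real.exp_le_exp.mpr; linarith

lemma Uest_var {p : ℝ} (h0 : 0 ≤ p) (h1 : p ≤ 1) (l : ℝ) (hl : 0 < l) (L : ℕ)
    (hL : 48 * (L : ℝ) ≤ l) (q : ℕ → ℝ) (n : ℕ) (hLm : 2 * L ≤ n + 1)
    (hB : ∑ s ∈ Finset.range (L + 1), |q s| ≤ 9 * 7 ^ L)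
    (hp : p ≤ 16 * l / ((n + 1 : ℕ) : ℝ)) :
    Bx p n (fun N => (Uest (16 * l / ((n + 1 : ℕ) : ℝ)) L q (n + 1) (N + 1)
      - Uest (16 * l / ((n + 1 : ℕ) : ℝ)) L q (n + 1) N) ^ 2) ≤
      (648 * Real.exp (l / 2) + 2 * (Real.log (16 * l / ((n + 1 : ℕ) : ℝ))) ^ 2) / ((n + 1 : ℕ) : ℝ) ^ 2 := by
  set m : ℕ := n + 1 with hm
  have hm1 : 1 ≤ m := by omega
  have hm0 : (0 : ℝ) < m := by exact_mod_cast hm1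
  set β := 16 * l / (m : ℝ) with hβ
  have hpt : ∀ N : ℕ, N ≤ n → (Uest β L q m (N + 1) - Uest β L q m N) ^ 2 ≤
      (648 * ((L : ℝ) * 7 ^ L) ^ 2 / m ^ 2) * (Real.exp (1 / 192)) ^ N + 2 * (Real.log β) ^ 2 / m ^ 2 := by
    intro N _
    have h := Uest_incr l hl L hL q m hm1 hLm hB N
    rw [← hβ] at h
    have h2 := pow_le_pow_left₀ (abs_nonneg _) h 2
    rw [sq_abs] at h2
    refine h2.trans ?_
    have e : (Real.exp (1 / 192)) ^ N = ((Real.exp (1 / 384)) ^ N) ^ 2 := by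
      rw [← pow_mul, ← Real.exp_nat_mul, ← Real.exp_nat_mul]
      congr 1; push_cast; ring
    rw [e, div_pow, div_mul_eq_mul_div, ← add_div]
    apply div_le_div_of_nonneg_right _ (by positivity)
    have hs : (Real.log β) ^ 2 = |Real.log β| ^ 2 := (sq_abs _).symm
    rw [hs]
    nlinarith [sq_nonneg (18 * L * 7 ^ L * (Real.exp (1 / 384)) ^ N - |Real.log β|)]
  refine (Bx_mono p h0 h1 n _ _ hpt).trans ?_
  rw [Bx_add p n (fun N => (648 * ((L : ℝ) * 7 ^ L) ^ 2 / m ^ 2) * (Real.exp (1 / 192)) ^ N),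
    Bx_mul, Bx_pow, Bx_const, add_div]
  refine add_le_add ?_ le_rfl
  have hc : Real.exp (1 / 192) ≤ 1 + 1 / 96 := by
    have h := Real.add_one_le_exp (-(1 / 192) : ℝ)
    have h2 : Real.exp (-(1 / 192)) * Real.exp (1 / 192) = 1 := by rw [← Real.exp_add]; norm_num
    nlinarith [Real.exp_pos (1 / 192)]
  have hb : 1 - p + p * Real.exp (1 / 192) ≤ Real.exp (p / 96) := by
    have := Real.add_one_le_exp (p / 96)
    nlinarith
  have hb0 : 0 ≤ 1 - p + p * Real.exp (1 / 192) := by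
    have := mul_nonneg h0 (Real.exp_pos (1 / 192)).le
    linarith
  have hpow : (1 - p + p * Real.exp (1 / 192)) ^ n ≤ Real.exp (l / 6) := by
    calc _ ≤ (Real.exp (p / 96)) ^ n := by gcongr
      _ = Real.exp (n * (p / 96)) := by rw [← Real.exp_nat_mul]
      _ ≤ _ := by
        apply Real.exp_le_exp.mpr
        have hnm : (n : ℝ) ≤ m := by exact_mod_cast (by omega)
        have : m * p ≤ 16 * l := by rw [hβ, le_div_iff₀ hm0] at hp; linarith
        nlinarith
  calc 648 * ((L : ℝ) * 7 ^ L) ^ 2 / m ^ 2 * (1 - p + p * Real.exp (1 / 192)) ^ n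
      ≤ 648 * Real.exp (l / 8) / m ^ 2 * Real.exp (l / 6) := by
        have := seven_pow_bound L l hL
        gcongr
    _ = 648 * (Real.exp (l / 8) * Real.exp (l / 6)) / m ^ 2 := by ring
    _ ≤ _ := by
        apply div_le_div_of_nonneg_right _ (by positivity)
        rw [← Real.exp_add]
        have := Real.exp_le_exp.mpr (by linarith : l / 8 + l / 6 ≤ l / 2)
        linarith

/-- Coordinatewise estimator given the first half histogram. -/
def gest (l : ℝ) (L : ℕ) (q : ℕ → ℝ) (m : ℕ) (low : Prop) [Decidable low] (N : ℕ) : ℝ :=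
  if low then Uest (16 * l / m) L q m N else phi (N / m) + 1 / (2 * m)

lemma good_risk {k : ℕ} (hk : 1 ≤ k) {P : Fin k → ℝ} (hP : P ∈ probVec k) (l : ℝ)
    (hl : 1 ≤ l) (hlk : l = Real.log k) (L : ℕ) (hL1 : 1 ≤ L) (hL : 48 * (L : ℝ) ≤ l)
    (q : ℕ → ℝ) (n : ℕ) (hLm : 2 * L ≤ n + 1)
    (hq : ∀ x : ℝ, 0 ≤ x → x ≤ 1 →
      |∑ s ∈ Finset.range (L + 1), q s * x ^ s - x * Real.log x| ≤ 1 / (2 * (L : ℝ) ^ 2))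
    (hB : ∑ s ∈ Finset.range (L + 1), |q s| ≤ 9 * 7 ^ L)
    (low : Fin k → Prop) [∀ i, Decidable (low i)]
    (h1 : ∀ i, low i → P i ≤ 16 * l / ((n + 1 : ℕ) : ℝ))
    (h2 : ∀ i, ¬ low i → l / ((n + 1 : ℕ) : ℝ) ≤ P i) :
    Ex P (n + 1) (fun N => (∑ j, gest l L q (n + 1) (low j) (N j) - entropy P) ^ 2) ≤
      10368 * k * l * Real.exp (l / 2) / ((n + 1 : ℕ) : ℝ) ^ 2 +
      (2 * (Real.log (16 * l / ((n + 1 : ℕ) : ℝ))) ^ 2 + 4 * l ^ 2 + 6) / ((n + 1 : ℕ) : ℝ) +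
      (8 * k * l / (((n + 1 : ℕ) : ℝ) * L ^ 2) + 2 * k / (((n + 1 : ℕ) : ℝ) * l)
        + 1 / (2 * ((n + 1 : ℕ) : ℝ))) ^ 2 := by
  refine (additive_risk hP n (fun j => gest l L q (n + 1) (low j)) (entropy P)).trans ?_
  have hvar := plugin_var hk hP n
  rw [← hlk] at hvar
  have hcast : (n : ℝ) + 1 = ((n + 1 : ℕ) : ℝ) := by push_cast; rfl
  rw [hcast] at hvar ⊢
  set m : ℕ := n + 1 with hm
  have hm1 : 1 ≤ m := by omega
  have hm0 : (0 : ℝ) < m := by exact_mod_cast hm1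
  have hl0 : 0 < l := by linarith
  have hL0 : (0 : ℝ) < L := by exact_mod_cast hL1
  set β := 16 * l / (m : ℝ) with hβ
  have hβ0 : 0 < β := by positivity
  have hV : ∀ j, P j * Bx (P j) n (fun N => (gest l L q m (low j) (N + 1) - gest l L q m (low j) N) ^ 2) ≤
      β * (648 * Real.exp (l / 2) / m ^ 2) + P j * (2 * (Real.log β) ^ 2 / m ^ 2) +
      P j * Bx (P j) n (fun N => (phi (((N + 1 : ℕ) : ℝ) / m) - phi (N / m)) ^ 2) := by
    intro j
    have hp0 := hP.1 j
    have hp1 := probVec_le_one hP j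
    have n1 : 0 ≤ β * (648 * Real.exp (l / 2) / m ^ 2) := by positivity
    have n2 : 0 ≤ P j * (2 * (Real.log β) ^ 2 / m ^ 2) := by positivity
    have n3 : 0 ≤ P j * Bx (P j) n (fun N => (phi (((N + 1 : ℕ) : ℝ) / m) - phi (N / m)) ^ 2) :=
      mul_nonneg hp0 (Bx_nonneg _ hp0 hp1 _ _ fun _ => sq_nonneg _)
    by_cases hlow : low j
    · have hv := Uest_var hp0 hp1 l hl0 L hL q n hLm hB (h1 j hlow)
      simp only [gest, if_pos hlow]
      have hv2 := mul_le_mul_of_nonneg_left hv hp0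
      have h3 : P j * (648 * Real.exp (l / 2) / m ^ 2) ≤ β * (648 * Real.exp (l / 2) / m ^ 2) :=
        mul_le_mul_of_nonneg_right (h1 j hlow) (by positivity)
      rw [add_div, mul_add] at hv2
      linarith
    · simp only [gest, if_neg hlow, add_sub_add_right_eq_sub]
      linarith
  have hVs : (m : ℝ) * ∑ j, P j * Bx (P j) n (fun N => (gest l L q m (low j) (N + 1) - gest l L q m (low j) N) ^ 2)
      ≤ 10368 * k * l * Real.exp (l / 2) / (m : ℝ) ^ 2 + (2 * (Real.log β) ^ 2 + 4 * l ^ 2 + 6) / m := by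
    have h3 := Finset.sum_le_sum fun j (_ : j ∈ Finset.univ) => hV j
    rw [Finset.sum_add_distrib, Finset.sum_add_distrib, ← Finset.sum_mul, ← Finset.sum_mul, hP.2, Finset.sum_const,
      Finset.card_univ, Fintype.card_fin, nsmul_eq_mul] at h3
    have h4 := mul_le_mul_of_nonneg_left (h3.trans (add_le_add le_rfl hvar)) hm0.le
    refine h4.trans (le_of_eq ?_)
    rw [hβ]
    field_simp
    ring
  refine add_le_add hVs ?_
  have hbias : |∑ j, Bx (P j) m (gest l L q m (low j)) - entropy P| ≤
      8 * k * l / (m * L ^ 2) + 2 * k / (m * l) + 1 / (2 * m) := by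
    rw [entropy_eq, ← Finset.sum_sub_distrib]
    refine (Finset.abs_sum_le_sum_abs _ _).trans ?_
    have hj : ∀ j, |Bx (P j) m (gest l L q m (low j)) - phi (P j)| ≤
        8 * l / (m * L ^ 2) + 2 / (m * l) + P j * (1 / (2 * m)) := by
      intro j
      have hp0 := hP.1 j
      have hp1 := probVec_le_one hP j
      have n1 : 0 ≤ 8 * l / (m * (L : ℝ) ^ 2) := by positivity
      have n2 : 0 ≤ 2 / (m * l) := by positivity
      have n3 : 0 ≤ P j * (1 / (2 * m)) := by positivity
      by_cases hlow : low j
      · have e : gest l L q m (low j) = Uest β L q m := by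
          funext N; simp only [gest, if_pos hlow]; rfl
        rw [e]
        have := Uest_bias hβ0 hp0 (h1 j hlow) L q m (by omega) hm1 hq
        have e2 : β / (2 * (L : ℝ) ^ 2) = 8 * l / (m * L ^ 2) := by rw [hβ]; field_simp; norm_num
        linarith
      · have e : gest l L q m (low j) = fun N : ℕ => phi (N / m) + 1 / (2 * m) := by
          funext N; simp only [gest, if_neg hlow]
        have hb := h2 j hlow
        have hmp : l ≤ m * P j := by rw [div_le_iff₀ hm0] at hb; linarith
        have hr := refined_bias hp1 (n := m) (by linarith)
        rw [e, Bx_add _ m (fun N : ℕ => phi (N / m)), Bx_const]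
        have e3 : Bx (P j) m (fun N : ℕ => phi (N / m)) + 1 / (2 * m) - phi (P j) =
          (Bx (P j) m (fun N : ℕ => phi (N / m)) + (1 - P j) / (2 * m) - phi (P j)) + P j * (1 / (2 * m)) := by
          ring
        rw [e3]
        refine (abs_add_le _ _).trans ?_
        rw [abs_of_nonneg n3]
        have h5 : 2 / ((m : ℝ) ^ 2 * P j) ≤ 2 / (m * l) := by
          apply div_le_div_of_nonneg_left (by norm_num) (by positivity)
          nlinarith
        linarith
    refine (Finset.sum_le_sum fun j _ => hj j).trans (le_of_eq ?_)
    rw [Finset.sum_add_distrib, ← Finset.sum_mul, hP.2, Finset.sum_const,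
      Finset.card_univ, Fintype.card_fin, nsmul_eq_mul]
    ring
  rw [← sq_abs]
  exact pow_le_pow_left₀ (abs_nonneg _) hbias 2

lemma clip_sq (x h l : ℝ) (h0 : 0 ≤ h) (hl : h ≤ l) :
    (max 0 (min l x) - h) ^ 2 ≤ (x - h) ^ 2 := by
  apply sq_le_sq.mpr
  rcases le_total l x with h1 | h1
  · rw [min_eq_left h1, max_eq_right (h0.trans hl), abs_of_nonneg (by linarith),
      abs_of_nonneg (by linarith)]
    linarith
  · rw [min_eq_right h1]
    rcases le_total 0 x with h2 | h2
    · rw [max_eq_right h2]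
    · rw [max_eq_left h2, abs_of_nonpos (by linarith), abs_of_nonpos (by linarith)]
      linarith

lemma clip_sq2 (x h l : ℝ) (h0 : 0 ≤ h) (hl : h ≤ l) : (max 0 (min l x) - h) ^ 2 ≤ l ^ 2 := by
  have h1 : 0 ≤ max 0 (min l x) := le_max_left _ _
  have h2 : max 0 (min l x) ≤ l := max_le (h0.trans hl) (min_le_left _ _)
  apply sq_le_sq'
  · linarith
  · linarith

lemma upper_split {k : ℕ} (hk : 1 ≤ k) (l : ℝ)
    (hl : 1 ≤ l) (hlk : l = Real.log k) (L : ℕ) (hL1 : 1 ≤ L) (hL : 48 * (L : ℝ) ≤ l)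
    (n : ℕ) (hLm : 2 * L ≤ n + 1) :
    Rstar k ((n + 1) + (n + 1)) ≤
      (10368 * k * l * Real.exp (l / 2) / ((n + 1 : ℕ) : ℝ) ^ 2 +
      (2 * (Real.log (16 * l / ((n + 1 : ℕ) : ℝ))) ^ 2 + 4 * l ^ 2 + 6) / ((n + 1 : ℕ) : ℝ) +
      (8 * k * l / (((n + 1 : ℕ) : ℝ) * L ^ 2) + 2 * k / (((n + 1 : ℕ) : ℝ) * l)
        + 1 / (2 * ((n + 1 : ℕ) : ℝ))) ^ 2) + l ^ 2 * (k * Real.exp (-3 * l)) := by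
  obtain ⟨q, hq, hB⟩ := poly_approx L hL1
  classical
  refine Rstar_split hk (fun M M' => max 0 (min l
    (∑ i, gest l L q (n + 1) ((M i : ℝ) ≤ 5 * l) (M' i)))) _ fun P hP => ?_
  set G := (10368 * k * l * Real.exp (l / 2) / ((n + 1 : ℕ) : ℝ) ^ 2 +
      (2 * (Real.log (16 * l / ((n + 1 : ℕ) : ℝ))) ^ 2 + 4 * l ^ 2 + 6) / ((n + 1 : ℕ) : ℝ) +
      (8 * k * l / (((n + 1 : ℕ) : ℝ) * L ^ 2) + 2 * k / (((n + 1 : ℕ) : ℝ) * l)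
        + 1 / (2 * ((n + 1 : ℕ) : ℝ))) ^ 2) with hG
  have hm0 : (0 : ℝ) < ((n + 1 : ℕ) : ℝ) := by positivity
  have hl0 : 0 < l := by linarith
  have hG0 : 0 ≤ G := by positivity
  set β := 16 * l / ((n + 1 : ℕ) : ℝ) with hβ
  have hbβ : l / ((n + 1 : ℕ) : ℝ) ≤ β := by
    rw [hβ]; apply div_le_div_of_nonneg_right _ hm0.le; linarith
  have hH0 := entropy_nonneg hP
  have hH1 := entropy_le_log hk hP
  rw [← hlk] at hH1
  let bad : Fin k → ℕ → ℝ := fun i N => if (N : ℝ) ≤ 5 * l then (if β < P i then 1 else 0)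
    else (if P i < l / ((n + 1 : ℕ) : ℝ) then 1 else 0)
  have hbad0 : ∀ i N, 0 ≤ bad i N := by
    intro i N; simp only [bad]; split_ifs <;> norm_num
  have hpt : ∀ M : Fin k → ℕ, ∑ i, M i = n + 1 → Ex P (n + 1) (fun M' => (max 0 (min l
      (∑ i, gest l L q (n + 1) ((M i : ℝ) ≤ 5 * l) (M' i))) - entropy P) ^ 2) ≤
      G + l ^ 2 * ∑ i, bad i (M i) := by
    intro M _
    by_cases hgood : ∀ i, bad i (M i) = 0
    · have hr := good_risk hk hP l hl hlk L hL1 hL q n hLm hq hB (fun i => (M i : ℝ) ≤ 5 * l)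
        (fun i hi => by
          have := hgood i
          simp only [bad, if_pos hi] at this
          by_contra hc
          push Not at hc
          rw [if_pos hc] at this
          norm_num at this)
        (fun i hi => by
          have := hgood i
          simp only [bad, if_neg hi] at this
          by_contra hc
          push Not at hc
          rw [if_pos hc] at this
          norm_num at this)
      have h1 := Ex_mono P hP.1 (n + 1) _ _ (fun M' _ => clip_sq
        (∑ i, gest l L q (n + 1) ((M i : ℝ) ≤ 5 * l) (M' i)) (entropy P) l hH0 hH1)
      have h2 : 0 ≤ l ^ 2 * ∑ i, bad i (M i) :=
        mul_nonneg (sq_nonneg _) (Finset.sum_nonneg fun i _ => hbad0 i _)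
      linarith [h1.trans hr]
    · push Not at hgood
      obtain ⟨i, hi⟩ := hgood
      have hi1 : bad i (M i) = 1 := by
        simp only [bad] at hi ⊢
        split_ifs at hi ⊢ <;> simp_all
      have h3 : 1 ≤ ∑ i, bad i (M i) := by
        rw [← hi1]
        exact Finset.single_le_sum (f := fun i => bad i (M i)) (fun j _ => hbad0 j _) (Finset.mem_univ i)
      have h1 := Ex_mono P hP.1 (n + 1) _ _ (fun M' _ => clip_sq2
        (∑ i, gest l L q (n + 1) ((M i : ℝ) ≤ 5 * l) (M' i)) (entropy P) l hH0 hH1)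
      rw [Ex_const P hP.2] at h1
      nlinarith [sq_nonneg l]
  refine (Ex_mono P hP.1 (n + 1) _ _ hpt).trans ?_
  rw [Ex_add P (n + 1) (fun _ => G), Ex_const P hP.2, Ex_mul P (n + 1) (l ^ 2), Ex_sum P]
  refine add_le_add le_rfl (mul_le_mul_of_nonneg_left ?_ (sq_nonneg _))
  have hb : ∀ i, Ex P (n + 1) (fun M => bad i (M i)) ≤ Real.exp (-3 * l) := by
    intro i
    rw [Ex_marginal P hP.2 (n + 1) i (bad i)]
    have hp0 := hP.1 i
    have hp1 := probVec_le_one hP i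
    by_cases c1 : β < P i
    · refine (Bx_mono _ hp0 hp1 _ _ (fun N => if (N : ℝ) ≤ 5 * l then 1 else 0) fun N _ => ?_).trans
        (chernoff_low hp0 hp1 (n + 1) l ?_)
      · have c2 : ¬ P i < l / ((n + 1 : ℕ) : ℝ) := by push Not; linarith
        simp only [bad, if_pos c1, if_neg c2]; exact le_rfl
      · rw [hβ, div_lt_iff₀ hm0] at c1; linarith
    · by_cases c2 : P i < l / ((n + 1 : ℕ) : ℝ)
      · refine (Bx_mono _ hp0 hp1 _ _ (fun N => if (N : ℝ) ≤ 5 * l then 0 else 1) fun N _ => ?_).trans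
          (chernoff_high hp0 hp1 (n + 1) l ?_)
        · simp only [bad, if_neg c1, if_pos c2]; exact le_rfl
        · rw [lt_div_iff₀ hm0] at c2; linarith
      · have : bad i = fun _ => 0 := by
          funext N; simp only [bad, if_neg c1, if_neg c2, ite_self]
        rw [this, Bx_const]; positivity
  refine (Finset.sum_le_sum fun i _ => hb i).trans (le_of_eq ?_)
  rw [Finset.sum_const, Finset.card_univ, Fintype.card_fin, nsmul_eq_mul]

lemma log_sq_le_nat (k : ℝ) (hk : 1 ≤ k) : (Real.log k) ^ 2 ≤ 4 * k := by
  have h := Real.add_one_le_exp (Real.log k / 2)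
  have h0 := Real.log_nonneg hk
  have h2 : (Real.exp (Real.log k / 2)) ^ 2 = k := by
    rw [← Real.exp_nat_mul]
    rw [show ((2 : ℕ) : ℝ) * (Real.log k / 2) = Real.log k by push_cast; ring, Real.exp_log (by linarith)]
  nlinarith [Real.exp_pos (Real.log k / 2)]

set_option maxHeartbeats 1000000 in
lemma upper_main {k n : ℕ} (hk : 48 ≤ Real.log k) (hn : (k : ℝ) / Real.log k ≤ n)
    (hn2 : (n : ℝ) ≤ (k : ℝ) ^ 2) :
    Rstar k n ≤ 10 ^ 11 * (((k : ℝ) / (n * Real.log k)) ^ 2 + (Real.log k) ^ 2 / n) := by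
  set l := Real.log k with hl
  have hl0 : 0 < l := by linarith
  have hk0 : 0 < k := by
    rcases Nat.eq_zero_or_pos k with h | h
    · rw [h] at hl; simp at hl; linarith
    · exact h
  have hkR : (1 : ℝ) ≤ k := by exact_mod_cast hk0
  have hkR0 : (0 : ℝ) < k := by linarith
  have hl2 : l ^ 2 ≤ 4 * k := log_sq_le_nat k hkR
  have hkl : l ≤ k / 12 := by nlinarith
  have hn12 : 12 ≤ (n : ℝ) := by
    refine le_trans ?_ hn
    rw [le_div_iff₀ hl0]; linarith
  have hnl : l / 4 ≤ n := by
    refine le_trans ?_ hn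
    rw [le_div_iff₀ hl0]; nlinarith
  have hn12' : 12 ≤ n := by exact_mod_cast hn12
  obtain ⟨m', hm'⟩ : ∃ m', n / 2 = m' + 1 := ⟨n / 2 - 1, by omega⟩
  set m : ℕ := m' + 1 with hm
  have h2m : m + m ≤ n := by omega
  have h3m : (n : ℝ) ≤ 3 * m := by exact_mod_cast (by omega : n ≤ 3 * m)
  have hmn : (m : ℝ) ≤ n := by exact_mod_cast (by omega : m ≤ n)
  have hm0 : (0 : ℝ) < m := by positivity
  have hn0 : (0 : ℝ) < n := by linarith
  -- choice of the degree
  have hLfl : (⌊l / 48⌋₊ : ℝ) ≤ l / 48 := Nat.floor_le (by positivity)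
  have hLfl2 : l / 48 < ⌊l / 48⌋₊ + 1 := Nat.lt_floor_add_one _
  have hL1 : 1 ≤ ⌊l / 48⌋₊ := by
    apply Nat.le_floor; push_cast; linarith
  set L := ⌊l / 48⌋₊ with hL
  have hL1' : (1 : ℝ) ≤ L := by exact_mod_cast hL1
  have hL96 : l / 96 ≤ L := by linarith
  have h2L : 2 * L ≤ m' + 1 := by
    have : ((2 * L : ℕ) : ℝ) ≤ m := by push_cast; linarith
    exact_mod_cast this
  have hmain := upper_split hk0 l (by linarith) hl L hL1 (by linarith) m' h2L
  rw [← hm] at hmain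
  refine (Rstar_anti hk0 h2m).trans (hmain.trans ?_)
  set A := (k : ℝ) / (m * l) with hA
  have hA0 : 0 < A := by positivity
  have hAn : A ≤ 3 * (k / (n * l)) := by
    rw [hA, mul_div_assoc', div_le_div_iff₀ (by positivity) (by positivity)]
    have : (k : ℝ) * (n * l) ≤ k * (3 * m * l) := by gcongr
    linarith
  have hexpk : Real.exp l = k := Real.exp_log hkR0
  -- first term
  have hT1 : 10368 * k * l * Real.exp (l / 2) / (m : ℝ) ^ 2 ≤ 10368 * 216 * A ^ 2 := by
    have h6 := Real.add_one_le_exp (l / 6)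
    have hc : l ^ 3 ≤ 216 * Real.exp (l / 2) := by
      have : (l / 6) ^ 3 ≤ (Real.exp (l / 6)) ^ 3 := by gcongr; linarith
      have e : (Real.exp (l / 6)) ^ 3 = Real.exp (l / 2) := by
        rw [← Real.exp_nat_mul]; congr 1; push_cast; ring
      rw [e] at this
      have e2 : (l / 6) ^ 3 = l ^ 3 / 216 := by ring
      rw [e2] at this
      linarith
    have hkk : Real.exp (l / 2) * Real.exp (l / 2) = k := by
      rw [← Real.exp_add, ← hexpk]; congr 1; ring
    have e3 : 10368 * k * l * Real.exp (l / 2) / (m : ℝ) ^ 2 =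
        10368 * k * (l ^ 3 * Real.exp (l / 2)) / (m ^ 2 * l ^ 2) := by
      field_simp
    have e4 : 10368 * 216 * A ^ 2 = 10368 * k * (216 * k) / (m ^ 2 * l ^ 2) := by
      rw [hA]; field_simp
    rw [e3, e4]
    apply div_le_div_of_nonneg_right _ (by positivity)
    apply mul_le_mul_of_nonneg_left _ (by positivity)
    calc l ^ 3 * Real.exp (l / 2) ≤ 216 * Real.exp (l / 2) * Real.exp (l / 2) := by gcongr
      _ = 216 * k := by rw [mul_assoc, hkk]
  -- second term
  have hlogβ : (Real.log (16 * l / m)) ^ 2 ≤ 4 * l ^ 2 := by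
    have hm1 : (1 : ℝ) ≤ m := by exact_mod_cast (by omega : 1 ≤ m)
    have hlk2 : Real.log ((k : ℝ) ^ 2) = 2 * l := by rw [Real.log_pow, ← hl]; norm_num
    have up : Real.log (16 * l / m) ≤ 2 * l := by
      rw [← hlk2]
      apply Real.log_le_log (by positivity)
      rw [div_le_iff₀ hm0]
      have h16 : 16 * l ≤ k ^ 2 := by nlinarith
      nlinarith [sq_nonneg (k : ℝ)]
    have lo : -(2 * l) ≤ Real.log (16 * l / m) := by
      rw [← hlk2, ← Real.log_inv]
      apply Real.log_le_log (by positivity)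
      rw [inv_eq_one_div, div_le_div_iff₀ (by positivity) hm0]
      nlinarith [sq_nonneg (k : ℝ)]
    have := sq_le_sq' lo up
    linarith [this, (by ring : (2 * l) ^ 2 = 4 * l ^ 2)]
  have hT2 : (2 * (Real.log (16 * l / m)) ^ 2 + 4 * l ^ 2 + 6) / (m : ℝ) ≤ 54 * (l ^ 2 / n) := by
    rw [mul_div_assoc', div_le_div_iff₀ hm0 hn0]
    have : 2 * (Real.log (16 * l / m)) ^ 2 + 4 * l ^ 2 + 6 ≤ 18 * l ^ 2 := by
      have h1 : 1 ≤ l ^ 2 := one_le_pow₀ (by linarith)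
      linarith
    calc _ ≤ 18 * l ^ 2 * (3 * m) := by gcongr
      _ = _ := by ring
  -- third term
  have hT3 : 8 * k * l / ((m : ℝ) * L ^ 2) + 2 * k / (m * l) + 1 / (2 * m) ≤ 73731 * A := by
    have a1 : 8 * k * l / ((m : ℝ) * L ^ 2) ≤ 73728 * A := by
      rw [hA, mul_div_assoc', div_le_div_iff₀ (by positivity) (by positivity)]
      have : l ^ 2 ≤ 9216 * (L : ℝ) ^ 2 := by
        have := pow_le_pow_left₀ (by positivity) hL96 2
        rw [div_pow] at this
        linarith
      calc 8 * k * l * (m * l) = 8 * k * m * l ^ 2 := by ring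
        _ ≤ 8 * k * m * (9216 * (L : ℝ) ^ 2) := by gcongr
        _ = _ := by ring
    have a2 : 2 * k / (m * l) = 2 * A := by rw [hA]; ring
    have a3 : 1 / (2 * (m : ℝ)) ≤ A := by
      rw [hA, div_le_div_iff₀ (by positivity) (by positivity)]
      nlinarith
    linarith
  have hT3' : (8 * k * l / ((m : ℝ) * L ^ 2) + 2 * k / (m * l) + 1 / (2 * m)) ^ 2 ≤ (73731 * A) ^ 2 := by
    apply pow_le_pow_left₀ (by positivity) hT3
  have hT4 : l ^ 2 * (k * Real.exp (-3 * l)) ≤ l ^ 2 / n := by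
    have e : k * Real.exp (-3 * l) = 1 / (k : ℝ) ^ 2 := by
      have : Real.exp (-3 * l) = 1 / (k : ℝ) ^ 3 := by
        rw [show -3 * l = -(((3 : ℕ) : ℝ) * l) by push_cast; ring, Real.exp_neg, Real.exp_nat_mul, hexpk, one_div]
      rw [this]; field_simp
    rw [e, ← mul_one_div (l ^ 2) (n : ℝ)]
    exact mul_le_mul_of_nonneg_left (one_div_le_one_div_of_le hn0 hn2) (sq_nonneg l)
  have hA2 : A ^ 2 ≤ 9 * (k / (n * l)) ^ 2 := by
    have := pow_le_pow_left₀ hA0.le hAn 2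
    linarith [this, (by ring : (3 * ((k : ℝ) / (n * l))) ^ 2 = 9 * (k / (n * l)) ^ 2)]
  have hn1 : 0 ≤ l ^ 2 / (n : ℝ) := by positivity
  have hn3 : 0 ≤ ((k : ℝ) / (n * l)) ^ 2 := by positivity
  rw [mul_pow] at hT3'
  linarith

lemma upper_all {k n : ℕ} (hk : 2 ≤ k) (hn1 : 1 ≤ n) (hn : (k : ℝ) / Real.log k ≤ n) :
    Rstar k n ≤ 10 ^ 11 * (((k : ℝ) / (n * Real.log k)) ^ 2 + (Real.log k) ^ 2 / n) := by
  have hk2 : (2 : ℝ) ≤ k := by exact_mod_cast hk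
  have hn0 : (0 : ℝ) < n := by exact_mod_cast hn1
  have hl2 : 0.69 ≤ Real.log k := by
    have := Real.log_le_log (by norm_num) hk2
    linarith [Real.log_two_gt_d9]
  have hpl := plugin_risk (k := k) (by omega) hn1
  set l := Real.log k with hl
  have hl0 : 0 < l := by linarith
  have hlsq : 1 ≤ 3 * l ^ 2 := by nlinarith
  have h1 : (4 * l ^ 2 + 6) / n ≤ 22 * (l ^ 2 / n) := by
    rw [mul_div_assoc']
    apply div_le_div_of_nonneg_right _ hn0.le
    linarith
  have p1 : 0 ≤ ((k : ℝ) / (n * l)) ^ 2 := by positivity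
  have p2 : 0 ≤ l ^ 2 / (n : ℝ) := by positivity
  by_cases h48 : 48 ≤ l
  · by_cases hnk : (n : ℝ) ≤ (k : ℝ) ^ 2
    · exact upper_main h48 hn hnk
    · push Not at hnk
      have h2 : ((k : ℝ) / n) ^ 2 ≤ 3 * (l ^ 2 / n) := by
        rw [div_pow, mul_div_assoc', div_le_div_iff₀ (by positivity) hn0]
        have : (k : ℝ) ^ 2 * n ≤ n * n := by gcongr
        nlinarith [mul_pos hn0 hn0]
      linarith
  · push Not at h48
    have h2 : ((k : ℝ) / n) ^ 2 ≤ 2304 * ((k : ℝ) / (n * l)) ^ 2 := by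
      have e : ((k : ℝ) / n) ^ 2 = l ^ 2 * ((k : ℝ) / (n * l)) ^ 2 := by field_simp
      rw [e]
      apply mul_le_mul_of_nonneg_right _ p1
      nlinarith
    linarith

lemma prod_pow_add_ei {k : ℕ} (r : Fin k → ℝ) (M : Fin k → ℕ) (i : Fin k) :
    ∏ j, r j ^ ((M + ei i) j) = r i * ∏ j, r j ^ (M j) := by
  have h : ∀ j, r j ^ ((M + ei i) j) = (if j = i then r i else 1) * r j ^ (M j) := by
    intro j
    rw [Pi.add_apply, ei_apply]
    split_ifs with h
    · subst h; rw [pow_succ]; ring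
    · simp
  simp only [h]
  rw [Finset.prod_mul_distrib]
  simp

lemma Ex_change {k : ℕ} (p q : Fin k → ℝ) (hp : ∀ i, 0 < p i) (n : ℕ) (f : (Fin k → ℕ) → ℝ) :
    Ex q n f = Ex p n (fun N => f N * ∏ j, (q j / p j) ^ (N j)) := by
  induction n generalizing f with
  | zero => simp [Ex]
  | succ n ih =>
    simp only [Ex]
    refine Finset.sum_congr rfl fun i _ => ?_
    rw [ih (fun M => f (M + ei i))]
    have : (fun M => f (M + ei i) * ∏ j, (q j / p j) ^ ((M + ei i) j)) =
        (fun M => (q i / p i) * (f (M + ei i) * ∏ j, (q j / p j) ^ (M j))) := by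
      funext M; rw [prod_pow_add_ei]; ring
    rw [this, Ex_mul]
    have := (hp i).ne'
    field_simp

lemma Ex_prod {k : ℕ} (p s : Fin k → ℝ) (n : ℕ) :
    Ex p n (fun N => ∏ j, s j ^ (N j)) = (∑ i, p i * s i) ^ n := by
  induction n with
  | zero => simp [Ex]
  | succ n ih =>
    simp only [Ex, prod_pow_add_ei]
    simp only [Ex_mul, ih]
    rw [pow_succ, Finset.mul_sum]
    exact Finset.sum_congr rfl fun i _ => by ring

lemma chi_bound {k : ℕ} (p q : Fin k → ℝ) (hp : ∀ i, 0 < p i) (hps : ∑ i, p i = 1)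
    (hqs : ∑ i, q i = 1) (n : ℕ) (f : (Fin k → ℕ) → ℝ) (hf : ∀ N, 0 ≤ f N ∧ f N ≤ 1) :
    (Ex q n f - Ex p n f) ^ 2 ≤ (∑ i, q i ^ 2 / p i) ^ n - 1 := by
  set w : (Fin k → ℕ) → ℝ := fun N => ∏ j, (q j / p j) ^ (N j) with hw
  have h1 : Ex q n f - Ex p n f = Ex p n (fun N => f N * (w N - 1)) := by
    rw [Ex_change p q hp n f, ← Ex_sub p n (fun N => f N * w N)]
    congr 1; funext N; ring
  rw [h1]
  have hp0 : ∀ i, 0 ≤ p i := fun i => (hp i).le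
  refine (Ex_sq_nonneg p hp0 hps n _).trans ?_
  have h2 : Ex p n (fun N => (f N * (w N - 1)) ^ 2) ≤
      Ex p n (fun N => (w N ^ 2 + (-2) * w N) + 1) := by
    refine Ex_mono p hp0 n _ _ fun N _ => ?_
    have hf2 : f N ^ 2 ≤ 1 := pow_le_one₀ (hf N).1 (hf N).2
    have := mul_le_mul_of_nonneg_right hf2 (sq_nonneg (w N - 1))
    nlinarith
  refine h2.trans (le_of_eq ?_)
  have hw2 : (fun N => w N ^ 2) = fun N => ∏ j, ((q j / p j) ^ 2) ^ (N j) := by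
    funext N
    rw [hw]
    simp only [← Finset.prod_pow, ← pow_mul, mul_comm]
  rw [Ex_add p n (fun N => w N ^ 2 + (-2) * w N), Ex_add p n (fun N => w N ^ 2), Ex_mul, Ex_const p hps,
    hw2, hw, Ex_prod, Ex_prod]
  have e1 : ∑ i, p i * (q i / p i) = 1 := by
    rw [← hqs]
    refine Finset.sum_congr rfl fun i _ => ?_
    have := (hp i).ne'
    field_simp
  have e2 : ∑ i, p i * (q i / p i) ^ 2 = ∑ i, q i ^ 2 / p i := by
    refine Finset.sum_congr rfl fun i _ => ?_
    have := (hp i).ne'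
    field_simp
  rw [e1, e2]; ring

lemma lecam_pt (e h0 h1 : ℝ) (h : h0 ≤ h1) :
    ((h1 - h0) ^ 2 / 4) * (if (h0 + h1) / 2 ≤ e then 1 else 0) ≤ (e - h0) ^ 2 ∧
    ((h1 - h0) ^ 2 / 4) * (1 - (if (h0 + h1) / 2 ≤ e then 1 else 0)) ≤ (e - h1) ^ 2 := by
  split_ifs with hc
  · constructor
    · nlinarith
    · simp; positivity
  · push Not at hc
    constructor
    · simp; positivity
    · nlinarith

/-- The two point family. -/
def twoP (k : ℕ) (w : ℝ) : Fin (k + 1) → ℝ := Fin.cons (1 - w) (fun _ => w / k)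

lemma twoP_sum (k : ℕ) (hk : 1 ≤ k) (w : ℝ) : ∑ i, twoP k w i = 1 := by
  have : (k : ℝ) ≠ 0 := by positivity
  simp [twoP, Fin.sum_univ_succ]
  field_simp
  ring

lemma twoP_pos (k : ℕ) (hk : 1 ≤ k) (w : ℝ) (h0 : 0 < w) (h1 : w < 1) (i : Fin (k + 1)) :
    0 < twoP k w i := by
  have : (0 : ℝ) < k := by positivity
  refine Fin.cases ?_ (fun j => ?_) i
  · simp [twoP]; linarith
  · simp [twoP]; positivity

lemma gibbs (a b : ℝ) (ha : 0 < a) (hb : 0 < b) : phi a ≤ -(a * Real.log b) + (b - a) := by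
  rw [phi_eq]
  have h := Real.log_le_sub_one_of_pos (div_pos hb ha)
  rw [Real.log_div hb.ne' ha.ne'] at h
  have := mul_le_mul_of_nonneg_left h ha.le
  have e : a * (b / a - 1) = b - a := by field_simp
  rw [e] at this
  linarith

lemma twoP_entropy_gap (k : ℕ) (hk : 1 ≤ k) (w w' : ℝ) (h0 : 0 < w) (h1 : w ≤ w') (h2 : w' ≤ 1 / 3) :
    (w' - w) * Real.log ((k + 1 : ℕ) : ℝ) ≤ entropy (twoP k w') - entropy (twoP k w) := by
  have hk0 : (1 : ℝ) ≤ k := by exact_mod_cast hk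
  have hk00 : (0 : ℝ) < k := by linarith
  have hw' : 0 < w' := by linarith
  have e : ∀ v : ℝ, entropy (twoP k v) = phi (1 - v) + k * phi (v / k) := by
    intro v
    rw [entropy_eq, Fin.sum_univ_succ]
    simp [twoP]
  rw [e, e]
  have g1 := gibbs (1 - w) (1 - w') (by linarith) (by linarith)
  have g2 := mul_le_mul_of_nonneg_left (gibbs (w / k) (w' / k) (by positivity) (by positivity))
    (by linarith : (0 : ℝ) ≤ k)
  have e2 : (k : ℝ) * (-(w / k * Real.log (w' / k)) + (w' / k - w / k)) = -(w * Real.log (w' / k)) + (w' - w) := by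
    field_simp
  have e3 : (k : ℝ) * phi (w' / k) = -(w' * Real.log (w' / k)) := by
    rw [phi_eq]; field_simp
  rw [e2] at g2
  rw [e3, phi_eq (1 - w')]
  have hlog : Real.log ((k + 1 : ℕ) : ℝ) ≤ Real.log (1 - w') - Real.log (w' / k) := by
    rw [← Real.log_div (by linarith) (by positivity)]
    apply Real.log_le_log (by positivity)
    rw [le_div_iff₀ (by positivity)]
    push_cast
    rw [mul_div_assoc', div_le_iff₀ (by positivity)]
    nlinarith
  have := mul_le_mul_of_nonneg_left hlog (by linarith : 0 ≤ w' - w)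
  linarith

lemma lower_B1 {k n : ℕ} (hk : 2 ≤ k) (hn : 1 ≤ n) : (Real.log k) ^ 2 / (2304 * n) ≤ Rstar k n := by
  obtain ⟨k, rfl⟩ : ∃ k', k = k' + 1 := ⟨k - 1, by omega⟩
  have hk1 : 1 ≤ k := by omega
  have hn0 : (1 : ℝ) ≤ n := by exact_mod_cast hn
  have hkR : (1 : ℝ) ≤ k := by exact_mod_cast hk1
  refine le_Rstar (by omega) _ fun est R hR => ?_
  set δ : ℝ := 1 / (12 * Real.sqrt n) with hδ
  have hs1 : 1 ≤ Real.sqrt n := by rw [Real.one_le_sqrt]; exact hn0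
  have hδ0 : 0 < δ := by positivity
  have hδ1 : δ ≤ 1 / 12 := by
    rw [hδ]; apply one_div_le_one_div_of_le (by norm_num); linarith
  have hδ2 : δ ^ 2 = 1 / (144 * n) := by
    rw [hδ, div_pow, mul_pow, Real.sq_sqrt (by linarith)]; norm_num
  set p := twoP k (1 / 4) with hp
  set q := twoP k (1 / 4 + δ) with hq
  have hpp : ∀ i, 0 < p i := twoP_pos k hk1 _ (by norm_num) (by norm_num)
  have hqp : ∀ i, 0 < q i := twoP_pos k hk1 _ (by linarith) (by linarith)
  have hps : ∑ i, p i = 1 := twoP_sum k hk1 _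
  have hqs : ∑ i, q i = 1 := twoP_sum k hk1 _
  have hgap := twoP_entropy_gap k hk1 (1 / 4) (1 / 4 + δ) (by norm_num) (by linarith) (by linarith)
  rw [← hp, ← hq] at hgap
  have hlogk : 0 ≤ Real.log ((k + 1 : ℕ) : ℝ) := Real.log_natCast_nonneg _
  have e0 : 1 / 4 + δ - 1 / 4 = δ := by ring
  rw [e0] at hgap
  set d := entropy q - entropy p with hd
  have hd0 : 0 ≤ d := le_trans (by positivity) hgap
  set f : (Fin (k + 1) → ℕ) → ℝ := fun N => if (entropy p + entropy q) / 2 ≤ est N then 1 else 0 with hf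
  have hchi := chi_bound p q hpp hps hqs n f (fun N => by simp only [hf]; split_ifs <;> norm_num)
  have hsum : ∑ i, q i ^ 2 / p i = 1 + 1 / (27 * n) := by
    have : ∑ i, q i ^ 2 / p i = 1 + 16 / 3 * δ ^ 2 := by
      rw [Fin.sum_univ_succ]
      simp [hp, hq, twoP]
      have : (k : ℝ) ≠ 0 := by positivity
      field_simp
      ring
    rw [this, hδ2]; field_simp; ring
  have hpow : (∑ i, q i ^ 2 / p i) ^ n ≤ 5 / 4 := by
    rw [hsum]
    have h1 : 1 + 1 / (27 * (n : ℝ)) ≤ Real.exp (1 / (27 * n)) := by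
      linarith [Real.add_one_le_exp (1 / (27 * (n : ℝ)))]
    calc (1 + 1 / (27 * (n : ℝ))) ^ n ≤ (Real.exp (1 / (27 * n))) ^ n := by gcongr
      _ = Real.exp (1 / 27) := by rw [← Real.exp_nat_mul]; congr 1; field_simp
      _ ≤ 5 / 4 := by
        have h := Real.add_one_le_exp (-(1 / 27) : ℝ)
        have h2 : Real.exp (-(1 / 27)) * Real.exp (1 / 27) = 1 := by rw [← Real.exp_add]; norm_num
        nlinarith [Real.exp_pos (1 / 27)]
  have hdiff : Ex q n f - Ex p n f ≤ 1 / 2 := by nlinarith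
  have hRp := hR p ⟨fun i => (hpp i).le, hps⟩
  have hRq := hR q ⟨fun i => (hqp i).le, hqs⟩
  have l1 : d ^ 2 / 4 * Ex p n f ≤ R := by
    rw [← Ex_mul]
    exact (Ex_mono p (fun i => (hpp i).le) n _ _ fun N _ => (lecam_pt (est N) _ _ (by linarith)).1).trans hRp
  have l2 : d ^ 2 / 4 * (1 - Ex q n f) ≤ R := by
    rw [← Ex_const q hqs n 1, ← Ex_sub q n (fun _ => 1), ← Ex_mul]
    exact (Ex_mono q (fun i => (hqp i).le) n _ _ fun N _ => (lecam_pt (est N) _ _ (by linarith)).2).trans hRq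
  have hd2 : δ ^ 2 * (Real.log ((k + 1 : ℕ) : ℝ)) ^ 2 ≤ d ^ 2 := by
    rw [← mul_pow]; exact pow_le_pow_left₀ (by positivity) hgap 2
  rw [hδ2] at hd2
  have hfin : d ^ 2 / 16 ≤ R := by nlinarith [sq_nonneg d]
  refine le_trans (le_trans (le_of_eq ?_) (div_le_div_of_nonneg_right hd2 (by norm_num : (0 : ℝ) ≤ 16))) hfin
  field_simp
  ring

/-- Sum of cosines over the equispaced grid. -/
def cosSum (K : ℕ) (q : ℤ) : ℝ := ∑ m ∈ Finset.range (2 * K), Real.cos (q * (π * m / K))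

lemma cosSum_tele (x : ℝ) (N : ℕ) :
    2 * Real.sin (x / 2) * ∑ m ∈ Finset.range N, Real.cos (m * x) =
      Real.sin (N * x - x / 2) + Real.sin (x / 2) := by
  induction N with
  | zero => simp [Real.sin_neg]
  | succ N ih =>
    rw [Finset.sum_range_succ, mul_add, ih]
    have h1 : ((N + 1 : ℕ) : ℝ) * x - x / 2 = N * x + x / 2 := by push_cast; ring
    rw [h1, Real.sin_add, Real.sin_sub]
    ring

lemma cosSum_zero (K : ℕ) (hK : 1 ≤ K) (q : ℤ) (hq : ¬ ((2 * K : ℤ) ∣ q)) : cosSum K q = 0 := by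
  have hK0 : (K : ℝ) ≠ 0 := by positivity
  have h := cosSum_tele (q * π / K) (2 * K)
  have e1 : ((2 * K : ℕ) : ℝ) * (q * π / K) - q * π / K / 2 = -(q * π / K / 2) + q * (2 * π) := by
    push_cast; field_simp; ring
  rw [e1, Real.sin_add_int_mul_two_pi, Real.sin_neg, neg_add_cancel] at h
  have hs : Real.sin (q * π / K / 2) ≠ 0 := by
    intro h0
    rw [Real.sin_eq_zero_iff] at h0
    obtain ⟨n, hn⟩ := h0
    apply hq
    refine ⟨n, ?_⟩
    have hpi := Real.pi_pos.ne'
    have : (q : ℝ) = 2 * K * n := by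
      field_simp at hn
      linarith
    exact_mod_cast this
  have h2 : ∑ m ∈ Finset.range (2 * K), Real.cos (m * (q * π / K)) = 0 := by
    rcases mul_eq_zero.mp h with h | h
    · exact absurd h (mul_ne_zero two_ne_zero hs)
    · exact h
  rw [cosSum, ← h2]
  refine Finset.sum_congr rfl fun m _ => ?_
  congr 1; ring

lemma cosSum_dvd (K : ℕ) (hK : 1 ≤ K) (q : ℤ) (hq : ((2 * K : ℤ) ∣ q)) : cosSum K q = 2 * K := by
  have hK0 : (K : ℝ) ≠ 0 := by positivity
  obtain ⟨n, rfl⟩ := hq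
  rw [cosSum]
  have : ∀ m ∈ Finset.range (2 * K), Real.cos (((2 * K * n : ℤ) : ℝ) * (π * m / K)) = 1 := by
    intro m _
    have e : ((2 * K * n : ℤ) : ℝ) * (π * m / K) = ((n * m : ℤ) : ℝ) * (2 * π) := by
      push_cast; field_simp
    rw [e, Real.cos_int_mul_two_pi]
  rw [Finset.sum_congr rfl this]
  simp

lemma cosSum_nonneg (K : ℕ) (hK : 1 ≤ K) (q : ℤ) : 0 ≤ cosSum K q := by
  by_cases h : (2 * K : ℤ) ∣ q
  · rw [cosSum_dvd K hK q h]; positivity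
  · rw [cosSum_zero K hK q h]

/-- Weights of the kernel. -/
def sa (D l : ℕ) : ℝ := Real.sin (l * (π / ((D : ℝ) + 1)))

lemma sa_nonneg (D l : ℕ) (hl : l ∈ Finset.range (D + 1)) : 0 ≤ sa D l := by
  rw [Finset.mem_range] at hl
  have h1 : (l : ℝ) ≤ D + 1 := by exact_mod_cast hl.le
  apply Real.sin_nonneg_of_nonneg_of_le_pi
  · positivity
  · rw [mul_div_assoc', div_le_iff₀ (by positivity)]
    nlinarith [Real.pi_pos]

lemma sa_le_one (D l : ℕ) : sa D l ≤ 1 := Real.sin_le_one _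

lemma sin_alpha_pos (D : ℕ) (hD : 1 ≤ D) : 0 < Real.sin (π / ((D : ℝ) + 1)) := by
  have h1 : (1 : ℝ) ≤ D := by exact_mod_cast hD
  apply Real.sin_pos_of_pos_of_lt_pi
  · have := Real.pi_pos; positivity
  · rw [div_lt_iff₀ (by positivity)]
    nlinarith [Real.pi_pos]

lemma sa_sq (D : ℕ) (hD : 1 ≤ D) : ∑ l ∈ Finset.range (D + 1), sa D l ^ 2 = ((D : ℝ) + 1) / 2 := by
  have h := cosSum_tele (2 * (π / ((D : ℝ) + 1))) (D + 1)
  have hD1 : (D : ℝ) + 1 ≠ 0 := by positivity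
  have e1 : ((D + 1 : ℕ) : ℝ) * (2 * (π / ((D : ℝ) + 1))) - 2 * (π / ((D : ℝ) + 1)) / 2 = -(π / ((D : ℝ) + 1)) + 2 * π := by
    push_cast; field_simp; ring
  have e2 : 2 * (π / ((D : ℝ) + 1)) / 2 = π / ((D : ℝ) + 1) := by ring
  rw [e1, e2, Real.sin_add_two_pi, Real.sin_neg, neg_add_cancel] at h
  have h2 : ∑ m ∈ Finset.range (D + 1), Real.cos (m * (2 * (π / ((D : ℝ) + 1)))) = 0 := by
    rcases mul_eq_zero.mp h with h | h
    · exact absurd h (mul_ne_zero two_ne_zero (sin_alpha_pos D hD).ne')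
    · exact h
  have e3 : ∀ l ∈ Finset.range (D + 1), sa D l ^ 2 = 1 / 2 - 1 / 2 * Real.cos (l * (2 * (π / ((D : ℝ) + 1)))) := by
    intro l _
    have : (l : ℝ) * (2 * (π / ((D : ℝ) + 1))) = 2 * (l * (π / ((D : ℝ) + 1))) := by ring
    rw [this, Real.cos_two_mul, Real.cos_sq', sa]; ring
  rw [Finset.sum_congr rfl e3, Finset.sum_sub_distrib, ← Finset.mul_sum, h2]
  simp
  ring

lemma sinSum_tele (x : ℝ) (N : ℕ) :
    2 * Real.sin (x / 2) * ∑ m ∈ Finset.range N, Real.sin (m * x) =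
      Real.cos (x / 2) - Real.cos (N * x - x / 2) := by
  induction N with
  | zero => simp [Real.cos_neg]
  | succ N ih =>
    rw [Finset.sum_range_succ, mul_add, ih]
    have h1 : ((N + 1 : ℕ) : ℝ) * x - x / 2 = N * x + x / 2 := by push_cast; ring
    rw [h1, Real.cos_add, Real.cos_sub]
    ring

lemma sa_shift (D : ℕ) (hD : 1 ≤ D) : ∑ l ∈ Finset.range (D + 1), sa D l * sa D (l + 1) =
    Real.cos (π / ((D : ℝ) + 1)) * (((D : ℝ) + 1) / 2) := by
  have h := sinSum_tele (2 * (π / ((D : ℝ) + 1))) (D + 1)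
  have hD1 : (D : ℝ) + 1 ≠ 0 := by positivity
  have e1 : ((D + 1 : ℕ) : ℝ) * (2 * (π / ((D : ℝ) + 1))) - 2 * (π / ((D : ℝ) + 1)) / 2 = -(π / ((D : ℝ) + 1)) + 2 * π := by
    push_cast; field_simp; ring
  have e2 : 2 * (π / ((D : ℝ) + 1)) / 2 = π / ((D : ℝ) + 1) := by ring
  rw [e1, e2, Real.cos_add_two_pi, Real.cos_neg, sub_self] at h
  have h2 : ∑ m ∈ Finset.range (D + 1), Real.sin (m * (2 * (π / ((D : ℝ) + 1)))) = 0 := by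
    rcases mul_eq_zero.mp h with h | h
    · exact absurd h (mul_ne_zero two_ne_zero (sin_alpha_pos D hD).ne')
    · exact h
  have e3 : ∀ l ∈ Finset.range (D + 1), sa D l * sa D (l + 1) = Real.cos (π / ((D : ℝ) + 1)) * sa D l ^ 2 +
      Real.sin (π / ((D : ℝ) + 1)) / 2 * Real.sin (l * (2 * (π / ((D : ℝ) + 1)))) := by
    intro l _
    have : (l : ℝ) * (2 * (π / ((D : ℝ) + 1))) = 2 * (l * (π / ((D : ℝ) + 1))) := by ring
    rw [this, Real.sin_two_mul, sa, sa]
    have : ((l + 1 : ℕ) : ℝ) * (π / ((D : ℝ) + 1)) = l * (π / ((D : ℝ) + 1)) + π / ((D : ℝ) + 1) := by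
      push_cast; ring
    rw [this, Real.sin_add]; ring
  rw [Finset.sum_congr rfl e3, Finset.sum_add_distrib, ← Finset.mul_sum, ← Finset.mul_sum, h2, sa_sq D hD]
  ring

/-- Nonnegative kernel. -/
def fejer (D : ℕ) (t : ℝ) : ℝ :=
  (2 / ((D : ℝ) + 1)) * ((∑ l ∈ Finset.range (D + 1), sa D l * Real.cos (l * t)) ^ 2 +
    (∑ l ∈ Finset.range (D + 1), sa D l * Real.sin (l * t)) ^ 2)

lemma fejer_nonneg (D : ℕ) (t : ℝ) : 0 ≤ fejer D t := by
  unfold fejer; positivity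

lemma fejer_mul_cos (D : ℕ) (t x : ℝ) : fejer D t * Real.cos x =
    (2 / ((D : ℝ) + 1)) * ∑ l ∈ Finset.range (D + 1), ∑ l' ∈ Finset.range (D + 1),
      sa D l * sa D l' * Real.cos (((l : ℝ) - l') * t + x) := by
  have h : ∀ l l' : ℕ, sa D l * sa D l' * Real.cos (((l : ℝ) - l') * t + x) =
      ((sa D l * Real.cos (l * t)) * (sa D l' * Real.cos (l' * t)) + (sa D l * Real.sin (l * t)) * (sa D l' * Real.sin (l' * t))) * Real.cos x -
      ((sa D l * Real.sin (l * t)) * (sa D l' * Real.cos (l' * t)) - (sa D l * Real.cos (l * t)) * (sa D l' * Real.sin (l' * t))) * Real.sin x := by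
    intro l l'
    rw [Real.cos_add, sub_mul, Real.cos_sub, Real.sin_sub]; ring
  simp only [h, Finset.sum_sub_distrib, ← Finset.sum_mul, Finset.sum_add_distrib, ← Finset.mul_sum]
  unfold fejer
  ring

/-- Fourier coefficient of the signed measure. -/
lemma nuhat (K D : ℕ) (hK : 1 ≤ K) (j : ℤ) :
    ∑ m ∈ Finset.range (2 * K), fejer D (π * m / K) * Real.cos (K * (π * m / K)) / K *
      Real.cos (j * (π * m / K)) =
    1 / (K * (D + 1)) * ∑ l ∈ Finset.range (D + 1), ∑ l' ∈ Finset.range (D + 1),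
      sa D l * sa D l' * (cosSum K (l - l' + (K + j)) + cosSum K (l - l' + (K - j))) := by
  have h : ∀ m ∈ Finset.range (2 * K), fejer D (π * m / K) * Real.cos (K * (π * m / K)) / K *
      Real.cos (j * (π * m / K)) = 1 / (K * (D + 1)) * ∑ l ∈ Finset.range (D + 1), ∑ l' ∈ Finset.range (D + 1),
      sa D l * sa D l' * (Real.cos (((l - l' + (K + j) : ℤ) : ℝ) * (π * m / K)) +
        Real.cos (((l - l' + (K - j) : ℤ) : ℝ) * (π * m / K))) := by
    intro m _
    have h1 := fejer_mul_cos D (π * m / K) (((K : ℝ) + j) * (π * m / K))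
    have h2 := fejer_mul_cos D (π * m / K) (((K : ℝ) - j) * (π * m / K))
    simp only [← add_mul] at h1 h2
    simp only [mul_add (sa D _ * sa D _), Finset.sum_add_distrib]
    push_cast
    have h3 : Real.cos (K * (π * m / K)) * Real.cos (j * (π * m / K)) =
        (Real.cos (((K : ℝ) + j) * (π * m / K)) + Real.cos (((K : ℝ) - j) * (π * m / K))) / 2 := by
      rw [add_mul, sub_mul, Real.cos_add, Real.cos_sub]; ring
    have h4 : fejer D (π * m / K) * Real.cos (K * (π * m / K)) / K * Real.cos (j * (π * m / K)) =
      (fejer D (π * m / K) * Real.cos (((K : ℝ) + j) * (π * m / K)) +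
       fejer D (π * m / K) * Real.cos (((K : ℝ) - j) * (π * m / K))) / (2 * K) := by
      rw [div_mul_eq_mul_div, mul_assoc, h3]
      have : (K : ℝ) ≠ 0 := by positivity
      field_simp
    rw [h4, h1, h2]
    generalize (∑ x ∈ Finset.range (D + 1), ∑ y ∈ Finset.range (D + 1),
      sa D x * sa D y * Real.cos (((x : ℝ) - y + (K + j)) * (π * m / K))) = A1
    generalize (∑ x ∈ Finset.range (D + 1), ∑ y ∈ Finset.range (D + 1),
      sa D x * sa D y * Real.cos (((x : ℝ) - y + (K - j)) * (π * m / K))) = A2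
    have : (K : ℝ) ≠ 0 := by positivity
    have : (D : ℝ) + 1 ≠ 0 := by positivity
    field_simp
  rw [Finset.sum_congr rfl h, ← Finset.mul_sum, Finset.sum_comm]
  congr 1
  refine Finset.sum_congr rfl fun l _ => ?_
  rw [Finset.sum_comm]
  refine Finset.sum_congr rfl fun l' _ => ?_
  rw [← Finset.mul_sum, Finset.sum_add_distrib, cosSum, cosSum]

lemma fejer_cosSum (K D : ℕ) (hK : 1 ≤ K) (x : ℤ) :
    ∑ m ∈ Finset.range (2 * K), fejer D (π * m / K) * Real.cos (x * (π * m / K)) = 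
     2 / ((D : ℝ) + 1) * ∑ l ∈ Finset.range (D + 1), ∑ l' ∈ Finset.range (D + 1),
      sa D l * sa D l' * cosSum K (l - l' + x) := by
  have h : ∀ m ∈ Finset.range (2 * K), fejer D (π * m / K) * Real.cos (x * (π * m / K)) = 
     2 / ((D : ℝ) + 1) * ∑ l ∈ Finset.range (D + 1), ∑ l' ∈ Finset.range (D + 1),
      sa D l * sa D l' * Real.cos (((l - l' + x : ℤ) : ℝ) * (π * m / K)) := by
    intro m _
    rw [fejer_mul_cos D]
    simp only [← add_mul]
    push_cast
    rfl
  rw [Finset.sum_congr rfl h, ← Finset.mul_sum, Finset.sum_comm]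
  congr 1
  refine Finset.sum_congr rfl fun l _ => ?_
  rw [Finset.sum_comm]
  refine Finset.sum_congr rfl fun l' _ => ?_
  rw [← Finset.mul_sum, cosSum]

lemma fejer_sum (K D : ℕ) (hK : 1 ≤ K) (hD : D < K) (hD1 : 1 ≤ D) :
    ∑ m ∈ Finset.range (2 * K), fejer D (π * m / K) = 2 * K := by
  have h := fejer_cosSum K D hK 0
  simp only [Int.cast_zero, zero_mul, Real.cos_zero, mul_one, add_zero] at h
  rw [h]
  have h2 : ∀ l ∈ Finset.range (D + 1), ∑ l' ∈ Finset.range (D + 1),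
      sa D l * sa D l' * cosSum K (l - l') = 2 * K * sa D l ^ 2 := by
    intro l hl
    rw [Finset.sum_eq_single l]
    · rw [sub_self, cosSum_dvd K hK 0 (dvd_zero _)]; ring
    · intro l' hl' hne
      rw [cosSum_zero K hK, mul_zero]
      rw [Finset.mem_range] at hl hl'
      intro hd
      have := Int.eq_zero_of_abs_lt_dvd hd (by rw [abs_lt]; constructor <;> omega)
      omega
    · intro h; exact absurd hl h
  rw [Finset.sum_congr rfl h2, ← Finset.mul_sum, sa_sq D hD1]
  have : (D : ℝ) + 1 ≠ 0 := by positivity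
  field_simp

lemma fejer_cos_one (K D : ℕ) (hK : 1 ≤ K) (hD : D + 1 < K) (hD1 : 1 ≤ D) :
    ∑ m ∈ Finset.range (2 * K), fejer D (π * m / K) * Real.cos (π * m / K) =
      2 * K * Real.cos (π / ((D : ℝ) + 1)) := by
  have h := fejer_cosSum K D hK 1
  simp only [Int.cast_one, one_mul] at h
  rw [h]
  have hDz : sa D (D + 1) = 0 := by
    have : ((D + 1 : ℕ) : ℝ) * (π / ((D : ℝ) + 1)) = π := by
      have : (D : ℝ) + 1 ≠ 0 := by positivity
      push_cast; field_simp
    rw [sa, this, Real.sin_pi]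
  have h2 : ∀ l ∈ Finset.range (D + 1), ∑ l' ∈ Finset.range (D + 1),
      sa D l * sa D l' * cosSum K (l - l' + 1) = 2 * K * (sa D l * sa D (l + 1)) := by
    intro l hl
    rw [Finset.sum_eq_single (l + 1)]
    · have e : (l : ℤ) - ((l + 1 : ℕ) : ℤ) + 1 = 0 := by push_cast; ring
      rw [e, cosSum_dvd K hK 0 (dvd_zero _)]; ring
    · intro l' hl' hne
      rw [cosSum_zero K hK, mul_zero]
      rw [Finset.mem_range] at hl hl'
      intro hd
      have := Int.eq_zero_of_abs_lt_dvd hd (by rw [abs_lt]; constructor <;> omega)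
      omega
    · intro h
      rw [Finset.mem_range] at hl h
      have : l = D := by omega
      rw [this, hDz]; ring
  rw [Finset.sum_congr rfl h2, ← Finset.mul_sum, sa_shift D hD1]
  have : (D : ℝ) + 1 ≠ 0 := by positivity
  field_simp

lemma nuhat_zero (L : ℕ) (j : ℤ) (hj : |j| ≤ L) :
    ∑ m ∈ Finset.range (2 * (2 * L + 1)), fejer L (π * m / (2 * L + 1 : ℕ)) *
      Real.cos ((2 * L + 1 : ℕ) * (π * m / (2 * L + 1 : ℕ))) / (2 * L + 1 : ℕ) *
      Real.cos (j * (π * m / (2 * L + 1 : ℕ))) = 0 := by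
  rw [nuhat (2 * L + 1) L (by omega) j]
  apply mul_eq_zero_of_right
  refine Finset.sum_eq_zero fun l hl => Finset.sum_eq_zero fun l' hl' => ?_
  rw [Finset.mem_range] at hl hl'
  rw [abs_le] at hj
  rw [cosSum_zero _ (by omega), cosSum_zero _ (by omega), add_zero, mul_zero]
  · intro hd
    have := Int.le_of_dvd (by push_cast; omega) hd
    push_cast at this
    omega
  · intro hd
    have := Int.le_of_dvd (by push_cast; omega) hd
    push_cast at this
    omega

lemma nuhat_nonneg (K D : ℕ) (hK : 1 ≤ K) (j : ℤ) :
    0 ≤ ∑ m ∈ Finset.range (2 * K), fejer D (π * m / K) * Real.cos (K * (π * m / K)) / K *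
      Real.cos (j * (π * m / K)) := by
  rw [nuhat K D hK j]
  refine mul_nonneg (by positivity) (Finset.sum_nonneg fun l hl => Finset.sum_nonneg fun l' hl' => 
    mul_nonneg (mul_nonneg (sa_nonneg D l hl) (sa_nonneg D l' hl'))
      (add_nonneg (cosSum_nonneg K hK _) (cosSum_nonneg K hK _)))

lemma nuhat_sum (K D : ℕ) (hK : 1 ≤ K) (hD1 : 1 ≤ D) :
    ((D : ℝ) + 1) / 4 ≤ ∑ i ∈ Finset.range (D + 1), 
      ∑ m ∈ Finset.range (2 * K), fejer D (π * m / K) * Real.cos (K * (π * m / K)) / K *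
      Real.cos (((K + i : ℕ) : ℤ) * (π * m / K)) := by
  have hK0 : (0 : ℝ) < K := by positivity
  simp only [nuhat K D hK]
  rw [← Finset.mul_sum]
  set A : ℝ := ∑ l ∈ Finset.range (D + 1), ∑ l' ∈ Finset.range (D + 1),
    sa D l * sa D l' * (if l' ≤ l then (1 : ℝ) else 0) with hA
  have hA0 : (((D : ℝ) + 1) / 2) ^ 2 ≤ (∑ l ∈ Finset.range (D + 1), sa D l) ^ 2 := by
    apply pow_le_pow_left₀ (by positivity)
    rw [← sa_sq D hD1]
    refine Finset.sum_le_sum fun l hl => ?_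
    nlinarith [sa_nonneg D l hl, sa_le_one D l]
  have hA1 : (((D : ℝ) + 1) / 2) ^ 2 ≤ 2 * A := by
    refine hA0.trans ?_
    have e : A = ∑ l ∈ Finset.range (D + 1), ∑ l' ∈ Finset.range (D + 1),
        sa D l * sa D l' * (if l ≤ l' then (1 : ℝ) else 0) := by
      rw [hA, Finset.sum_comm]
      refine Finset.sum_congr rfl fun l _ => Finset.sum_congr rfl fun l' _ => by ring
    rw [two_mul]
    nth_rewrite 2 [e]
    rw [hA, sq, Finset.sum_mul_sum, ← Finset.sum_add_distrib]
    refine Finset.sum_le_sum fun l hl => ?_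
    rw [← Finset.sum_add_distrib]
    refine Finset.sum_le_sum fun l' hl' => ?_
    have := mul_nonneg (sa_nonneg D l hl) (sa_nonneg D l' hl')
    split_ifs <;> first | omega | linarith
  have hB : 2 * K * A ≤ ∑ i ∈ Finset.range (D + 1), ∑ l ∈ Finset.range (D + 1), ∑ l' ∈ Finset.range (D + 1),
      sa D l * sa D l' * (cosSum K (l - l' + (K + ((K + i : ℕ) : ℤ))) + cosSum K (l - l' + (K - ((K + i : ℕ) : ℤ)))) := by
    rw [Finset.sum_comm, hA, Finset.mul_sum]
    refine Finset.sum_le_sum fun l hl => ?_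
    rw [Finset.sum_comm, Finset.mul_sum]
    refine Finset.sum_le_sum fun l' hl' => ?_
    have hss := mul_nonneg (sa_nonneg D l hl) (sa_nonneg D l' hl')
    rw [← Finset.mul_sum, mul_left_comm]
    refine mul_le_mul_of_nonneg_left ?_ hss
    split_ifs with h
    · have hmem : l - l' ∈ Finset.range (D + 1) := by
        rw [Finset.mem_range] at hl ⊢; omega
      refine le_trans ?_ (Finset.single_le_sum (f := fun i : ℕ => (cosSum K (l - l' + (K + ((K + i : ℕ) : ℤ))) + cosSum K (l - l' + (K - ((K + i : ℕ) : ℤ))))) (fun i _ => add_nonneg (cosSum_nonneg K hK _) (cosSum_nonneg K hK _)) hmem)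
      have e : (l : ℤ) - l' + (K - ((K + (l - l') : ℕ) : ℤ)) = 0 := by omega
      simp only [e]
      rw [cosSum_dvd K hK 0 (dvd_zero _)]
      linarith [cosSum_nonneg K hK (l - l' + (K + ((K + (l - l') : ℕ) : ℤ)))]
    · rw [mul_zero]
      exact Finset.sum_nonneg fun i _ => add_nonneg (cosSum_nonneg K hK _) (cosSum_nonneg K hK _)
  have := mul_le_mul_of_nonneg_left hB (by positivity : (0 : ℝ) ≤ 1 / (K * (D + 1)))
  refine le_trans ?_ this
  have e : 1 / ((K : ℝ) * (D + 1)) * (2 * K * A) = 2 * A / (D + 1) := by field_simp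
  rw [e, div_le_div_iff₀ (by norm_num) (by positivity)]
  nlinarith

lemma moments_zero {S : Finset ℕ} (nu th : ℕ → ℝ) (L : ℕ)
    (h : ∀ j : ℤ, |j| ≤ L → ∑ m ∈ S, nu m * Real.cos (j * th m) = 0) (s : ℕ) :
    ∀ j : ℤ, |j| + s ≤ L → ∑ m ∈ S, nu m * (((1 - Real.cos (th m)) / 2) ^ s * Real.cos (j * th m)) = 0 := by
  induction s with
  | zero => intro j hj; simpa using h j (by simpa using hj)
  | succ s ih =>
    intro j hj
    push_cast at hj
    have a1 : |j + 1| ≤ |j| + 1 := (abs_add_le j 1).trans (by simp)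
    have a2 : |j - 1| ≤ |j| + 1 := (abs_sub j 1).trans (by simp)
    have i0 := ih j (by omega)
    have i1 := ih (j + 1) (by omega)
    have i2 := ih (j - 1) (by omega)
    have e : ∀ m ∈ S, nu m * (((1 - Real.cos (th m)) / 2) ^ (s + 1) * Real.cos (j * th m)) =
        1 / 2 * (nu m * (((1 - Real.cos (th m)) / 2) ^ s * Real.cos (j * th m))) -
        1 / 4 * (nu m * (((1 - Real.cos (th m)) / 2) ^ s * Real.cos ((j + 1 : ℤ) * th m))) -
        1 / 4 * (nu m * (((1 - Real.cos (th m)) / 2) ^ s * Real.cos ((j - 1 : ℤ) * th m))) := by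
      intro m _
      push_cast
      rw [add_mul, sub_mul, one_mul, Real.cos_add, Real.cos_sub]
      ring
    rw [Finset.sum_congr rfl e, Finset.sum_sub_distrib, Finset.sum_sub_distrib, ← Finset.mul_sum,
      ← Finset.mul_sum, ← Finset.mul_sum, i0, i1, i2]
    ring


lemma dual_exists (L : ℕ) (hL : 1 ≤ L) : ∃ (S : ℕ) (v w0 w1 : ℕ → ℝ),
    (∀ m, 0 ≤ v m ∧ v m ≤ 1) ∧ (∀ m, 0 ≤ w0 m) ∧ (∀ m, 0 ≤ w1 m) ∧
    (∑ m ∈ Finset.range S, w0 m = 1) ∧ (∑ m ∈ Finset.range S, w1 m = 1) ∧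
    (∀ s, s ≤ L → ∑ m ∈ Finset.range S, w0 m * v m ^ s = ∑ m ∈ Finset.range S, w1 m * v m ^ s) ∧
    (∑ m ∈ Finset.range S, w0 m * v m ≤ 3 / (L : ℝ) ^ 2) ∧
    1 / (500 * (L : ℝ) ^ 2) ≤ ∑ m ∈ Finset.range S, w1 m * phi (v m) - ∑ m ∈ Finset.range S, w0 m * phi (v m) := by
  set K : ℕ := 2 * L + 1 with hKdef
  have hK : 1 ≤ K := by omega
  have hK0 : (0 : ℝ) < K := by positivity
  set th : ℕ → ℝ := fun m => π * m / K with hth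
  set nu : ℕ → ℝ := fun m => fejer L (th m) * Real.cos (K * th m) / K with hnu
  set v : ℕ → ℝ := fun m => (1 - Real.cos (th m)) / 2 with hv
  have hnz : ∀ j : ℤ, |j| ≤ L → ∑ m ∈ Finset.range (2 * K), nu m * Real.cos (j * th m) = 0 :=
    fun j hj => nuhat_zero L j hj
  have hnn : ∀ j : ℤ, 0 ≤ ∑ m ∈ Finset.range (2 * K), nu m * Real.cos (j * th m) :=
    fun j => nuhat_nonneg K L hK j
  have hns : ((L : ℝ) + 1) / 4 ≤ ∑ i ∈ Finset.range (L + 1), ∑ m ∈ Finset.range (2 * K),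
    nu m * Real.cos (((K + i : ℕ) : ℤ) * th m) := nuhat_sum K L hK hL
  have hmom : ∀ s, s ≤ L → ∑ m ∈ Finset.range (2 * K), nu m * v m ^ s = 0 := by
    intro s hs
    have := moments_zero nu th L hnz s 0 (by simpa using hs)
    simpa using this
  have hnu0 : ∑ m ∈ Finset.range (2 * K), nu m = 0 := by simpa using hmom 0 (by omega)
  have hnu1 : ∑ m ∈ Finset.range (2 * K), nu m * v m = 0 := by simpa using hmom 1 (by omega)
  have hnuc : ∑ m ∈ Finset.range (2 * K), nu m * Real.cos (th m) = 0 := by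
    simpa using hnz 1 (by simpa using hL)
  have hF : ∑ m ∈ Finset.range (2 * K), fejer L (th m) / (2 * K) = 1 := by
    rw [← Finset.sum_div, fejer_sum K L hK (by omega) hL]
    field_simp
  have w0e : ∀ m, fejer L (th m) * (1 + Real.cos (K * th m)) / (2 * K) = fejer L (th m) / (2 * K) + nu m / 2 := by
    intro m; simp only [hnu]; field_simp
  have w1e : ∀ m, fejer L (th m) * (1 - Real.cos (K * th m)) / (2 * K) = fejer L (th m) / (2 * K) - nu m / 2 := by
    intro m; simp only [hnu]; field_simp
  refine ⟨2 * K, v, fun m => fejer L (th m) * (1 + Real.cos (K * th m)) / (2 * K),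
    fun m => fejer L (th m) * (1 - Real.cos (K * th m)) / (2 * K), ?_, ?_, ?_, ?_, ?_, ?_, ?_, ?_⟩
  · intro m
    simp only [hv]
    have := Real.cos_le_one (th m)
    have := Real.neg_one_le_cos (th m)
    constructor <;> linarith
  · intro m
    have := Real.neg_one_le_cos (K * th m)
    exact div_nonneg (mul_nonneg (fejer_nonneg _ _) (by linarith)) (by positivity)
  · intro m
    have := Real.cos_le_one (K * th m)
    exact div_nonneg (mul_nonneg (fejer_nonneg _ _) (by linarith)) (by positivity)
  · simp only [w0e, Finset.sum_add_distrib, ← Finset.sum_div] at hF ⊢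
    rw [hF, hnu0]; norm_num
  · simp only [w1e, Finset.sum_sub_distrib, ← Finset.sum_div] at hF ⊢
    rw [hF, hnu0]; norm_num
  · intro s hs
    have h := hmom s hs
    rw [← sub_eq_zero, ← Finset.sum_sub_distrib, ← h]
    refine Finset.sum_congr rfl fun m _ => ?_
    simp only [w0e, w1e]; ring
  · have hF1 := fejer_cos_one K L hK (by omega) hL
    have e1 : ∀ m ∈ Finset.range (2 * K), fejer L (th m) * (1 + Real.cos (K * th m)) / (2 * K) * v m =
        1 / 2 * (fejer L (th m) / (2 * K)) - 1 / (4 * K) * (fejer L (π * m / K) * Real.cos (π * m / K)) + 1 / 2 * (nu m * v m) := by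
      intro m _
      rw [w0e]
      have : th m = π * m / K := rfl
      simp only [hv, ← this]
      field_simp
      ring
    rw [Finset.sum_congr rfl e1, Finset.sum_add_distrib, Finset.sum_sub_distrib, ← Finset.mul_sum,
      ← Finset.mul_sum, ← Finset.mul_sum, hF, hF1, hnu1]
    have hL0 : (1 : ℝ) ≤ L := by exact_mod_cast hL
    have hc := Real.one_sub_sq_div_two_le_cos (x := π / ((L : ℝ) + 1))
    have e2 : 1 / (4 * (K : ℝ)) * (2 * K * Real.cos (π / ((L : ℝ) + 1))) = 1 / 2 * Real.cos (π / ((L : ℝ) + 1)) := by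
      field_simp; ring
    rw [e2]
    have hb : (π / ((L : ℝ) + 1)) ^ 2 ≤ 12 / (L : ℝ) ^ 2 := by
      rw [div_pow]
      have : π ^ 2 ≤ 12 := by nlinarith [Real.pi_lt_d2, Real.pi_pos]
      gcongr
      linarith
    have e3 : 3 / (L : ℝ) ^ 2 = (12 / (L : ℝ) ^ 2) / 4 := by ring
    rw [e3]
    linarith
  · have e : ∑ m ∈ Finset.range (2 * K), fejer L (th m) * (1 - Real.cos (K * th m)) / (2 * K) * phi (v m) -
        ∑ m ∈ Finset.range (2 * K), fejer L (th m) * (1 + Real.cos (K * th m)) / (2 * K) * phi (v m) =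
        ∑ m ∈ Finset.range (2 * K), nu m * ((1 - Real.cos (th m)) / 2 * Real.log (4 * ((1 - Real.cos (th m)) / 2)) - 1 / 2 + 3 / 4 * Real.cos (th m)) := by
      have h1 : ∀ m ∈ Finset.range (2 * K), nu m * ((1 - Real.cos (th m)) / 2 * Real.log (4 * ((1 - Real.cos (th m)) / 2)) - 1 / 2 + 3 / 4 * Real.cos (th m)) =
          nu m * (v m * Real.log (v m)) + Real.log 4 * (nu m * v m) - 1 / 2 * nu m + 3 / 4 * (nu m * Real.cos (th m)) := by
        intro m _
        have : (1 - Real.cos (th m)) / 2 = v m := rfl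
        rw [this]
        by_cases h0 : v m = 0
        · rw [h0]; ring
        · rw [Real.log_mul (by norm_num) h0]; ring
      rw [Finset.sum_congr rfl h1, Finset.sum_add_distrib, Finset.sum_sub_distrib, Finset.sum_add_distrib,
        ← Finset.mul_sum, ← Finset.mul_sum, ← Finset.mul_sum, hnu0, hnu1, hnuc, ← Finset.sum_sub_distrib]
      simp only [mul_zero, add_zero, sub_zero]
      refine Finset.sum_congr rfl fun m _ => ?_
      rw [w0e, w1e, phi_eq]; ring
    rw [e]
    have hs : HasSum (fun j : ℕ => ∑ m ∈ Finset.range (2 * K), nu m * (Real.cos ((j + 2 : ℕ) * th m) / (((j : ℝ) + 3) * (j + 2) * (j + 1))))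
       (∑ m ∈ Finset.range (2 * K), nu m * ((1 - Real.cos (th m)) / 2 * Real.log (4 * ((1 - Real.cos (th m)) / 2)) - 1 / 2 + 3 / 4 * Real.cos (th m))) :=
      hasSum_sum fun m _ => (cheb_series (th m)).mul_left (nu m)
    have hfe : ∀ j : ℕ, ∑ m ∈ Finset.range (2 * K), nu m * (Real.cos ((j + 2 : ℕ) * th m) / (((j : ℝ) + 3) * (j + 2) * (j + 1))) =
        (∑ m ∈ Finset.range (2 * K), nu m * Real.cos (((j + 2 : ℕ) : ℤ) * th m)) / (((j : ℝ) + 3) * (j + 2) * (j + 1)) := by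
      intro j
      rw [Finset.sum_div]
      refine Finset.sum_congr rfl fun m _ => ?_
      push_cast
      ring
    have hle := sum_le_hasSum ((Finset.range (L + 1)).map ⟨fun i => K - 2 + i, fun a b h => by simpa using h⟩)
      (fun j _ => by rw [hfe]; exact div_nonneg (hnn _) (by positivity)) hs
    refine le_trans ?_ hle
    rw [Finset.sum_map]
    have hL0 : (1 : ℝ) ≤ L := by exact_mod_cast hL
    have hterm : ∀ i ∈ Finset.range (L + 1), (∑ m ∈ Finset.range (2 * K), nu m * Real.cos (((K + i : ℕ) : ℤ) * th m)) / (125 * L ^ 3) ≤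
        ∑ m ∈ Finset.range (2 * K), nu m * (Real.cos ((K - 2 + i + 2 : ℕ) * th m) / ((((K - 2 + i : ℕ) : ℝ) + 3) * (((K - 2 + i : ℕ) : ℝ) + 2) * (((K - 2 + i : ℕ) : ℝ) + 1))) := by
      intro i hi
      rw [hfe]
      have e3 : K - 2 + i + 2 = K + i := by omega
      rw [e3]
      have hb : ((K - 2 + i : ℕ) : ℝ) + 3 ≤ 5 * L := by
        rw [Finset.mem_range] at hi
        have : K - 2 + i + 3 ≤ 5 * L := by omega
        exact_mod_cast this
      set t : ℝ := ((K - 2 + i : ℕ) : ℝ)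
      have ht : 0 ≤ t := Nat.cast_nonneg _
      refine div_le_div_of_nonneg_left (hnn _) (by positivity) ?_
      calc (t + 3) * (t + 2) * (t + 1) ≤ (5 * L) * (5 * L) * (5 * L) := by gcongr <;> linarith
        _ = 125 * L ^ 3 := by ring
    refine le_trans ?_ (Finset.sum_le_sum hterm)
    rw [← Finset.sum_div, le_div_iff₀ (by positivity)]
    refine le_trans ?_ hns
    have : 1 / (500 * (L : ℝ) ^ 2) * (125 * L ^ 3) = L / 4 := by field_simp; norm_num
    rw [this]; linarith

/-- Expectation under the product prior. -/
def Qm (S : ℕ) (v w : ℕ → ℝ) : (κ : ℕ) → ((Fin κ → ℝ) → ℝ) → ℝ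
  | 0, F => F Fin.elim0
  | κ + 1, F => ∑ s ∈ Finset.range S, w s * Qm S v w κ (fun x => F (Fin.cons (v s) x))

section QmLemmas
variable (S : ℕ) (v w : ℕ → ℝ)

lemma Qm_add (κ : ℕ) (F G : (Fin κ → ℝ) → ℝ) :
    Qm S v w κ (fun x => F x + G x) = Qm S v w κ F + Qm S v w κ G := by
  induction κ with
  | zero => simp [Qm]
  | succ κ ih =>
    simp only [Qm]
    rw [← Finset.sum_add_distrib]
    refine Finset.sum_congr rfl fun i _ => ?_
    rw [ih (fun x => F (Fin.cons (v i) x)) (fun x => G (Fin.cons (v i) x))]; ring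

lemma Qm_mul (κ : ℕ) (c : ℝ) (F : (Fin κ → ℝ) → ℝ) :
    Qm S v w κ (fun x => c * F x) = c * Qm S v w κ F := by
  induction κ with
  | zero => simp [Qm]
  | succ κ ih =>
    simp only [Qm]
    rw [Finset.mul_sum]
    refine Finset.sum_congr rfl fun i _ => ?_
    rw [ih (fun x => F (Fin.cons (v i) x))]; ring

lemma Qm_sub (κ : ℕ) (F G : (Fin κ → ℝ) → ℝ) :
    Qm S v w κ (fun x => F x - G x) = Qm S v w κ F - Qm S v w κ G := by
  have h := Qm_add S v w κ F (fun M => (-1) * G M)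
  rw [Qm_mul] at h
  have : (fun M => F M - G M) = (fun M => F M + (-1) * G M) := by funext M; ring
  rw [this, h]; ring

lemma Qm_const (hw : ∑ s ∈ Finset.range S, w s = 1) (κ : ℕ) (c : ℝ) :
    Qm S v w κ (fun _ => c) = c := by
  induction κ with
  | zero => simp [Qm]
  | succ κ ih => simp only [Qm, ih]; rw [← Finset.sum_mul, hw, one_mul]

lemma Qm_sum (κ T : ℕ) (F : ℕ → (Fin κ → ℝ) → ℝ) :
    Qm S v w κ (fun x => ∑ a ∈ Finset.range T, F a x) = ∑ a ∈ Finset.range T, Qm S v w κ (F a) := by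
  induction T with
  | zero =>
    simp only [Finset.range_zero, Finset.sum_empty]
    have := Qm_mul S v w κ 0 (fun _ => 0)
    simpa using this
  | succ T ih =>
    simp only [Finset.sum_range_succ]
    rw [Qm_add S v w κ (fun x => ∑ a ∈ Finset.range T, F a x) (F T), ih]

lemma Qm_mono (hv : ∀ m, 0 ≤ v m ∧ v m ≤ 1) (hw : ∀ m, 0 ≤ w m) (κ : ℕ) (F G : (Fin κ → ℝ) → ℝ)
    (h : ∀ x : Fin κ → ℝ, (∀ i, 0 ≤ x i ∧ x i ≤ 1) → F x ≤ G x) :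
    Qm S v w κ F ≤ Qm S v w κ G := by
  induction κ with
  | zero => simp only [Qm]; exact h _ (fun i => i.elim0)
  | succ κ ih =>
    simp only [Qm]
    refine Finset.sum_le_sum fun s _ => mul_le_mul_of_nonneg_left (ih _ _ fun x hx => h _ ?_) (hw s)
    intro i
    refine Fin.cases ?_ (fun j => ?_) i
    · simpa using hv s
    · simpa using hx j

lemma Qm_var (hw1 : ∑ s ∈ Finset.range S, w s = 1) (g : ℝ → ℝ) (γ B : ℝ)
    (hg : ∑ s ∈ Finset.range S, w s * g (v s) = γ)
    (hB : ∑ s ∈ Finset.range S, w s * (g (v s) - γ) ^ 2 ≤ B) (κ : ℕ) :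
    Qm S v w κ (fun x => (∑ i, g (x i) - κ * γ) ^ 2) ≤ κ * B := by
  induction κ with
  | zero => simp [Qm]
  | succ κ ih =>
    simp only [Qm, Fin.sum_univ_succ, Fin.cons_zero, Fin.cons_succ]
    have e : ∀ s ∈ Finset.range S, w s * Qm S v w κ (fun x => (g (v s) + ∑ i, g (x i) - ((κ + 1 : ℕ) : ℝ) * γ) ^ 2) =
        w s * (g (v s) - γ) ^ 2 + 2 * Qm S v w κ (fun x => ∑ i, g (x i) - κ * γ) * (w s * g (v s) - γ * w s) +
        Qm S v w κ (fun x => (∑ i, g (x i) - κ * γ) ^ 2) * w s := by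
      intro s _
      have : (fun x : Fin κ → ℝ => (g (v s) + ∑ i, g (x i) - ((κ + 1 : ℕ) : ℝ) * γ) ^ 2) =
        fun x => ((fun _ => (g (v s) - γ) ^ 2) x + (2 * (g (v s) - γ)) * (∑ i, g (x i) - κ * γ)) + (∑ i, g (x i) - κ * γ) ^ 2 := by
        funext x; push_cast; ring
      rw [this, Qm_add S v w κ (fun x => ((fun _ => (g (v s) - γ) ^ 2) x + (2 * (g (v s) - γ)) * (∑ i, g (x i) - κ * γ))), Qm_add S v w κ (fun _ => (g (v s) - γ) ^ 2), Qm_mul,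
        Qm_const S v w hw1]
      ring
    rw [Finset.sum_congr rfl e, Finset.sum_add_distrib, Finset.sum_add_distrib, ← Finset.mul_sum,
      ← Finset.mul_sum, Finset.sum_sub_distrib, ← Finset.mul_sum, hg, hw1]
    push_cast
    linarith

end QmLemmas

lemma hybrid (S : ℕ) (v w0 w1 : ℕ → ℝ) (hv : ∀ m, 0 ≤ v m ∧ v m ≤ 1) (hw0 : ∀ m, 0 ≤ w0 m)
    (hw1 : ∀ m, 0 ≤ w1 m) (h0 : ∑ s ∈ Finset.range S, w0 s = 1) (h1 : ∑ s ∈ Finset.range S, w1 s = 1)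
    (ε : ℝ) (κ : ℕ) (F : (Fin κ → ℝ) → ℝ)
    (hF : ∀ (i : Fin κ) (x : Fin κ → ℝ), (∀ j, 0 ≤ x j ∧ x j ≤ 1) →
      |∑ s ∈ Finset.range S, (w1 s - w0 s) * F (Function.update x i (v s))| ≤ ε) :
    Qm S v w1 κ F - Qm S v w0 κ F ≤ κ * ε := by
  induction κ with
  | zero => simp [Qm]
  | succ κ ih =>
    simp only [Qm]
    have hstep : ∀ s, Qm S v w1 κ (fun x => F (Fin.cons (v s) x)) - Qm S v w0 κ (fun x => F (Fin.cons (v s) x)) ≤ κ * ε := by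
      intro s
      refine ih _ fun i x hx => ?_
      have := hF i.succ (Fin.cons (v s) x) (fun j => by
        refine Fin.cases ?_ (fun l => ?_) j
        · simpa using hv s
        · simpa using hx l)
      simpa [Fin.cons_update] using this
    have hlast : Qm S v w1 κ (fun x => ∑ s ∈ Finset.range S, (w1 s - w0 s) * F (Fin.cons (v s) x)) ≤ ε := by
      rw [← Qm_const S v w1 h1 κ ε]
      refine Qm_mono S v w1 hv hw1 κ _ _ fun x hx => ?_
      have := hF 0 (Fin.cons 0 x) (fun j => by
        refine Fin.cases ?_ (fun l => ?_) j
        · simp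
        · simpa using hx l)
      simp only [Fin.update_cons_zero] at this
      exact (le_abs_self _).trans this
    rw [Qm_sum S v w1 κ S (fun s x => (w1 s - w0 s) * F (Fin.cons (v s) x))] at hlast
    simp only [Qm_mul] at hlast
    have hsum : ∑ s ∈ Finset.range S, w0 s * (Qm S v w1 κ (fun x => F (Fin.cons (v s) x)) - Qm S v w0 κ (fun x => F (Fin.cons (v s) x))) ≤ κ * ε := by
      calc _ ≤ ∑ s ∈ Finset.range S, w0 s * (κ * ε) :=
            Finset.sum_le_sum fun s _ => mul_le_mul_of_nonneg_left (hstep s) (hw0 s)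
        _ = κ * ε := by rw [← Finset.sum_mul, h0, one_mul]
    have e : ∑ s ∈ Finset.range S, w1 s * Qm S v w1 κ (fun x => F (Fin.cons (v s) x)) -
        ∑ s ∈ Finset.range S, w0 s * Qm S v w0 κ (fun x => F (Fin.cons (v s) x)) =
        ∑ s ∈ Finset.range S, (w1 s - w0 s) * Qm S v w1 κ (fun x => F (Fin.cons (v s) x)) +
        ∑ s ∈ Finset.range S, w0 s * (Qm S v w1 κ (fun x => F (Fin.cons (v s) x)) - Qm S v w0 κ (fun x => F (Fin.cons (v s) x))) := by
      rw [← Finset.sum_sub_distrib, ← Finset.sum_add_distrib]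
      exact Finset.sum_congr rfl fun s _ => by ring
    rw [e]
    push_cast
    linarith

/-- Coefficients of the expectation as a polynomial in the transferred mass. -/
def cf {k : ℕ} (p : Fin k → ℝ) (i0 i : Fin k) : ℕ → ((Fin k → ℕ) → ℝ) → ℕ → ℝ
  | 0, f, 0 => f 0
  | 0, _, _ + 1 => 0
  | n + 1, f, 0 => ∑ j, p j * cf p i0 i n (fun M => f (M + ei j)) 0
  | n + 1, f, s + 1 => ∑ j, p j * cf p i0 i n (fun M => f (M + ei j)) (s + 1) +
      cf p i0 i n (fun M => f (M + ei i)) s - cf p i0 i n (fun M => f (M + ei i0)) s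

lemma cf_bound {k : ℕ} (p : Fin k → ℝ) (hp : p ∈ probVec k) (i0 i : Fin k) (n : ℕ)
    (f : (Fin k → ℕ) → ℝ) (hf : ∀ N, |f N| ≤ 1) (s : ℕ) :
    |cf p i0 i n f s| ≤ (n.choose s) * 2 ^ s := by
  have hav : ∀ (g : Fin k → ℝ) (B : ℝ), (∀ j, |g j| ≤ B) → |∑ j, p j * g j| ≤ B := by
    intro g B h
    calc |∑ j, p j * g j| ≤ ∑ j, |p j * g j| := Finset.abs_sum_le_sum_abs _ _
      _ ≤ ∑ j, p j * B := Finset.sum_le_sum fun j _ => by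
          rw [abs_mul, abs_of_nonneg (hp.1 j)]; exact mul_le_mul_of_nonneg_left (h j) (hp.1 j)
      _ = B := by rw [← Finset.sum_mul, hp.2, one_mul]
  induction n generalizing f s with
  | zero =>
    cases s with
    | zero => simpa [cf] using hf 0
    | succ s => simp [cf]
  | succ n ih =>
    cases s with
    | zero =>
      simp only [cf]
      have := hav (fun j => cf p i0 i n (fun M => f (M + ei j)) 0) _ (fun j => ih _ (fun N => hf _) 0)
      simpa using this
    | succ s =>
      simp only [cf]
      have h1 := hav (fun j => cf p i0 i n (fun M => f (M + ei j)) (s + 1)) _ (fun j => ih _ (fun N => hf _) (s + 1))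
      have h2 := ih (fun M => f (M + ei i)) (fun N => hf _) s
      have h3 := ih (fun M => f (M + ei i0)) (fun N => hf _) s
      rw [Nat.choose_succ_succ]
      push_cast
      rw [abs_le] at h1 h2 h3 ⊢
      have : ((n.choose s : ℝ) + n.choose (s + 1)) * 2 ^ (s + 1) = n.choose (s + 1) * 2 ^ (s + 1) + 2 * (n.choose s * 2 ^ s) := by
        ring
      rw [this]
      constructor <;> linarith [h1.1, h1.2, h2.1, h2.2, h3.1, h3.2]

lemma cf_big {k : ℕ} (p : Fin k → ℝ) (i0 i : Fin k) (n : ℕ)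
    (f : (Fin k → ℕ) → ℝ) (s : ℕ) (hs : n < s) : cf p i0 i n f s = 0 := by
  induction n generalizing f s with
  | zero =>
    cases s with
    | zero => omega
    | succ s => simp [cf]
  | succ n ih =>
    cases s with
    | zero => omega
    | succ s =>
      simp only [cf]
      rw [ih _ _ (by omega), ih _ _ (by omega)]
      simp only [ih _ _ (by omega : n < s + 1)]
      simp

lemma cf_expand {k : ℕ} (p : Fin k → ℝ) (i0 i : Fin k) (u : ℝ) (n : ℕ) (f : (Fin k → ℕ) → ℝ) :
    Ex (fun j => p j + u * ((if j = i then 1 else 0) - (if j = i0 then 1 else 0))) n f =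
      ∑ s ∈ Finset.range (n + 1), cf p i0 i n f s * u ^ s := by
  induction n generalizing f with
  | zero => simp [Ex, cf]
  | succ n ih =>
    simp only [Ex]
    have e : ∀ j : Fin k, (p j + u * ((if j = i then 1 else 0) - (if j = i0 then 1 else 0))) *
        Ex (fun j => p j + u * ((if j = i then 1 else 0) - (if j = i0 then 1 else 0))) n (fun M => f (M + ei j)) =
        p j * Ex (fun j => p j + u * ((if j = i then 1 else 0) - (if j = i0 then 1 else 0))) n (fun M => f (M + ei j)) +
        u * (if j = i then Ex (fun j => p j + u * ((if j = i then 1 else 0) - (if j = i0 then 1 else 0))) n (fun M => f (M + ei j)) else 0) -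
        u * (if j = i0 then Ex (fun j => p j + u * ((if j = i then 1 else 0) - (if j = i0 then 1 else 0))) n (fun M => f (M + ei j)) else 0) := by
      intro j
      split_ifs <;> ring
    rw [Finset.sum_congr rfl fun j _ => e j, Finset.sum_sub_distrib, Finset.sum_add_distrib,
      ← Finset.mul_sum, ← Finset.mul_sum, Finset.sum_ite_eq', Finset.sum_ite_eq']
    simp only [Finset.mem_univ, if_true, ih]
    rw [Finset.sum_range_succ' _ (n + 1)]
    simp only [cf, sub_mul, add_mul, pow_zero, mul_one, Finset.sum_sub_distrib, Finset.sum_add_distrib]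
    have h1 : ∑ j, p j * ∑ s ∈ Finset.range (n + 1), cf p i0 i n (fun M => f (M + ei j)) s * u ^ s =
        ∑ s ∈ Finset.range (n + 1), (∑ j, p j * cf p i0 i n (fun M => f (M + ei j)) (s + 1)) * u ^ (s + 1) +
          ∑ j, p j * cf p i0 i n (fun M => f (M + ei j)) 0 := by
      have h2 : ∀ j, ∑ s ∈ Finset.range (n + 1), cf p i0 i n (fun M => f (M + ei j)) s * u ^ s =
          ∑ s ∈ Finset.range (n + 1 + 1), cf p i0 i n (fun M => f (M + ei j)) s * u ^ s := by
        intro j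
        rw [Finset.sum_range_succ _ (n + 1), cf_big p i0 i n _ (n + 1) (by omega)]
        ring
      simp only [h2, Finset.mul_sum]
      rw [Finset.sum_comm, Finset.sum_range_succ' _ (n + 1)]
      simp only [pow_zero, mul_one, Finset.sum_mul, mul_assoc]
    rw [h1]
    simp only [pow_succ, Finset.mul_sum]
    have h3 : ∀ q : Fin k, ∑ s ∈ Finset.range (n + 1), u * (cf p i0 i n (fun M => f (M + ei q)) s * u ^ s) =
       ∑ s ∈ Finset.range (n + 1), cf p i0 i n (fun M => f (M + ei q)) s * (u ^ s * u) := by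
      intro q
      exact Finset.sum_congr rfl fun s _ => by ring
    rw [h3, h3]
    ring

lemma junk_decomp {k : ℕ} (s : ℝ) (r : Fin k → ℝ) (n : ℕ) (g : (Fin k → ℕ) → ℝ) :
    Ex (Fin.cons (1 - s) (fun i => s * r i) : Fin (k + 1) → ℝ) n (fun M => g (Fin.tail M)) =
      Bx s n (fun J => Ex r J g) := by
  induction n generalizing g with
  | zero => simp only [Ex, Bx]; rfl
  | succ n ih =>
    simp only [Ex, Bx]
    rw [Fin.sum_univ_succ]
    simp only [Fin.cons_zero, Fin.cons_succ]
    have e0 : ∀ M : Fin (k + 1) → ℕ, Fin.tail (M + ei 0) = Fin.tail M := by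
      intro M; funext j; simp [Fin.tail, ei_apply, Fin.succ_ne_zero]
    have e1 : ∀ (M : Fin (k + 1) → ℕ) (i : Fin k), Fin.tail (M + ei i.succ) = Fin.tail M + ei i := by
      intro M i; funext j; simp [Fin.tail, ei_apply]
    simp only [e0, e1]
    rw [ih g]
    have e2 : ∀ i, Ex (Fin.cons (1 - s) (fun i => s * r i) : Fin (k + 1) → ℝ) n (fun M => g (Fin.tail M + ei i)) =
        Bx s n (fun J => Ex r J (fun M => g (M + ei i))) := fun i => ih (fun M => g (M + ei i))
    simp only [e2]
    rw [Bx_sum s Finset.univ n (fun i J => r i * Ex r J (fun M => g (M + ei i)))]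
    simp only [Bx_mul]
    rw [Finset.mul_sum, add_comm]
    congr 1
    exact Finset.sum_congr rfl fun i _ => by ring

lemma coord_bound {k : ℕ} (S L : ℕ) (v w0 w1 : ℕ → ℝ) (hv : ∀ m, 0 ≤ v m ∧ v m ≤ 1) (hw0 : ∀ m, 0 ≤ w0 m)
    (hw1 : ∀ m, 0 ≤ w1 m) (h0 : ∑ s ∈ Finset.range S, w0 s = 1) (h1 : ∑ s ∈ Finset.range S, w1 s = 1)
    (hm : ∀ s, s ≤ L → ∑ m ∈ Finset.range S, w0 m * v m ^ s = ∑ m ∈ Finset.range S, w1 m * v m ^ s)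
    (p : Fin k → ℝ) (hp : p ∈ probVec k) (i0 i : Fin k) (N : ℕ)
    (f : (Fin k → ℕ) → ℝ) (hf : ∀ N, |f N| ≤ 1) (b : ℝ) (hb : 0 ≤ b) (hbN : b * N = L / 128) :
    |∑ m ∈ Finset.range S, (w1 m - w0 m) *
      Ex (fun j => p j + b * v m * ((if j = i then 1 else 0) - (if j = i0 then 1 else 0))) N f| ≤
      2 * Real.exp (-3 * L) := by
  simp only [cf_expand]
  have e1 : ∑ m ∈ Finset.range S, (w1 m - w0 m) * ∑ s ∈ Finset.range (N + 1), cf p i0 i N f s * (b * v m) ^ s =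
      ∑ s ∈ Finset.range (N + 1), cf p i0 i N f s * b ^ s * (∑ m ∈ Finset.range S, w1 m * v m ^ s - ∑ m ∈ Finset.range S, w0 m * v m ^ s) := by
    simp only [Finset.mul_sum, ← Finset.sum_sub_distrib]
    rw [Finset.sum_comm]
    refine Finset.sum_congr rfl fun s _ => Finset.sum_congr rfl fun m _ => ?_
    rw [mul_pow]; ring
  rw [e1]
  have hmb : ∀ w : ℕ → ℝ, (∀ m, 0 ≤ w m) → ∑ s ∈ Finset.range S, w s = 1 → ∀ s : ℕ,
      0 ≤ ∑ m ∈ Finset.range S, w m * v m ^ s ∧ ∑ m ∈ Finset.range S, w m * v m ^ s ≤ 1 := by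
    intro w hw hw1 s
    refine ⟨Finset.sum_nonneg fun m _ => mul_nonneg (hw m) (pow_nonneg (hv m).1 s), ?_⟩
    rw [← hw1]
    refine Finset.sum_le_sum fun m _ => ?_
    have := pow_le_one₀ (hv m).1 (hv m).2 (n := s)
    nlinarith [hw m]
  have hterm : ∀ s ∈ Finset.range (N + 1), |cf p i0 i N f s * b ^ s * (∑ m ∈ Finset.range S, w1 m * v m ^ s - ∑ m ∈ Finset.range S, w0 m * v m ^ s)| ≤
      2 / 64 ^ L * ((128 * b) ^ s * (1 : ℝ) ^ (N - s) * (N.choose s : ℝ)) := by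
    intro s _
    by_cases hs : s ≤ L
    · rw [hm s hs, sub_self, mul_zero, abs_zero]; positivity
    · rw [abs_mul, abs_mul, abs_of_nonneg (pow_nonneg hb s)]
      have hc := cf_bound p hp i0 i N f hf s
      have hd : |∑ m ∈ Finset.range S, w1 m * v m ^ s - ∑ m ∈ Finset.range S, w0 m * v m ^ s| ≤ 2 := by
        have a1 := hmb w1 hw1 h1 s
        have a0 := hmb w0 hw0 h0 s
        rw [abs_le]; constructor <;> linarith [a1.1, a1.2, a0.1, a0.2]
      have h64 : (64 : ℝ) ^ L ≤ 64 ^ s := pow_le_pow_right₀ (by norm_num) (by omega)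
      calc |cf p i0 i N f s| * b ^ s * |_| ≤ (N.choose s * 2 ^ s) * b ^ s * 2 := by gcongr
        _ = 2 / 64 ^ L * ((2 * b) ^ s * 64 ^ L * (N.choose s : ℝ)) := by
            rw [mul_pow]; field_simp
        _ ≤ 2 / 64 ^ L * ((2 * b) ^ s * 64 ^ s * (N.choose s : ℝ)) := by gcongr
        _ = _ := by
            have e5 : (128 : ℝ) * b = 2 * b * 64 := by ring
            rw [one_pow, mul_one, e5, mul_pow (2 * b) 64]
  refine (Finset.abs_sum_le_sum_abs _ _).trans ((Finset.sum_le_sum hterm).trans ?_)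
  rw [← Finset.mul_sum, ← add_pow]
  have h2 : (128 * b + 1) ^ N ≤ Real.exp L := by
    calc (128 * b + 1) ^ N ≤ (Real.exp (128 * b)) ^ N := by
          gcongr; exact Real.add_one_le_exp _
      _ = Real.exp L := by rw [← Real.exp_nat_mul]; congr 1; linarith
  have h3 : Real.exp (4 * L) ≤ 64 ^ L := by
    have : Real.exp 4 ≤ 64 := by
      have : Real.exp 4 = (Real.exp 1) ^ 4 := by rw [← Real.exp_nat_mul]; norm_num
      rw [this]
      have h := Real.exp_one_lt_d9
      calc (Real.exp 1) ^ 4 ≤ (2.72 : ℝ) ^ 4 := by gcongr; linarith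
        _ ≤ 64 := by norm_num
    calc Real.exp (4 * L) = (Real.exp 4) ^ L := by rw [← Real.exp_nat_mul]; congr 1; ring
      _ ≤ 64 ^ L := by gcongr
  calc 2 / 64 ^ L * (128 * b + 1) ^ N ≤ 2 / Real.exp (4 * L) * Real.exp L := by gcongr
    _ = 2 * Real.exp (-3 * L) := by
      rw [div_mul_eq_mul_div, mul_div_assoc, ← Real.exp_sub]; congr 2; ring

/-- Extended vector with the junk atom. -/
def Zv {κ : ℕ} (ρ b : ℝ) (x : Fin κ → ℝ) : Fin (κ + 1 + 1) → ℝ :=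
  Fin.cons (1 - ρ - b * ∑ i, x i) (Fin.cons ρ (fun i => b * x i) : Fin (κ + 1) → ℝ)

lemma Zv_update {κ : ℕ} (ρ b : ℝ) (x : Fin κ → ℝ) (i : Fin κ) (t : ℝ) :
    Zv ρ b (Function.update x i t) = fun j => Zv ρ b (Function.update x i 0) j +
      b * t * ((if j = i.succ.succ then 1 else 0) - (if j = 0 then 1 else 0)) := by
  have hs : ∀ t, ∑ l, Function.update x i t l = t + ∑ l ∈ Finset.univ \ {i}, x l := by
    intro t; rw [Finset.sum_update_of_mem (Finset.mem_univ i)]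
  funext j
  refine Fin.cases ?_ (fun j => ?_) j
  · simp only [Zv, Fin.cons_zero, hs]
    rw [if_neg (Fin.succ_ne_zero _).symm]
    simp; ring
  · simp only [Zv, Fin.cons_succ]
    refine Fin.cases ?_ (fun j => ?_) j
    · simp only [Fin.cons_zero]
      rw [if_neg, if_neg (Fin.succ_ne_zero _)]
      · ring
      · intro h
        exact absurd (Fin.succ_inj.mp h).symm (Fin.succ_ne_zero i)
    · simp only [Fin.cons_succ, Fin.succ_inj, Fin.succ_ne_zero, if_false]
      by_cases h : j = i
      · subst h; simp
      · simp [h]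

lemma Zv_prob {κ : ℕ} (ρ b : ℝ) (x : Fin κ → ℝ) (hρ : 0 ≤ ρ) (hb : 0 ≤ b) (hx : ∀ i, 0 ≤ x i ∧ x i ≤ 1)
    (h : ρ + b * κ ≤ 1) : Zv ρ b x ∈ probVec (κ + 1 + 1) := by
  have hX : ∑ i, x i ≤ κ := by
    calc ∑ i, x i ≤ ∑ _i : Fin κ, (1 : ℝ) := Finset.sum_le_sum fun i _ => (hx i).2
      _ = κ := by simp
  constructor
  · intro j
    refine Fin.cases ?_ (fun j => Fin.cases ?_ (fun j => ?_) j) j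
    · simp only [Zv, Fin.cons_zero]
      have := mul_le_mul_of_nonneg_left hX hb
      linarith
    · simpa [Zv] using hρ
    · simpa [Zv] using mul_nonneg hb (hx j).1
  · rw [Fin.sum_univ_succ, Fin.sum_univ_succ]
    simp only [Zv, Fin.cons_zero, Fin.cons_succ, ← Finset.mul_sum]
    ring

/-- The normalized vector. -/
def rv {κ : ℕ} (a : ℝ) (x : Fin κ → ℝ) : Fin (κ + 1) → ℝ :=
  Fin.cons (1 / (1 + a * ∑ i, x i)) (fun i => a * x i / (1 + a * ∑ i, x i))

lemma rv_prob {κ : ℕ} (a : ℝ) (x : Fin κ → ℝ) (ha : 0 ≤ a) (hx : ∀ i, 0 ≤ x i) : rv a x ∈ probVec (κ + 1) := by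
  have hX : 0 ≤ ∑ i, x i := Finset.sum_nonneg fun i _ => hx i
  have hu : 0 < 1 + a * ∑ i, x i := by positivity
  constructor
  · intro j
    refine Fin.cases ?_ (fun j => ?_) j
    · simp only [rv, Fin.cons_zero]; positivity
    · simp only [rv, Fin.cons_succ]; exact div_nonneg (mul_nonneg ha (hx j)) hu.le
  · rw [Fin.sum_univ_succ]
    simp only [rv, Fin.cons_zero, Fin.cons_succ, ← Finset.mul_sum, ← Finset.sum_div]
    field_simp

lemma Zv_eq {κ : ℕ} (ρ a : ℝ) (x : Fin κ → ℝ) (ha : 0 ≤ a) (hx : ∀ i, 0 ≤ x i) :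
    Zv ρ (ρ * a) x = Fin.cons (1 - ρ * (1 + a * ∑ i, x i)) (fun i => (ρ * (1 + a * ∑ i, x i)) * rv a x i) := by
  have hX : 0 ≤ ∑ i, x i := Finset.sum_nonneg fun i _ => hx i
  have hu : 0 < 1 + a * ∑ i, x i := by positivity
  funext j
  refine Fin.cases ?_ (fun j => Fin.cases ?_ (fun j => ?_) j) j
  · simp only [Zv, Fin.cons_zero]; ring
  · simp only [Zv, rv, Fin.cons_zero, Fin.cons_succ]; field_simp
  · simp only [Zv, rv, Fin.cons_succ]; field_simp

lemma phi_mul (a x : ℝ) (ha : 0 < a) : phi (a * x) = a * phi x + x * phi a := by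
  simp only [phi_eq]
  by_cases h : x = 0
  · subst h; simp
  · rw [Real.log_mul ha.ne' h]; ring

lemma phi_div (y u : ℝ) (hu : 0 < u) : phi (y / u) = phi y / u + y / u * Real.log u := by
  simp only [phi_eq]
  by_cases h : y = 0
  · subst h; simp
  · rw [Real.log_div h hu.ne']; ring

lemma phi_unit (x : ℝ) (h0 : 0 ≤ x) (h1 : x ≤ 1) : 0 ≤ phi x ∧ phi x ≤ 1 := by
  rcases h0.eq_or_lt with h | h
  · rw [← h, phi_zero]; norm_num
  · constructor
    · rw [phi_eq]; nlinarith [Real.log_nonpos h0 h1]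
    · have := gibbs x 1 h one_pos
      rw [Real.log_one] at this
      linarith

lemma rv_entropy {κ : ℕ} (a : ℝ) (x : Fin κ → ℝ) (ha : 0 < a) (hx : ∀ i, 0 ≤ x i) :
    entropy (rv a x) = Real.log (1 + a * ∑ i, x i) + (phi a * ∑ i, x i + a * ∑ i, phi (x i)) / (1 + a * ∑ i, x i) := by
  have hX : 0 ≤ ∑ i, x i := Finset.sum_nonneg fun i _ => hx i
  have hu : 0 < 1 + a * ∑ i, x i := by positivity
  rw [entropy_eq, Fin.sum_univ_succ]
  simp only [rv, Fin.cons_zero, Fin.cons_succ, phi_div _ _ hu, phi_mul _ _ ha]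
  simp only [Finset.sum_add_distrib, ← Finset.sum_div, ← Finset.sum_mul, ← Finset.mul_sum]
  have : phi 1 = 0 := by simp [phi_eq]
  rw [this]
  field_simp
  ring

lemma log_lip (u u0 : ℝ) (h : 1 ≤ u) (h0 : 1 ≤ u0) : |Real.log u - Real.log u0| ≤ |u - u0| := by
  wlog hle : u0 ≤ u generalizing u u0
  · have := this u0 u h0 h (by linarith)
    rwa [abs_sub_comm, abs_sub_comm u u0]
  · rw [abs_of_nonneg (by linarith : 0 ≤ u - u0),
      abs_of_nonneg (by linarith [Real.log_le_log (by linarith) hle])]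
    rw [← Real.log_div (by linarith) (by linarith)]
    have h1 := Real.log_le_sub_one_of_pos (div_pos (by linarith : 0 < u) (by linarith : 0 < u0))
    have h2 : u / u0 - 1 = (u - u0) / u0 := by
      have : u0 ≠ 0 := by linarith
      field_simp
    rw [h2] at h1
    exact h1.trans (div_le_self (by linarith) h0)

lemma dev_bound (a c X X0 Φ Φ0 : ℝ) (ha : 0 ≤ a) (hc : 0 ≤ c) (hX : 0 ≤ X) (hX0 : 0 ≤ X0) (hΦ0 : 0 ≤ Φ0) :
    |(Real.log (1 + a * X) + (c * X + a * Φ) / (1 + a * X)) - (Real.log (1 + a * X0) + (c * X0 + a * Φ0) / (1 + a * X0))| ≤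
      (a + c + a ^ 2 * Φ0) * |X - X0| + a * |Φ - Φ0| := by
  have hu : 1 ≤ 1 + a * X := by nlinarith
  have hu0 : 1 ≤ 1 + a * X0 := by nlinarith
  have hl := log_lip _ _ hu hu0
  have e : 1 + a * X - (1 + a * X0) = a * (X - X0) := by ring
  rw [e, abs_mul, abs_of_nonneg ha] at hl
  have e2 : (c * X + a * Φ) / (1 + a * X) - (c * X0 + a * Φ0) / (1 + a * X0) =
      (c - a ^ 2 * Φ0) * (X - X0) / ((1 + a * X) * (1 + a * X0)) + a * (Φ - Φ0) / (1 + a * X) := by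
    have : 1 + a * X ≠ 0 := by linarith
    have : 1 + a * X0 ≠ 0 := by linarith
    field_simp
    ring
  have h1 : |(c - a ^ 2 * Φ0) * (X - X0) / ((1 + a * X) * (1 + a * X0))| ≤ (c + a ^ 2 * Φ0) * |X - X0| := by
    have hp : 1 ≤ (1 + a * X) * (1 + a * X0) := by nlinarith
    rw [abs_div, abs_of_nonneg (by linarith : 0 ≤ (1 + a * X) * (1 + a * X0)), abs_mul]
    have : |c - a ^ 2 * Φ0| ≤ c + a ^ 2 * Φ0 := by
      have : 0 ≤ a ^ 2 * Φ0 := by positivity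
      rw [abs_le]; constructor <;> linarith
    refine (div_le_self (by positivity) hp).trans ?_
    exact mul_le_mul_of_nonneg_right this (abs_nonneg _)
  have h2 : |a * (Φ - Φ0) / (1 + a * X)| ≤ a * |Φ - Φ0| := by
    rw [abs_div, abs_of_nonneg (by linarith : 0 ≤ 1 + a * X), abs_mul, abs_of_nonneg ha]
    exact div_le_self (by positivity) hu
  have e3 : ∀ A B C D : ℝ, (A + B) - (C + D) = (A - C) + (B - D) := by intros; ring
  rw [e3, e2]
  have := abs_add_three (Real.log (1 + a * X) - Real.log (1 + a * X0)) ((c - a ^ 2 * Φ0) * (X - X0) / ((1 + a * X) * (1 + a * X0))) (a * (Φ - Φ0) / (1 + a * X))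
  rw [← add_assoc]
  nlinarith

lemma point_bound {k n N' : ℕ} (hn : 16 ≤ n) (s : ℝ) (hs0 : 0 ≤ s) (hs1 : s ≤ 1) (hs : 2 * n ≤ N' * s)
    (r : Fin k → ℝ) (hr : r ∈ probVec k) (est : ℕ → (Fin k → ℕ) → ℝ) (R' : ℝ)
    (hest : ∀ J, n ≤ J → Ex r J (fun N => (est J N - entropy r) ^ 2) ≤ R')
    (χ : (Fin k → ℕ) → ℝ) (hχ0 : ∀ N, 0 ≤ χ N ∧ χ N ≤ 1) (h c : ℝ) (hc : 0 ≤ c)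
    (hχ : ∀ N, c * χ N ≤ (est (∑ i, N i) N - h) ^ 2) :
    c * Bx s N' (fun J => Ex r J χ) ≤ 2 * R' + 2 * (entropy r - h) ^ 2 + c / 8 := by
  have hR0 : 0 ≤ R' := le_trans (Ex_nonneg r hr.1 n _ fun N => sq_nonneg _) (hest n le_rfl)
  have hnR : (16 : ℝ) ≤ n := by exact_mod_cast hn
  have hT : 0 < N' * s := by linarith
  rw [← Bx_mul]
  have hle : Bx s N' (fun J => c * Ex r J χ) ≤
      Bx s N' (fun J => (2 * R' + 2 * (entropy r - h) ^ 2) + (c * (4 / (N' * s) ^ 2)) * ((J : ℝ) - N' * s) ^ 2) := by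
    refine Bx_mono s hs0 hs1 N' _ _ fun J _ => ?_
    by_cases hJ : n ≤ J
    · have h1 : c * Ex r J χ ≤ 2 * R' + 2 * (entropy r - h) ^ 2 := by
        rw [← Ex_mul]
        calc Ex r J (fun N => c * χ N) ≤ Ex r J (fun N => 2 * (est J N - entropy r) ^ 2 + 2 * (entropy r - h) ^ 2) := by
              refine Ex_mono r hr.1 J _ _ fun N hN => (hχ N).trans ?_
              rw [hN]
              nlinarith [sq_nonneg (est J N - entropy r - (entropy r - h))]
          _ = 2 * Ex r J (fun N => (est J N - entropy r) ^ 2) + 2 * (entropy r - h) ^ 2 := by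
              rw [Ex_add r J (fun N => 2 * (est J N - entropy r) ^ 2), Ex_mul, Ex_const r hr.2]
          _ ≤ _ := by linarith [hest J hJ]
      have : 0 ≤ (c * (4 / (N' * s) ^ 2)) * ((J : ℝ) - N' * s) ^ 2 := by positivity
      linarith
    · have h1 : Ex r J χ ≤ 1 := by
        rw [← Ex_const r hr.2 J 1]
        exact Ex_mono r hr.1 J _ _ fun N _ => (hχ0 N).2
      have hJ' : (J : ℝ) ≤ n := by exact_mod_cast (by omega : J ≤ n)
      have h2 : (N' * s / 2) ^ 2 ≤ ((J : ℝ) - N' * s) ^ 2 := by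
        rw [← sq_abs ((J : ℝ) - N' * s), abs_of_nonpos (by linarith)]
        apply pow_le_pow_left₀ (by positivity); linarith
      have h3 : 1 ≤ (4 / (N' * s) ^ 2) * ((J : ℝ) - N' * s) ^ 2 := by
        rw [div_mul_eq_mul_div, le_div_iff₀ (by positivity)]; nlinarith
      have h4 : c * Ex r J χ ≤ c * 1 := mul_le_mul_of_nonneg_left h1 hc
      have h5 := mul_le_mul_of_nonneg_left h3 hc
      nlinarith [sq_nonneg (entropy r - h)]
  refine hle.trans ?_
  rw [Bx_add s N' (fun _ => 2 * R' + 2 * (entropy r - h) ^ 2), Bx_const, Bx_mul, Bx_c2]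
  have : (c * (4 / (N' * s) ^ 2)) * (N' * s * (1 - s)) ≤ c / 8 := by
    have e : (c * (4 / (N' * s) ^ 2)) * (N' * s * (1 - s)) = c * (4 * (1 - s) / (N' * s)) := by
      field_simp
    rw [e]
    have : 4 * (1 - s) / (N' * s) ≤ 1 / 8 := by
      rw [div_le_iff₀ hT]; nlinarith
    nlinarith
  linarith

lemma exists_est {k n : ℕ} (hk : 1 ≤ k) (R' : ℝ) (hR : Rstar k n < R') :
    ∃ est : (Fin k → ℕ) → ℝ, ∀ P ∈ probVec k, Ex P n (fun N => (est N - entropy P) ^ 2) ≤ R' := by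
  by_contra hcon
  push Not at hcon
  have : R' ≤ Rstar k n := by
    refine le_Rstar hk _ fun est R h => ?_
    obtain ⟨P, hP, h2⟩ := hcon est
    linarith [h P hP]
  linarith

lemma var_unit (S : ℕ) (v w : ℕ → ℝ) (hw : ∀ m, 0 ≤ w m)
    (h1 : ∑ s ∈ Finset.range S, w s = 1) (g : ℝ → ℝ) (hg : ∀ m, 0 ≤ g (v m) ∧ g (v m) ≤ 1) (κ : ℕ) :
    Qm S v w κ (fun x => (∑ i, g (x i) - κ * ∑ s ∈ Finset.range S, w s * g (v s)) ^ 2) ≤ κ := by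
  set γ := ∑ s ∈ Finset.range S, w s * g (v s) with hγ
  have hγ0 : 0 ≤ γ := Finset.sum_nonneg fun s _ => mul_nonneg (hw s) (hg s).1
  have hγ1 : γ ≤ 1 := by
    rw [← h1]
    exact Finset.sum_le_sum fun s _ => mul_le_of_le_one_right (hw s) (hg s).2
  have := Qm_var S v w h1 g γ 1 rfl ?_ κ
  · simpa using this
  · rw [← h1]
    refine Finset.sum_le_sum fun s _ => mul_le_of_le_one_right (hw s) ?_
    have := hg s
    rw [sq_le_one_iff_abs_le_one, abs_le]
    constructor <;> linarith

lemma prior_var (S : ℕ) (v w : ℕ → ℝ) (hv : ∀ m, 0 ≤ v m ∧ v m ≤ 1) (hw : ∀ m, 0 ≤ w m)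
    (h1 : ∑ s ∈ Finset.range S, w s = 1) (κ L : ℕ) (hL : 1 ≤ L) (a : ℝ) (ha : 0 < a) (ha1 : a ≤ 1)
    (hκ : a * κ ≤ L ^ 2) (hphi : phi a ≤ 8 * a * L) (X0 Φ0 : ℝ)
    (hX0 : X0 = κ * ∑ s ∈ Finset.range S, w s * v s) (hΦ0 : Φ0 = κ * ∑ s ∈ Finset.range S, w s * phi (v s)) :
    Qm S v w κ (fun x => (entropy (rv a x) -
      (Real.log (1 + a * X0) + (phi a * X0 + a * Φ0) / (1 + a * X0))) ^ 2) ≤ 202 * κ * L ^ 4 * a ^ 2 := by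
  have hLR : (1 : ℝ) ≤ L := by exact_mod_cast hL
  have hpv : ∀ m, 0 ≤ phi (v m) ∧ phi (v m) ≤ 1 := fun m => phi_unit _ (hv m).1 (hv m).2
  have hpa := (phi_unit a ha.le ha1).1
  have hX00 : 0 ≤ X0 := by
    rw [hX0]; exact mul_nonneg (Nat.cast_nonneg _) (Finset.sum_nonneg fun s _ => mul_nonneg (hw s) (hv s).1)
  have hΦ00 : 0 ≤ Φ0 := by
    rw [hΦ0]; exact mul_nonneg (Nat.cast_nonneg _) (Finset.sum_nonneg fun s _ => mul_nonneg (hw s) (hpv s).1)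
  have hΦ01 : Φ0 ≤ κ := by
    rw [hΦ0]
    refine mul_le_of_le_one_right (Nat.cast_nonneg _) ?_
    rw [← h1]
    exact Finset.sum_le_sum fun s _ => mul_le_of_le_one_right (hw s) (hpv s).2
  have hA : a + phi a + a ^ 2 * Φ0 ≤ 10 * a * L ^ 2 := by
    have e1 : a ^ 2 * Φ0 ≤ a * L ^ 2 := by
      calc a ^ 2 * Φ0 ≤ a ^ 2 * κ := by gcongr
        _ = a * (a * κ) := by ring
        _ ≤ _ := by gcongr
    have e2 : a * L ≤ a * L ^ 2 := by gcongr; nlinarith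
    have e3 : a * 1 ≤ a * L := by gcongr
    nlinarith
  have hA0 : 0 ≤ a + phi a + a ^ 2 * Φ0 := by positivity
  have va := var_unit S v w hw h1 (fun x => x) hv κ
  have vb := var_unit S v w hw h1 phi hpv κ
  rw [← hX0] at va
  rw [← hΦ0] at vb
  calc _ ≤ Qm S v w κ (fun x => (2 * (10 * a * L ^ 2) ^ 2) * (∑ i, x i - X0) ^ 2 + (2 * a ^ 2) * (∑ i, phi (x i) - Φ0) ^ 2) := by
        refine Qm_mono S v w hv hw κ _ _ fun x hx => ?_
        rw [rv_entropy a x ha fun i => (hx i).1]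
        have hd := dev_bound a (phi a) (∑ i, x i) X0 (∑ i, phi (x i)) Φ0 ha.le hpa
          (Finset.sum_nonneg fun i _ => (hx i).1) hX00 hΦ00
        rw [← sq_abs]
        set D := |∑ i, x i - X0| with hD
        set E := |∑ i, phi (x i) - Φ0| with hE
        have hD0 : 0 ≤ D := abs_nonneg _
        have h3 : (a + phi a + a ^ 2 * Φ0) * D ≤ (10 * a * L ^ 2) * D := mul_le_mul_of_nonneg_right hA hD0
        calc _ ≤ ((10 * a * L ^ 2) * D + a * E) ^ 2 := by
              apply pow_le_pow_left₀ (abs_nonneg _); linarith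
          _ ≤ (2 * (10 * a * L ^ 2) ^ 2) * D ^ 2 + (2 * a ^ 2) * E ^ 2 := by
              nlinarith [sq_nonneg ((10 * a * L ^ 2) * D - a * E)]
          _ = _ := by rw [hD, hE, sq_abs, sq_abs]
    _ = (2 * (10 * a * L ^ 2) ^ 2) * Qm S v w κ (fun x => (∑ i, x i - X0) ^ 2) + (2 * a ^ 2) * Qm S v w κ (fun x => (∑ i, phi (x i) - Φ0) ^ 2) := by
        rw [Qm_add S v w κ (fun x => (2 * (10 * a * L ^ 2) ^ 2) * (∑ i, x i - X0) ^ 2), Qm_mul, Qm_mul]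
    _ ≤ (2 * (10 * a * L ^ 2) ^ 2) * κ + (2 * a ^ 2) * κ := by gcongr
    _ = 200 * κ * L ^ 4 * a ^ 2 + 2 * κ * 1 * a ^ 2 := by ring
    _ ≤ 200 * κ * L ^ 4 * a ^ 2 + 2 * κ * L ^ 4 * a ^ 2 := by
        have : (1 : ℝ) ≤ L ^ 4 := one_le_pow₀ hLR
        gcongr
    _ = _ := by ring

set_option maxHeartbeats 1000000 in
lemma B2_core (κ L n : ℕ) (hL : 1 ≤ L) (hn : 16 ≤ n) (a : ℝ) (ha : a = L / (256 * n)) (ha1 : a ≤ 1)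
    (hκ : a * κ ≤ L ^ 2) (hκ3 : a * κ * (3 / L ^ 2) ≤ 1) (hε : κ * (2 * Real.exp (-3 * L)) ≤ 1 / 2)
    (hphi : phi a ≤ 8 * a * L) :
    (a * κ / (1000 * L ^ 2)) ^ 2 / 16 ≤ 4 * Rstar (κ + 1) n + 808 * κ * L ^ 4 * a ^ 2 := by
  have hLR : (1 : ℝ) ≤ L := by exact_mod_cast hL
  have hnR : (16 : ℝ) ≤ n := by exact_mod_cast hn
  have ha0 : 0 < a := by rw [ha]; positivity
  obtain ⟨S, v, w0, w1, hv, hw0, hw1, h0, h1, hm, hmu, hgap⟩ := dual_exists L hL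
  have hm1 := hm 1 hL
  simp only [pow_one] at hm1
  have hpv : ∀ m, 0 ≤ phi (v m) ∧ phi (v m) ≤ 1 := fun m => phi_unit _ (hv m).1 (hv m).2
  set μ := ∑ s ∈ Finset.range S, w0 s * v s with hμ
  set β0 := ∑ s ∈ Finset.range S, w0 s * phi (v s) with hβ0
  set β1 := ∑ s ∈ Finset.range S, w1 s * phi (v s) with hβ1
  have hμ0 : 0 ≤ μ := Finset.sum_nonneg fun s _ => mul_nonneg (hw0 s) (hv s).1
  set H0 := Real.log (1 + a * (κ * μ)) + (phi a * (κ * μ) + a * (κ * β0)) / (1 + a * (κ * μ)) with hH0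
  set H1 := Real.log (1 + a * (κ * μ)) + (phi a * (κ * μ) + a * (κ * β1)) / (1 + a * (κ * μ)) with hH1
  have hV0 := prior_var S v w0 hv hw0 h0 κ L hL a ha0 ha1 hκ hphi (κ * μ) (κ * β0) rfl rfl
  have hV1 := prior_var S v w1 hv hw1 h1 κ L hL a ha0 ha1 hκ hphi (κ * μ) (κ * β1) (by rw [← hm1]) rfl
  rw [← hH0] at hV0
  rw [← hH1] at hV1
  have hu0 : 0 ≤ a * (κ * μ) := by positivity
  have hu1 : a * (κ * μ) ≤ 1 := by
    calc a * (κ * μ) = a * κ * μ := by ring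
      _ ≤ a * κ * (3 / L ^ 2) := by gcongr
      _ ≤ 1 := hκ3
  have hd : a * κ / (1000 * L ^ 2) ≤ H1 - H0 := by
    have e : H1 - H0 = a * κ * (β1 - β0) / (1 + a * (κ * μ)) := by
      rw [hH0, hH1]; field_simp; ring
    rw [e, le_div_iff₀ (by linarith)]
    calc a * κ / (1000 * L ^ 2) * (1 + a * (κ * μ)) ≤ a * κ / (1000 * L ^ 2) * 2 := by gcongr; linarith
      _ = a * κ * (1 / (500 * L ^ 2)) := by field_simp; ring
      _ ≤ _ := by gcongr
  have hd0 : 0 ≤ a * κ / (1000 * L ^ 2) := by positivity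
  have key : ∀ R', Rstar (κ + 1) n < R' → (H1 - H0) ^ 2 / 16 ≤ 4 * R' + 808 * κ * L ^ 4 * a ^ 2 := by
    intro R' hR'
    have hex : ∀ J, ∃ est : (Fin (κ + 1) → ℕ) → ℝ, n ≤ J → ∀ P ∈ probVec (κ + 1),
        Ex P J (fun N => (est N - entropy P) ^ 2) ≤ R' := by
      intro J
      by_cases hJ : n ≤ J
      · obtain ⟨e, he⟩ := exists_est (n := J) (by omega : 1 ≤ κ + 1) R' (lt_of_le_of_lt (Rstar_anti (by omega) hJ) hR')
        exact ⟨e, fun _ => he⟩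
      · exact ⟨fun _ => 0, fun h => absurd h hJ⟩
    choose est hest using hex
    set f : (Fin (κ + 1) → ℕ) → ℝ := fun N => if (H0 + H1) / 2 ≤ est (∑ i, N i) N then 1 else 0 with hf
    have hf01 : ∀ N, 0 ≤ f N ∧ f N ≤ 1 := by
      intro N; simp only [hf]; split_ifs <;> norm_num
    set ρ : ℝ := 1 / (1 + L ^ 2) with hρ
    have hρ0 : 0 < ρ := by positivity
    set N' : ℕ := 2 * n * (1 + L ^ 2) with hN'
    have hρN : (N' : ℝ) * ρ = 2 * n := by
      rw [hN', hρ]; push_cast; field_simp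
    set F : (Fin κ → ℝ) → ℝ := fun x => Ex (Zv ρ (ρ * a) x) N' (fun M => f (Fin.tail M)) with hF
    have hρ1 : ρ + ρ * a * κ ≤ 1 := by
      have : ρ * (1 + L ^ 2) = 1 := by rw [hρ]; field_simp
      nlinarith
    have hFeq : ∀ x : Fin κ → ℝ, (∀ i, 0 ≤ x i ∧ x i ≤ 1) →
        F x = Bx (ρ * (1 + a * ∑ i, x i)) N' (fun J => Ex (rv a x) J f) := by
      intro x hx
      simp only [hF]
      rw [Zv_eq ρ a x ha0.le fun i => (hx i).1, junk_decomp]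
    have hsx : ∀ x : Fin κ → ℝ, (∀ i, 0 ≤ x i ∧ x i ≤ 1) → ρ ≤ ρ * (1 + a * ∑ i, x i) ∧ ρ * (1 + a * ∑ i, x i) ≤ 1 := by
      intro x hx
      have hX0 : 0 ≤ ∑ i, x i := Finset.sum_nonneg fun i _ => (hx i).1
      have hX : ∑ i, x i ≤ κ := by
        calc ∑ i, x i ≤ ∑ _i : Fin κ, (1 : ℝ) := Finset.sum_le_sum fun i _ => (hx i).2
          _ = κ := by simp
      constructor
      · have : 0 ≤ ρ * (a * ∑ i, x i) := by positivity
        linarith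
      · have : ρ * a * ∑ i, x i ≤ ρ * a * κ := by gcongr
        linarith
    set c := (H1 - H0) ^ 2 / 4 with hc
    have hc0 : 0 ≤ c := by positivity
    have hle : H0 ≤ H1 := by linarith
    have p0 : ∀ x : Fin κ → ℝ, (∀ i, 0 ≤ x i ∧ x i ≤ 1) → c * F x ≤ (2 * R' + c / 8) + 2 * (entropy (rv a x) - H0) ^ 2 := by
      intro x hx
      obtain ⟨hs1, hs2⟩ := hsx x hx
      have hr := rv_prob a x ha0.le fun i => (hx i).1
      rw [hFeq x hx]
      have := point_bound (N' := N') hn (ρ * (1 + a * ∑ i, x i)) (by linarith) hs2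
        (by rw [← hρN]; gcongr) (rv a x) hr est R' (fun J hJ => hest J hJ _ hr) f hf01 H0 c hc0
        (fun N => (lecam_pt (est (∑ i, N i) N) H0 H1 hle).1)
      linarith
    have p1 : ∀ x : Fin κ → ℝ, (∀ i, 0 ≤ x i ∧ x i ≤ 1) → c * (1 - F x) ≤ (2 * R' + c / 8) + 2 * (entropy (rv a x) - H1) ^ 2 := by
      intro x hx
      obtain ⟨hs1, hs2⟩ := hsx x hx
      have hr := rv_prob a x ha0.le fun i => (hx i).1
      have := point_bound (N' := N') hn (ρ * (1 + a * ∑ i, x i)) (by linarith) hs2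
        (by rw [← hρN]; gcongr) (rv a x) hr est R' (fun J hJ => hest J hJ _ hr) (fun N => 1 - f N)
        (fun N => ⟨by linarith [(hf01 N).2], by linarith [(hf01 N).1]⟩) H1 c hc0
        (fun N => (lecam_pt (est (∑ i, N i) N) H0 H1 hle).2)
      have e : Bx (ρ * (1 + a * ∑ i, x i)) N' (fun J => Ex (rv a x) J (fun N => 1 - f N)) = 1 - F x := by
        rw [hFeq x hx]
        simp only [Ex_sub (rv a x) _ (fun _ => 1) f, Ex_const (rv a x) hr.2]
        rw [Bx_sub _ _ (fun _ => 1), Bx_const]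
      rw [e] at this
      linarith
    have q0 : c * Qm S v w0 κ F ≤ (2 * R' + c / 8) + 2 * (202 * κ * L ^ 4 * a ^ 2) := by
      have := Qm_mono S v w0 hv hw0 κ _ _ p0
      rw [Qm_mul, Qm_add S v w0 κ (fun _ => 2 * R' + c / 8), Qm_const S v w0 h0, Qm_mul] at this
      linarith
    have q1 : c * (1 - Qm S v w1 κ F) ≤ (2 * R' + c / 8) + 2 * (202 * κ * L ^ 4 * a ^ 2) := by
      have := Qm_mono S v w1 hv hw1 κ _ _ p1
      rw [Qm_mul, Qm_sub S v w1 κ (fun _ => 1) F, Qm_const S v w1 h1, Qm_add S v w1 κ (fun _ => 2 * R' + c / 8), Qm_const S v w1 h1, Qm_mul] at this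
      linarith
    have hb : Qm S v w1 κ F - Qm S v w0 κ F ≤ 1 / 2 := by
      refine (hybrid S v w0 w1 hv hw0 hw1 h0 h1 (2 * Real.exp (-3 * L)) κ F ?_).trans hε
      intro i x hx
      simp only [hF]
      refine le_of_eq_of_le (congrArg abs (Finset.sum_congr rfl fun s _ => congrArg (fun z => (w1 s - w0 s) * Ex z N' (fun M => f (Fin.tail M))) (Zv_update ρ (ρ * a) x i (v s)))) ?_
      refine coord_bound S L v w0 w1 hv hw0 hw1 h0 h1 hm _ (Zv_prob ρ (ρ * a) _ hρ0.le (by positivity) ?_ hρ1) 0 i.succ.succ N'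
        (fun M => f (Fin.tail M)) (fun N => ?_) (ρ * a) (by positivity) ?_
      · intro j
        by_cases h : j = i
        · subst h; simp
        · rw [Function.update_of_ne h]; exact hx j
      · rw [abs_le]; constructor <;> linarith [(hf01 (Fin.tail N)).1, (hf01 (Fin.tail N)).2]
      · calc ρ * a * N' = a * (N' * ρ) := by ring
          _ = L / 128 := by rw [hρN, ha]; field_simp; norm_num
    have hcb : c * (Qm S v w1 κ F - Qm S v w0 κ F) ≤ c * (1 / 2) := mul_le_mul_of_nonneg_left hb hc0
    have : (H1 - H0) ^ 2 / 16 = c / 4 := by rw [hc]; ring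
    rw [this]
    linarith
  have hfin : (H1 - H0) ^ 2 / 16 ≤ 4 * Rstar (κ + 1) n + 808 * κ * L ^ 4 * a ^ 2 := by
    refine le_of_forall_pos_le_add fun ε hε => ?_
    have := key (Rstar (κ + 1) n + ε / 4) (by linarith)
    linarith
  refine le_trans ?_ hfin
  gcongr

lemma large_k : ∃ k0 : ℕ, ∀ k : ℕ, k0 ≤ k → 4 ≤ k ∧ (10 : ℝ) ^ 14 * Real.log k ^ 8 ≤ k := by
  have h := (Real.isLittleO_pow_log_id_atTop (n := 8)).def (by norm_num : (0 : ℝ) < 1 / 10 ^ 14)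
  have h2 := tendsto_natCast_atTop_atTop (R := ℝ) |>.eventually h
  obtain ⟨k0, hk0⟩ := Filter.eventually_atTop.1 h2
  refine ⟨max k0 4, fun k hk => ⟨le_trans (le_max_right _ _) hk, ?_⟩⟩
  have := hk0 k (le_trans (le_max_left _ _) hk)
  simp only [id, Real.norm_eq_abs] at this
  rw [abs_of_nonneg (by positivity : (0 : ℝ) ≤ k), abs_of_nonneg (by positivity)] at this
  linarith

lemma lower_B2 (k n : ℕ) (hk4 : 4 ≤ k) (hk : (10 : ℝ) ^ 14 * Real.log k ^ 8 ≤ k)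
    (hn : (k : ℝ) / Real.log k ≤ n) (hn2 : (n : ℝ) ≤ k ^ 2) :
    1 / 10 ^ 15 * ((k : ℝ) / (n * Real.log k)) ^ 2 ≤ Rstar k n := by
  have hkR : (4 : ℝ) ≤ k := by exact_mod_cast hk4
  set ℓ := Real.log k with hℓ
  have hℓ1 : 1 ≤ ℓ := by
    rw [hℓ, Real.le_log_iff_exp_le (by linarith)]
    linarith [Real.exp_one_lt_d9]
  set L : ℕ := ⌈ℓ⌉₊ with hL
  have hLl : ℓ ≤ L := Nat.le_ceil _
  have hLu : (L : ℝ) ≤ 2 * ℓ := by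
    have := Nat.ceil_lt_add_one (by linarith : 0 ≤ ℓ)
    linarith
  have hLR : (1 : ℝ) ≤ L := by linarith
  have hL1 : 1 ≤ L := by exact_mod_cast hLR
  obtain ⟨κ, rfl⟩ : ∃ κ, k = κ + 1 := ⟨k - 1, by omega⟩
  have hκk : ((κ + 1 : ℕ) : ℝ) = κ + 1 := by push_cast; ring
  set K : ℝ := ((κ + 1 : ℕ) : ℝ) with hK
  have hκ2 : K ≤ 2 * κ := by linarith
  have hℓ8 : ℓ ≤ ℓ ^ 8 := le_self_pow₀ hℓ1 (by norm_num)
  have hℓ28 : ℓ ^ 2 ≤ ℓ ^ 8 := pow_le_pow_right₀ hℓ1 (by norm_num)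
  have hkn : K ≤ n * ℓ := by rwa [div_le_iff₀ (by linarith)] at hn
  have hnℓ : 10 ^ 14 * ℓ ≤ n := by
    refine le_trans ?_ hn
    rw [le_div_iff₀ (by linarith)]
    nlinarith
  have hnR : (16 : ℝ) ≤ n := by linarith
  have hn16 : 16 ≤ n := by exact_mod_cast hnR
  have hnpos : (0 : ℝ) < n := by linarith
  have hκ0 : (0 : ℝ) < κ := by linarith
  set a : ℝ := L / (256 * n) with ha
  have ha0 : 0 < a := by positivity
  have ha1 : a ≤ 1 := by
    rw [ha, div_le_one (by positivity)]; linarith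
  have haκ : a * κ ≤ L ^ 2 / 256 := by
    rw [ha, div_mul_eq_mul_div, div_le_div_iff₀ (by positivity) (by norm_num)]
    have h1 : (κ : ℝ) ≤ n * L := by
      calc (κ : ℝ) ≤ n * ℓ := by linarith
        _ ≤ n * L := by gcongr
    have := mul_le_mul_of_nonneg_left h1 (by positivity : (0 : ℝ) ≤ L)
    nlinarith
  have hlog : Real.log (256 * n / L) ≤ 8 * L := by
    have h1 : Real.log (256 * n / L) ≤ Real.log (256 * K ^ 2) := by
      apply Real.log_le_log (by positivity)
      rw [div_le_iff₀ (by positivity)]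
      nlinarith
    have h2 : Real.log (256 * K ^ 2) = 8 * Real.log 2 + 2 * ℓ := by
      rw [Real.log_mul (by norm_num) (by positivity), Real.log_pow, (by norm_num : (256 : ℝ) = 2 ^ 8), Real.log_pow]
      push_cast; ring
    have := Real.log_two_lt_d9
    linarith
  have hphi : phi a ≤ 8 * a * L := by
    have e : Real.log a = - Real.log (256 * n / L) := by
      rw [← Real.log_inv, inv_div]
    rw [phi_eq, e]
    have := mul_le_mul_of_nonneg_left hlog ha0.le
    linarith
  have hexp : κ * (2 * Real.exp (-3 * L)) ≤ 1 / 2 := by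
    have h1 : Real.exp (-3 * L) ≤ 1 / K ^ 2 := by
      calc Real.exp (-3 * L) ≤ Real.exp (-(2 * ℓ)) := by
            apply Real.exp_le_exp.2; linarith
        _ = 1 / K ^ 2 := by
            rw [Real.exp_neg, two_mul, Real.exp_add, hℓ, Real.exp_log (by linarith)]
            field_simp
    calc κ * (2 * Real.exp (-3 * L)) ≤ K * (2 * (1 / K ^ 2)) := by gcongr; linarith
      _ = 2 / K := by field_simp
      _ ≤ 1 / 2 := by rw [div_le_div_iff₀ (by linarith) (by norm_num)]; linarith
  have core := B2_core κ L n hL1 hn16 a ha ha1 (by nlinarith) (by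
    calc a * κ * (3 / L ^ 2) ≤ L ^ 2 / 256 * (3 / L ^ 2) := by gcongr
      _ = 3 / 256 := by field_simp
      _ ≤ 1 := by norm_num) hexp hphi
  have hL8 : 25856000000 * (L : ℝ) ^ 8 ≤ κ := by
    have : (L : ℝ) ^ 8 ≤ (2 * ℓ) ^ 8 := by gcongr
    have e : (2 * ℓ) ^ 8 = 256 * ℓ ^ 8 := by ring
    have h0 : 0 ≤ ℓ ^ 8 := by positivity
    rw [e] at this
    linarith
  have hvar : 808 * κ * L ^ 4 * a ^ 2 ≤ (a * κ / (1000 * L ^ 2)) ^ 2 / 32 := by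
    rw [div_pow (a * κ), div_div, le_div_iff₀ (by positivity)]
    calc 808 * κ * L ^ 4 * a ^ 2 * ((1000 * L ^ 2) ^ 2 * 32) = (a ^ 2 * κ) * (25856000000 * (L : ℝ) ^ 8) := by ring
      _ ≤ (a ^ 2 * κ) * κ := by gcongr
      _ = _ := by ring
  have hR : (a * κ / (1000 * L ^ 2)) ^ 2 / 128 ≤ Rstar (κ + 1) n := by linarith
  refine le_trans ?_ hR
  have e : a * κ / (1000 * L ^ 2) = κ / (256000 * n * L) := by
    rw [ha]; field_simp; norm_num
  have h2 : K / (n * ℓ) / 1024000 ≤ κ / (256000 * n * L) := by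
    rw [div_div, div_le_div_iff₀ (by positivity) (by positivity)]
    calc K * (256000 * n * L) ≤ (2 * κ) * (256000 * n * (2 * ℓ)) := by gcongr
      _ = _ := by ring
  rw [e]
  calc 1 / 10 ^ 15 * (K / (n * ℓ)) ^ 2 ≤ (K / (n * ℓ) / 1024000) ^ 2 / 128 := by
        have : 0 ≤ (K / (n * ℓ)) ^ 2 := by positivity
        rw [div_pow (K / (n * ℓ)) 1024000]; linarith
    _ ≤ _ := by gcongr

lemma lower_all : ∃ C1 : ℝ, 0 < C1 ∧ ∀ k n : ℕ, 2 ≤ k → 1 ≤ n → (k : ℝ) / Real.log k ≤ n →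
    C1 * (((k : ℝ) / (n * Real.log k)) ^ 2 + Real.log k ^ 2 / n) ≤ Rstar k n := by
  obtain ⟨k0, hk0⟩ := large_k
  set M : ℝ := (k0 : ℝ) ^ 2 + 1 with hM
  set c : ℝ := min (1 / 10 ^ 15) (1 / (2304 * (16 * M))) with hc
  have hM1 : 1 ≤ M := by rw [hM]; nlinarith [sq_nonneg (k0 : ℝ)]
  have hc0 : 0 < c := lt_min (by norm_num) (by positivity)
  refine ⟨min c (1 / 2304) / 2, by positivity, fun k n hk hn hkn => ?_⟩
  have hB1 := lower_B1 hk hn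
  have hkR : (2 : ℝ) ≤ k := by exact_mod_cast hk
  have hnR : (1 : ℝ) ≤ n := by exact_mod_cast hn
  set ℓ := Real.log k with hℓ
  have hℓ2 : 1 / 2 ≤ ℓ := by
    have h1 := Real.log_le_log (by norm_num) hkR
    have := Real.log_two_gt_d9
    linarith
  have hT1 : c * ((k : ℝ) / (n * ℓ)) ^ 2 ≤ Rstar k n := by
    by_cases hcase : k0 ≤ k ∧ (n : ℝ) ≤ k ^ 2
    · obtain ⟨h4, h8⟩ := hk0 k hcase.1
      refine le_trans ?_ (lower_B2 k n h4 h8 hkn hcase.2)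
      gcongr
      exact min_le_left _ _
    · refine le_trans ?_ hB1
      have hkM : (k : ℝ) ^ 2 ≤ M * n := by
        by_cases h : k0 ≤ k
        · have : (k : ℝ) ^ 2 ≤ n := by
            by_contra h2
            exact hcase ⟨h, by linarith⟩
          nlinarith
        · have h1 : (k : ℝ) ≤ k0 := by exact_mod_cast (by omega : k ≤ k0)
          have h2 : (k : ℝ) ^ 2 ≤ k0 ^ 2 := by gcongr
          nlinarith
      have h4 : 1 ≤ 16 * ℓ ^ 4 := by
        have : (1 / 2 : ℝ) ^ 4 ≤ ℓ ^ 4 := by gcongr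
        linarith
      calc c * ((k : ℝ) / (n * ℓ)) ^ 2 ≤ 1 / (2304 * (16 * M)) * ((k : ℝ) / (n * ℓ)) ^ 2 := by
            gcongr; exact min_le_right _ _
        _ = (k : ℝ) ^ 2 * (1 / (2304 * (16 * M) * (n * ℓ) ^ 2)) := by field_simp
        _ ≤ (M * n) * (1 / (2304 * (16 * M) * (n * ℓ) ^ 2)) := by gcongr
        _ = 1 / (2304 * 16 * n * ℓ ^ 2) := by
            have : M ≠ 0 := by positivity
            have : ℓ ≠ 0 := by linarith
            field_simp
        _ ≤ ℓ ^ 2 / (2304 * n) := by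
            rw [div_le_div_iff₀ (by positivity) (by positivity)]
            have := mul_le_mul_of_nonneg_left h4 (by positivity : (0 : ℝ) ≤ 2304 * n)
            nlinarith
  have hA : min c (1 / 2304) * ((k : ℝ) / (n * ℓ)) ^ 2 ≤ Rstar k n := by
    refine le_trans ?_ hT1
    gcongr; exact min_le_left _ _
  have hB : min c (1 / 2304) * (ℓ ^ 2 / n) ≤ Rstar k n := by
    refine le_trans ?_ hB1
    calc min c (1 / 2304) * (ℓ ^ 2 / n) ≤ 1 / 2304 * (ℓ ^ 2 / n) := by gcongr; exact min_le_right _ _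
      _ = _ := by field_simp
  linarith

/-- minimax rates of entropy estimation. -/
theorem entropy_minimax_rate :
    ∃ c0 c c' C1 C2 : ℝ, 0 < c0 ∧ 0 < c ∧ 0 < c' ∧ 0 < C1 ∧ 0 < C2 ∧
      ∀ k n : ℕ, 2 ≤ k → 1 ≤ n →
        ((c0 * k / Real.log k ≤ (n : ℝ) →
            C1 * (((k : ℝ) / (n * Real.log k)) ^ 2 + (Real.log k) ^ 2 / n) ≤ Rstar k n ∧
            Rstar k n ≤ C2 * (((k : ℝ) / (n * Real.log k)) ^ 2 + (Real.log k) ^ 2 / n)) ∧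
        ((n : ℝ) ≤ c * k / Real.log k → c' ≤ Rstar k n)) := by
  obtain ⟨C1, hC1, hlow⟩ := lower_all
  refine ⟨1, 1, C1 / 4, C1, 10 ^ 11, one_pos, one_pos, by positivity, hC1, by positivity, fun k n hk hn => ⟨fun h => ?_, fun h => ?_⟩⟩
  · rw [one_mul] at h
    exact ⟨hlow k n hk hn h, upper_all hk hn h⟩
  · rw [one_mul] at h
    have hkR : (2 : ℝ) ≤ k := by exact_mod_cast hk
    have hℓ : 0 < Real.log k := Real.log_pos (by linarith)
    have hx1 : 1 ≤ (k : ℝ) / Real.log k := by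
      rw [le_div_iff₀ hℓ]
      linarith [Real.log_le_sub_one_of_pos (by linarith : (0 : ℝ) < k)]
    set m : ℕ := ⌈(k : ℝ) / Real.log k⌉₊ with hm
    have hm1 : (k : ℝ) / Real.log k ≤ m := Nat.le_ceil _
    have hm2 : (m : ℝ) ≤ 2 * (k / Real.log k) := by
      have := Nat.ceil_lt_add_one (by linarith : 0 ≤ (k : ℝ) / Real.log k)
      linarith
    have hnm : n ≤ m := by exact_mod_cast h.trans hm1
    have hmpos : (0 : ℝ) < m := by linarith
    refine le_trans ?_ (Rstar_anti (by omega) hnm)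
    refine le_trans ?_ (hlow k m hk (by omega) hm1)
    have h1 : 1 / 2 ≤ (k : ℝ) / (m * Real.log k) := by
      rw [div_le_div_iff₀ (by norm_num) (by positivity)]
      calc 1 * (m * Real.log k) ≤ 2 * (k / Real.log k) * Real.log k := by rw [one_mul]; gcongr
        _ = k * 2 := by field_simp
    have h2 : (1 / 2) ^ 2 ≤ ((k : ℝ) / (m * Real.log k)) ^ 2 := by gcongr
    have h3 : 0 ≤ Real.log k ^ 2 / m := by positivity
    calc C1 / 4 = C1 * (1 / 4) := by ring
      _ ≤ _ := by gcongr; linarith
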